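/- Let n ≥ 3, ν > n/2 − 1, 1 ≤ p < ∞, and let q satisfy (q_{ν,p})' < q < q_{ν,p}, where (q_{ν,p})' is the conjugate exponent of q_{ν,p}. Then there exists a constant C > 0 such that for every measurable F : T_{Λ_n} → ℂ with ‖F‖_{L^{p,q}_ν} < ∞, the integral defining T_ν F(z) converges absolutely for every z ∈ T_{Λ_n}, and ‖T_ν F‖_{L^{p,q}_ν} ≤ C·‖F‖_{L^{p,q}_ν}. -/

import Mathlib

open MeasureTheory Complex Set
open scoped ENNReal NNReal

noncomputable section

def lorentzQ (n : ℕ) [NeZero n] (y : Fin n → ℝ) : ℝ :=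
  y 0 ^ 2 - ∑ k ∈ Finset.univ.filter (fun k => k ≠ 0), y k ^ 2

def lorentzQC (n : ℕ) [NeZero n] (z : Fin n → ℂ) : ℂ :=
  z 0 ^ 2 - ∑ k ∈ Finset.univ.filter (fun k => k ≠ 0), z k ^ 2

def lightCone (n : ℕ) [NeZero n] : Set (Fin n → ℝ) :=
  {y | 0 < y 0 ∧ 0 < lorentzQ n y}

def tubePt (n : ℕ) (x y : Fin n → ℝ) : Fin n → ℂ :=
  fun k => (x k : ℂ) + (y k : ℂ) * Complex.I

def inTube (n : ℕ) [NeZero n] (z : Fin n → ℂ) : Prop :=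
  (fun k => (z k).im) ∈ lightCone n

def eVec (n : ℕ) [NeZero n] : Fin n → ℝ := fun k => if k = 0 then 1 else 0

def mixedNorm (n : ℕ) [NeZero n] (p q ν : ℝ) (F : (Fin n → ℂ) → ℂ) : ℝ≥0∞ :=
  (∫⁻ y in lightCone n,
      (∫⁻ x : Fin n → ℝ, (‖F (tubePt n x y)‖₊ : ℝ≥0∞) ^ p) ^ (q / p)
        * ENNReal.ofReal (lorentzQ n y ^ (ν - (n : ℝ) / 2))) ^ (1 / q)

def bergmanIntegrand (n : ℕ) [NeZero n] (ν : ℝ) (F : (Fin n → ℂ) → ℂ) (z : Fin n → ℂ)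
    (uv : (Fin n → ℝ) × (Fin n → ℝ)) : ℂ :=
  lorentzQC n (fun k => (z k - ((uv.1 k : ℂ) - (uv.2 k : ℂ) * Complex.I)) / Complex.I)
      ^ (((-(ν + (n : ℝ) / 2) : ℝ)) : ℂ)
    * F (tubePt n uv.1 uv.2)
    * ((lorentzQ n uv.2 ^ (ν - (n : ℝ) / 2) : ℝ) : ℂ)

def bergmanOp (n : ℕ) [NeZero n] (ν : ℝ) (F : (Fin n → ℂ) → ℂ) (z : Fin n → ℂ) : ℂ :=
  ∫ uv in (univ ×ˢ lightCone n : Set ((Fin n → ℝ) × (Fin n → ℝ))),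
    bergmanIntegrand n ν F z uv

def qnu (n : ℕ) (ν : ℝ) : ℝ := (ν + (n : ℝ) / 2 - 1) / ((n : ℝ) / 2 - 1)

def pSharp (p : ℝ) : ℝ := if p ≤ 2 then p else p / (p - 1)

def qtilde (n : ℕ) (ν p : ℝ) : ℝ≥0∞ :=
  if 1 < (n : ℝ) / 2 * (1 - 1 / p) then
    ENNReal.ofReal ((ν + (n : ℝ) / 2 - 1) / ((n : ℝ) / 2 * (1 - 1 / p) - 1))
  else ∞

namespace LightCone

theorem norm_integral_le_interp {X : Type*} [MeasurableSpace X] {μ : Measure X} {Φ : X → ℂ}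
    (hΦ : Integrable Φ μ) {ψ : X → ℝ} (hψ : Measurable ψ) {R : ℝ} (hR : ∀ x, |ψ x| ≤ R)
    {θ : ℝ} (hθ0 : 0 < θ) (hθ1 : θ < 1) {M₀ M₁ : ℝ}
    (h0 : ∀ t : ℝ, ‖∫ x, Φ x * cexp ((t * I - θ) * ψ x) ∂μ‖ ≤ M₀)
    (h1 : ∀ t : ℝ, ‖∫ x, Φ x * cexp ((1 + t * I - θ) * ψ x) ∂μ‖ ≤ M₁) :
    ‖∫ x, Φ x ∂μ‖ ≤ M₀ ^ (1 - θ) * M₁ ^ θ := by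
  set f : ℂ → ℂ := fun z => ∫ x, Φ x * cexp ((z - θ) * ψ x) ∂μ with hf
  have hexp : ∀ (z : ℂ) (x : X), ‖cexp ((z - θ) * ψ x)‖ ≤ Real.exp ((‖z‖ + |θ|) * R) := by
    intro z x
    rw [Complex.norm_exp]
    apply Real.exp_le_exp.2
    refine (Complex.re_le_norm _).trans ?_
    rw [norm_mul, Complex.norm_real, Real.norm_eq_abs]
    have h2 : ‖z - θ‖ ≤ ‖z‖ + |θ| := by
      refine (norm_sub_le _ _).trans ?_
      simp
    exact mul_le_mul h2 (hR x) (abs_nonneg _) (by positivity)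
  have hmeas : ∀ z : ℂ, Measurable fun x => cexp ((z - θ) * ψ x) := by
    intro z; fun_prop
  have hint : ∀ z : ℂ, Integrable (fun x => Φ x * cexp ((z - θ) * ψ x)) μ := fun z =>
    hΦ.mul_bdd (hmeas z).aestronglyMeasurable (Filter.Eventually.of_forall (hexp z))
  have hdiff : Differentiable ℂ f := by
    intro z₀
    have := hasDerivAt_integral_of_dominated_loc_of_deriv_le (μ := μ) (𝕜 := ℂ)
      (F := fun z x => Φ x * cexp ((z - θ) * ψ x))
      (F' := fun z x => Φ x * (cexp ((z - θ) * ψ x) * ψ x))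
      (bound := fun x => ‖Φ x‖ * (Real.exp ((‖z₀‖ + 1 + |θ|) * R) * R)) (x₀ := z₀)
      (s := Metric.ball z₀ 1) (Metric.ball_mem_nhds _ one_pos)
      (Filter.Eventually.of_forall fun z => (hint z).aestronglyMeasurable) (hint z₀)
      (hΦ.aestronglyMeasurable.mul (by
        apply Measurable.aestronglyMeasurable
        have := hmeas z₀
        fun_prop)) ?_ (hΦ.norm.mul_const _) ?_
    · exact this.2.differentiableAt
    · refine Filter.Eventually.of_forall fun x z hz => ?_
      have hR0 : 0 ≤ R := (abs_nonneg _).trans (hR x)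
      rw [norm_mul, norm_mul, Complex.norm_real, Real.norm_eq_abs]
      have hz' : ‖z‖ ≤ ‖z₀‖ + 1 := by
        have := norm_sub_norm_le z z₀
        rw [mem_ball_iff_norm] at hz
        linarith
      have h3 : Real.exp ((‖z‖ + |θ|) * R) ≤ Real.exp ((‖z₀‖ + 1 + |θ|) * R) := by
        apply Real.exp_le_exp.2
        gcongr
      gcongr
      · exact (hexp z x).trans h3
      · exact hR x
    · refine Filter.Eventually.of_forall fun x z _ => ?_
      refine HasDerivAt.const_mul _ ?_
      have : HasDerivAt (fun z : ℂ => (z - θ) * ψ x) (ψ x) z := by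
        simpa using ((hasDerivAt_id z).sub_const (θ : ℂ)).mul_const (ψ x : ℂ)
      exact this.cexp
  have key := HadamardThreeLines.norm_le_interp_of_mem_verticalClosedStrip₀₁' f (z := (θ : ℂ))
    (a := M₀) (b := M₁) (by simp [HadamardThreeLines.verticalClosedStrip, hθ0.le, hθ1.le])
    hdiff.diffContOnCl ?_ ?_ ?_
  · simpa [hf] using key
  · refine ⟨∫ x, ‖Φ x‖ * Real.exp ((1 + |θ|) * R) ∂μ, ?_⟩
    rintro _ ⟨z, hz, rfl⟩
    refine norm_integral_le_of_norm_le (hΦ.norm.mul_const _) (Filter.Eventually.of_forall fun x => ?_)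
    rw [norm_mul, Complex.norm_exp]
    gcongr
    have h3 : ((z - θ) * ψ x).re = (z.re - θ) * ψ x := by
      simp
    rw [h3]
    have hz2 : z.re ∈ Icc (0 : ℝ) 1 := hz
    refine (le_abs_self _).trans ?_
    rw [abs_mul]
    refine mul_le_mul ?_ (hR x) (abs_nonneg _) (by positivity)
    refine (abs_sub _ _).trans ?_
    rw [abs_of_nonneg hz2.1]
    linarith [hz2.2]
  · intro z hz
    have hz : z.re = 0 := by simpa using hz
    have : z = (z.im : ℂ) * I := by
      apply Complex.ext <;> simp [hz]
    rw [this]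
    exact h0 z.im
  · intro z hz
    have hz : z.re = 1 := by simpa using hz
    have : z = 1 + (z.im : ℂ) * I := by
      apply Complex.ext <;> simp [hz]
    rw [this]
    exact h1 z.im

theorem lintegral_lintegral_conv_mul_le {ι : Type*} [Fintype ι] {k f g : (ι → ℝ) → ℝ≥0∞}
    (hk : Measurable k) (hf : Measurable f) (hg : Measurable g) {p p' : ℝ}
    (hp : p.HolderConjugate p') :
    ∫⁻ x, ∫⁻ u, k (x - u) * f u * g x ≤
      (∫⁻ x, k x) * (∫⁻ x, f x ^ p) ^ (1 / p) * (∫⁻ x, g x ^ p') ^ (1 / p') := by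
  calc ∫⁻ x, ∫⁻ u, k (x - u) * f u * g x
      = ∫⁻ x, ∫⁻ t, k t * f (x - t) * g x := by
        refine lintegral_congr fun x => ?_
        rw [← lintegral_sub_left_eq_self _ x]
        simp
    _ = ∫⁻ t, ∫⁻ x, k t * f (x - t) * g x := by
        rw [lintegral_lintegral_swap]
        apply Measurable.aemeasurable
        fun_prop
    _ ≤ ∫⁻ t, k t * ((∫⁻ x, f x ^ p) ^ (1 / p) * (∫⁻ x, g x ^ p') ^ (1 / p')) := by
        refine lintegral_mono fun t => ?_
        simp_rw [mul_assoc]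
        rw [lintegral_const_mul _ (by fun_prop)]
        gcongr
        have h := ENNReal.lintegral_mul_le_Lp_mul_Lq (μ := volume) hp (f := fun x => f (x - t))
          (g := g) (by fun_prop) (by fun_prop)
        rwa [lintegral_sub_right_eq_self (fun x => f x ^ p) t] at h
    _ = _ := by
        rw [lintegral_mul_const _ hk, mul_assoc]

theorem lintegral_schur {X : Type*} [MeasurableSpace X] {μ : Measure X} [SFinite μ]
    {K : X → X → ℝ≥0∞} (hK : Measurable (Function.uncurry K))
    {r r' : ℝ} (hr : r.HolderConjugate r') {h : X → ℝ≥0∞} (hh : Measurable h)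
    (h0 : ∀ᵐ x ∂μ, h x ≠ 0 ∧ h x ≠ ∞) {A B : ℝ≥0∞}
    (hA : ∀ᵐ y ∂μ, ∫⁻ v, K y v * h v ^ r' ∂μ ≤ A * h y ^ r')
    (hB : ∀ᵐ v ∂μ, ∫⁻ y, K y v * h y ^ r ∂μ ≤ B * h v ^ r)
    {f : X → ℝ≥0∞} (hf : Measurable f) :
    ∫⁻ y, (∫⁻ v, K y v * f v ∂μ) ^ r ∂μ ≤ A ^ (r / r') * B * ∫⁻ v, f v ^ r ∂μ := by
  have hr0 := hr.pos
  have hr0' := hr.symm.pos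
  have hKy : ∀ y, Measurable (K y) := fun y => hK.of_uncurry_left
  have hKv : ∀ v, Measurable (fun y => K y v) := fun v => hK.of_uncurry_right
  have step : ∀ᵐ y ∂μ, (∫⁻ v, K y v * f v ∂μ) ^ r ≤
      A ^ (r / r') * ∫⁻ v, h y ^ r * (K y v * (f v / h v) ^ r) ∂μ := by
    filter_upwards [hA, h0] with y hy hy0
    have e1 : ∫⁻ v, K y v * f v ∂μ = ∫⁻ v, ((fun v => K y v ^ (1 / r) * (f v / h v)) *
        fun v => K y v ^ (1 / r') * h v) v ∂μ := by
      refine lintegral_congr_ae ?_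
      filter_upwards [h0] with v hv
      simp only [Pi.mul_apply]
      have : K y v = K y v ^ (1 / r) * K y v ^ (1 / r') := by
        rw [← ENNReal.rpow_add_of_nonneg _ _ (by positivity) (by positivity)]
        have := hr.inv_add_inv_eq_one
        rw [one_div, one_div, this, ENNReal.rpow_one]
      have h5 : f v / h v * h v = f v := ENNReal.div_mul_cancel hv.1 hv.2
      calc K y v * f v = (K y v ^ (1 / r) * K y v ^ (1 / r')) * (f v / h v * h v) := by
            rw [← this, h5]
        _ = _ := by ring
    have e2 := ENNReal.lintegral_mul_le_Lp_mul_Lq μ hr (f := fun v => K y v ^ (1 / r) * (f v / h v))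
      (g := fun v => K y v ^ (1 / r') * h v)
      (by have := hKy y; fun_prop) (by have := hKy y; fun_prop)
    rw [← e1] at e2
    have e3 : ∀ v, (K y v ^ (1 / r) * (f v / h v)) ^ r = K y v * (f v / h v) ^ r := by
      intro v
      rw [ENNReal.mul_rpow_of_nonneg _ _ hr0.le, ← ENNReal.rpow_mul, one_div_mul_cancel hr0.ne',
        ENNReal.rpow_one]
    have e4 : ∀ v, (K y v ^ (1 / r') * h v) ^ r' = K y v * h v ^ r' := by
      intro v
      rw [ENNReal.mul_rpow_of_nonneg _ _ hr0'.le, ← ENNReal.rpow_mul, one_div_mul_cancel hr0'.ne',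
        ENNReal.rpow_one]
    simp_rw [e3, e4] at e2
    calc _ ≤ ((∫⁻ v, K y v * (f v / h v) ^ r ∂μ) ^ (1 / r) * (A * h y ^ r') ^ (1 / r')) ^ r := by
          gcongr
          exact e2.trans (by gcongr)
      _ = _ := by
          rw [ENNReal.mul_rpow_of_nonneg _ _ hr0.le, ← ENNReal.rpow_mul, one_div_mul_cancel hr0.ne',
            ENNReal.rpow_one, ENNReal.mul_rpow_of_nonneg _ _ (by positivity), ← ENNReal.rpow_mul,
            mul_one_div_cancel hr0'.ne', ENNReal.rpow_one, ENNReal.mul_rpow_of_nonneg _ _ hr0.le,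
            ← ENNReal.rpow_mul, one_div_mul_eq_div, lintegral_const_mul]
          · ring
          · have := hKy y; fun_prop
  refine (lintegral_mono_ae step).trans ?_
  rw [lintegral_const_mul, lintegral_lintegral_swap, mul_assoc]
  · gcongr
    rw [← lintegral_const_mul _ (by fun_prop)]
    refine lintegral_mono_ae ?_
    filter_upwards [hB, h0] with v hv hv0
    calc ∫⁻ y, h y ^ r * (K y v * (f v / h v) ^ r) ∂μ
        = (∫⁻ y, K y v * h y ^ r ∂μ) * (f v / h v) ^ r := by
          rw [← lintegral_mul_const _ (by have := hKv v; fun_prop)]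
          refine lintegral_congr fun y => by ring
      _ ≤ B * h v ^ r * (f v / h v) ^ r := by gcongr
      _ = B * f v ^ r := by
          rw [mul_assoc, ← ENNReal.mul_rpow_of_nonneg _ _ hr0.le, ENNReal.mul_div_cancel hv0.1 hv0.2]
  · apply Measurable.aemeasurable
    have h5 : Measurable fun q : X × X => K q.1 q.2 := hK
    change Measurable fun q : X × X => h q.1 ^ r * (K q.1 q.2 * (f q.2 / h q.2) ^ r)
    fun_prop
  · apply Measurable.lintegral_prod_right'
      (f := fun q : X × X => h q.1 ^ r * (K q.1 q.2 * (f q.2 / h q.2) ^ r))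
    have h5 : Measurable fun q : X × X => K q.1 q.2 := hK
    fun_prop

theorem integrable_rpow_mul_cexp {s : ℝ} (hs : 0 < s) {r : ℂ} (hr : 0 < r.re) :
    IntegrableOn (fun t : ℝ => ((t ^ (s - 1) : ℝ) : ℂ) * cexp (-(r * t))) (Ioi 0) := by
  have h := integrableOn_rpow_mul_exp_neg_mul_rpow (p := 1) (s := s - 1) (b := r.re)
    (by linarith) one_pos hr
  refine Integrable.mono' h (Measurable.aestronglyMeasurable (by fun_prop)) ?_
  refine (ae_restrict_mem measurableSet_Ioi).mono fun t (ht : 0 < t) => ?_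
  rw [norm_mul, Complex.norm_exp, Complex.norm_real, Real.norm_of_nonneg (by positivity)]
  simp

theorem integral_rpow_mul_cexp {s : ℝ} (hs : 0 < s) {r : ℂ} (hr : 0 < r.re) :
    ∫ t in Ioi (0 : ℝ), ((t ^ (s - 1) : ℝ) : ℂ) * cexp (-(r * t)) =
      Real.Gamma s * r ^ (-(s : ℂ)) := by
  set U : Set ℂ := {z | 0 < z.re} with hU
  have hUo : IsOpen U := isOpen_lt continuous_const Complex.continuous_re
  have hUc : IsPreconnected U := (convex_halfSpace_re_gt 0).isPreconnected
  set f : ℂ → ℂ := fun r => ∫ t in Ioi (0 : ℝ), ((t ^ (s - 1) : ℝ) : ℂ) * cexp (-(r * t))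
  set g : ℂ → ℂ := fun r => Real.Gamma s * r ^ (-(s : ℂ))
  have hf : DifferentiableOn ℂ f U := by
    intro z₀ (hz₀ : 0 < z₀.re)
    have hb := (integrable_rpow_mul_cexp (s := s + 1) (by linarith) (r := (z₀.re / 2 : ℝ))
      (by simpa using hz₀)).norm
    have := hasDerivAt_integral_of_dominated_loc_of_deriv_le (μ := volume.restrict (Ioi (0 : ℝ)))
      (𝕜 := ℂ) (F := fun z (t : ℝ) => ((t ^ (s - 1) : ℝ) : ℂ) * cexp (-(z * t)))
      (F' := fun z t => ((t ^ (s - 1) : ℝ) : ℂ) * (cexp (-(z * t)) * -(t : ℂ)))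
      (x₀ := z₀) (s := Metric.ball z₀ (z₀.re / 2)) (bound := _)
      (Metric.ball_mem_nhds _ (by positivity))
      (Filter.Eventually.of_forall fun z => Measurable.aestronglyMeasurable (by fun_prop))
      (integrable_rpow_mul_cexp hs hz₀)
      (Measurable.aestronglyMeasurable (by fun_prop)) ?_ hb ?_
    · exact this.2.differentiableAt.differentiableWithinAt
    · refine (ae_restrict_mem measurableSet_Ioi).mono fun t (ht : 0 < t) z hz => ?_
      have hz' : z₀.re / 2 ≤ z.re := by
        have h1 : |(z - z₀).re| ≤ ‖z - z₀‖ := Complex.abs_re_le_norm _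
        rw [mem_ball_iff_norm] at hz
        rw [Complex.sub_re] at h1
        linarith [(abs_le.1 h1).1]
      simp only [norm_mul, Complex.norm_exp, Complex.norm_real, norm_neg, add_sub_cancel_right]
      have h2 : |t ^ s| = |t ^ (s - 1)| * |t| := by
        rw [← abs_mul, Real.rpow_sub_one ht.ne', div_mul_cancel₀ _ ht.ne']
      simp only [Real.norm_eq_abs, h2]
      rw [mul_assoc, mul_comm |t|]
      refine mul_le_mul_of_nonneg_left (mul_le_mul_of_nonneg_right (Real.exp_le_exp.2 ?_)
        (abs_nonneg _)) (abs_nonneg _)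
      have h3 := mul_le_mul_of_nonneg_right hz' ht.le
      simp only [Complex.neg_re, Complex.mul_re, Complex.ofReal_re, Complex.ofReal_im, mul_zero,
        sub_zero]
      linarith
    · refine (ae_restrict_mem measurableSet_Ioi).mono fun t (ht : 0 < t) z _ => ?_
      refine HasDerivAt.const_mul _ ?_
      have : HasDerivAt (fun z : ℂ => -(z * t)) (-(t : ℂ)) z := by
        have h3 := ((hasDerivAt_id z).mul_const (t : ℂ)).neg
        rw [one_mul] at h3
        exact h3
      exact this.cexp
  have hg : DifferentiableOn ℂ g U := by
    intro z (hz : 0 < z.re)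
    refine ((DifferentiableAt.cpow_const (by fun_prop) (Or.inl hz)).const_mul
      _).differentiableWithinAt
  have hreal : ∀ x : ℝ, 0 < x → f x = g x := by
    intro x hx
    have h := Complex.integral_cpow_mul_exp_neg_mul_Ioi (a := s) (by simpa using hs) hx
    have h2 : f x = ∫ (t : ℝ) in Ioi 0, (t : ℂ) ^ ((s : ℂ) - 1) * cexp (-(x * t)) := by
      refine setIntegral_congr_fun measurableSet_Ioi fun t (ht : 0 < t) => ?_
      rw [Complex.ofReal_cpow ht.le]
      push_cast
      rfl
    rw [h2, h]
    simp only [g]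
    rw [Complex.Gamma_ofReal, mul_comm, one_div, Complex.inv_cpow _ _, Complex.cpow_neg]
    rw [Complex.arg_ofReal_of_nonneg hx.le]
    exact Real.pi_pos.ne
  have hfreq : ∃ᶠ z in nhdsWithin (1 : ℂ) {1}ᶜ, f z = g z := by
    have ht : Filter.Tendsto (fun k : ℕ => (((1 : ℝ) + 1 / ((k : ℝ) + 1) : ℝ) : ℂ)) Filter.atTop
        (nhdsWithin (1 : ℂ) {1}ᶜ) := by
      refine tendsto_nhdsWithin_iff.2 ⟨?_, Filter.Eventually.of_forall fun k => ?_⟩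
      · have := (tendsto_one_div_add_atTop_nhds_zero_nat (𝕜 := ℝ)).const_add 1
        rw [add_zero] at this
        exact (Complex.continuous_ofReal.tendsto _).comp this
      · have : (0 : ℝ) < 1 / ((k : ℝ) + 1) := by positivity
        simp only [mem_compl_iff, mem_singleton_iff]
        intro h
        have h2 : (1 : ℝ) + 1 / ((k : ℝ) + 1) = 1 := by exact_mod_cast h
        linarith
    refine ht.frequently (Filter.Frequently.of_forall fun k => hreal _ ?_)
    positivity
  exact (hf.analyticOnNhd hUo).eqOn_of_preconnected_of_frequently_eq (hg.analyticOnNhd hUo) hUc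
    (by simp [hU] : (1 : ℂ) ∈ U) hfreq hr

theorem integrable_gaussian {ι : Type*} [Fintype ι] {b : ℝ} (hb : 0 < b) :
    Integrable fun x : ι → ℝ => Real.exp (-b * ∑ i, x i ^ 2) := by
  have h := (GaussianFourier.integrable_cexp_neg_mul_sum_add (ι := ι) (b := b) (by simpa using hb)
    0).norm
  refine h.congr (Filter.Eventually.of_forall fun x => ?_)
  simp only [Complex.norm_exp]
  congr 1
  simp only [Pi.zero_apply, zero_mul, Finset.sum_const_zero, add_zero]
  norm_cast

theorem integral_gaussian_pi {ι : Type*} [Fintype ι] {b : ℝ} (hb : 0 < b) :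
    ∫ x : ι → ℝ, Real.exp (-b * ∑ i, x i ^ 2) = (Real.pi / b) ^ (Fintype.card ι / 2 : ℝ) := by
  have h := GaussianFourier.integral_cexp_neg_mul_sum_add (ι := ι) (b := b) (by simpa using hb) 0
  have h2 : ((∫ x : ι → ℝ, Real.exp (-b * ∑ i, x i ^ 2) : ℝ) : ℂ) =
      ((Real.pi / b) ^ (Fintype.card ι / 2 : ℝ) : ℝ) := by
    rw [← integral_complex_ofReal, Complex.ofReal_cpow (by positivity)]
    push_cast
    simpa using h
  exact_mod_cast h2

/-- The character `x ↦ exp (i ξ·x)`. -/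
def chr {ι : Type*} [Fintype ι] (ξ x : ι → ℝ) : ℂ := cexp (((∑ i, ξ i * x i : ℝ) : ℂ) * I)

section chr

variable {ι : Type*} [Fintype ι]

theorem norm_chr (ξ x : ι → ℝ) : ‖chr ξ x‖ = 1 := Complex.norm_exp_ofReal_mul_I _

theorem chr_mul_conj (ξ x y : ι → ℝ) :
    chr ξ x * (starRingEnd ℂ) (chr ξ y) = chr ξ (x - y) := by
  unfold chr
  rw [← Complex.exp_conj, ← Complex.exp_add]
  congr 1
  simp only [map_mul, Complex.conj_ofReal, Complex.conj_I, Pi.sub_apply, mul_sub,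
    Finset.sum_sub_distrib]
  push_cast
  ring

@[fun_prop]
theorem continuous_chr : Continuous fun z : (ι → ℝ) × (ι → ℝ) => chr z.1 z.2 := by
  unfold chr
  fun_prop

@[fun_prop]
theorem measurable_chr : Measurable fun z : (ι → ℝ) × (ι → ℝ) => chr z.1 z.2 :=
  continuous_chr.measurable

theorem integrable_chr_comp_mul {X : Type*} [MeasurableSpace X] {μ : Measure X} {g : X → ℂ}
    (hg : Integrable g μ) {u v : X → ι → ℝ} (hu : Measurable u) (hv : Measurable v) :
    Integrable (fun a => chr (u a) (v a) * g a) μ :=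
  hg.bdd_mul (measurable_chr.comp (hu.prodMk hv)).aestronglyMeasurable
    (Filter.Eventually.of_forall fun _ => (norm_chr _ _).le)

theorem integral_chr_gaussian {ε : ℝ} (hε : 0 < ε) (t : ι → ℝ) :
    ∫ ξ : ι → ℝ, chr ξ t * (Real.exp (-ε * ∑ i, ξ i ^ 2) : ℂ) =
      (((Real.pi / ε) ^ (Fintype.card ι / 2 : ℝ) *
        Real.exp (-(1 / (4 * ε)) * ∑ i, t i ^ 2) : ℝ) : ℂ) := by
  have h := GaussianFourier.integral_cexp_neg_mul_sum_add (ι := ι) (b := ε) (by simpa using hε)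
    (fun i => t i * I)
  push_cast
  rw [Complex.ofReal_cpow (by positivity)]
  push_cast
  convert h using 2
  · ext ξ
    unfold chr
    rw [← Complex.exp_add]
    congr 1
    push_cast
    rw [Finset.sum_mul, add_comm]
    congr 1
    refine Finset.sum_congr rfl fun i _ => by ring
  · simp only [mul_pow, Complex.I_sq, mul_neg, mul_one, Finset.sum_neg_distrib]
    congr 1
    field_simp

theorem measurable_fourier {h : (ι → ℝ) → ℂ} (hm : Measurable h) :
    Measurable fun ξ : ι → ℝ => ∫ x : ι → ℝ, chr ξ x * h x := by
  have : StronglyMeasurable fun z : (ι → ℝ) × (ι → ℝ) => chr z.1 z.2 * h z.2 :=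
    Measurable.stronglyMeasurable (by fun_prop)
  exact this.integral_prod_right.measurable

theorem lintegral_fourier_sq_mul_gaussian_le {h : (ι → ℝ) → ℂ} (hm : Measurable h)
    (hi : Integrable h) {ε : ℝ} (hε : 0 < ε) :
    ∫⁻ ξ : ι → ℝ, ‖∫ x : ι → ℝ, chr ξ x * h x‖ₑ ^ (2 : ℝ) *
        ENNReal.ofReal (Real.exp (-ε * ∑ i, ξ i ^ 2)) ≤
      ENNReal.ofReal ((2 * Real.pi) ^ Fintype.card ι) * ∫⁻ x, ‖h x‖ₑ ^ (2 : ℝ) := by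
  set H : (ι → ℝ) → ℂ := fun ξ => ∫ x : ι → ℝ, chr ξ x * h x with hH
  set γ : (ι → ℝ) → ℝ := fun ξ => Real.exp (-ε * ∑ i, ξ i ^ 2) with hγ
  set G : (ι → ℝ) → ℝ := fun t => (Real.pi / ε) ^ (Fintype.card ι / 2 : ℝ) *
        Real.exp (-(1 / (4 * ε)) * ∑ i, t i ^ 2) with hG
  have hγi : Integrable γ := integrable_gaussian hε
  have hγm : Measurable γ := by fun_prop
  have hHm : Measurable H := measurable_fourier hm
  have hHb : ∀ ξ, ‖H ξ‖ ≤ ∫ x, ‖h x‖ := fun ξ => by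
    refine (norm_integral_le_integral_norm _).trans (le_of_eq ?_)
    simp [norm_chr]
  have hi2 : Integrable fun ξ => ‖H ξ‖ ^ 2 * γ ξ :=
    hγi.bdd_mul (c := (∫ x, ‖h x‖) ^ 2) (by fun_prop)
      (Filter.Eventually.of_forall fun ξ => by
        rw [norm_pow, norm_norm]
        have := hHb ξ
        gcongr)
  have e1 : ∫⁻ ξ : ι → ℝ, ‖H ξ‖ₑ ^ (2 : ℝ) * ENNReal.ofReal (γ ξ) =
      ‖((∫ ξ, ‖H ξ‖ ^ 2 * γ ξ : ℝ) : ℂ)‖ₑ := by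
    have hnn : 0 ≤ ∫ ξ, ‖H ξ‖ ^ 2 * γ ξ := integral_nonneg fun ξ => by positivity
    rw [← ofReal_norm, Complex.norm_real, Real.norm_of_nonneg hnn,
      ofReal_integral_eq_lintegral_ofReal hi2 (Filter.Eventually.of_forall fun ξ => by positivity)]
    refine lintegral_congr fun ξ => ?_
    rw [ENNReal.ofReal_mul (by positivity), ENNReal.ofReal_pow (by positivity), ofReal_norm]
    norm_cast
  have hinner : ∀ x : ι → ℝ, ∫ ξ, chr ξ x * ((starRingEnd ℂ) (H ξ) * (γ ξ : ℂ)) =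
      ∫ x', (starRingEnd ℂ) (h x') * (G (x - x') : ℂ) := by
    intro x
    have e2 : ∀ ξ, chr ξ x * ((starRingEnd ℂ) (H ξ) * (γ ξ : ℂ)) =
        ∫ x', (starRingEnd ℂ) (h x') * (chr ξ (x - x') * (γ ξ : ℂ)) := by
      intro ξ
      rw [hH, ← integral_conj, mul_comm, mul_assoc, ← integral_mul_const]
      refine integral_congr_ae (Filter.Eventually.of_forall fun x' => ?_)
      simp only [← chr_mul_conj, map_mul]
      ring
    simp_rw [e2]
    rw [integral_integral_swap]
    · refine integral_congr_ae (Filter.Eventually.of_forall fun x' => ?_)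
      simp only
      rw [integral_const_mul, integral_chr_gaussian hε]
    · have : Integrable (fun z : (ι → ℝ) × (ι → ℝ) => chr z.1 (x - z.2) *
          ((γ z.1 : ℂ) * (starRingEnd ℂ) (h z.2))) (volume.prod volume) := by
        have hc : Integrable (fun x => (starRingEnd ℂ) (h x)) :=
          Complex.conjCLE.toContinuousLinearMap.integrable_comp hi
        exact integrable_chr_comp_mul (hγi.ofReal.mul_prod (L := ℂ) hc) measurable_fst
          (measurable_const.sub measurable_snd)
      refine this.congr (Filter.Eventually.of_forall fun z => ?_)
      simp only [Function.uncurry]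
      ring
  have e3 : ((∫ ξ, ‖H ξ‖ ^ 2 * γ ξ : ℝ) : ℂ) =
      ∫ x, h x * ∫ x', (starRingEnd ℂ) (h x') * (G (x - x') : ℂ) := by
    simp_rw [← hinner, ← integral_const_mul]
    rw [integral_integral_swap]
    · rw [← integral_complex_ofReal]
      refine integral_congr_ae (Filter.Eventually.of_forall fun ξ => ?_)
      simp only
      push_cast
      rw [← Complex.mul_conj', mul_assoc]
      nth_rewrite 1 [hH]
      simp only
      rw [← integral_mul_const]
      refine integral_congr_ae (Filter.Eventually.of_forall fun x' => ?_)
      simp only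
      ring
    · have : Integrable (fun z : (ι → ℝ) × (ι → ℝ) => (chr z.2 z.1 * (starRingEnd ℂ) (H z.2)) *
          (h z.1 * (γ z.2 : ℂ))) (volume.prod volume) := by
        simp_rw [mul_assoc]
        refine integrable_chr_comp_mul ?_ measurable_snd measurable_fst
        refine (hi.mul_prod (L := ℂ) hγi.ofReal).bdd_mul (c := ∫ x, ‖h x‖) ?_ ?_
        · refine Measurable.aestronglyMeasurable ?_
          fun_prop
        · refine Filter.Eventually.of_forall fun z => ?_
          rw [RCLike.norm_conj]
          exact hHb _
      refine this.congr (Filter.Eventually.of_forall fun z => ?_)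
      simp only [Function.uncurry]
      ring
  have hGm : Measurable G := by fun_prop
  have hGl : ∫⁻ t, ‖G t‖ₑ = ENNReal.ofReal ((2 * Real.pi) ^ Fintype.card ι) := by
    have h4 : (0 : ℝ) < 1 / (4 * ε) := by positivity
    have h5 : Integrable G := (integrable_gaussian h4).const_mul _
    have h6 : ∀ t, 0 ≤ G t := fun t => by positivity
    simp_rw [← ofReal_norm, Real.norm_of_nonneg (h6 _)]
    rw [← ofReal_integral_eq_lintegral_ofReal h5 (Filter.Eventually.of_forall h6), hG,
      integral_const_mul, integral_gaussian_pi h4, ← Real.mul_rpow (by positivity) (by positivity)]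
    congr 1
    have h7 : Real.pi / ε * (Real.pi / (1 / (4 * ε))) = (2 * Real.pi) ^ (2 : ℝ) := by
      rw [Real.rpow_two]
      field_simp
      ring
    rw [h7, ← Real.rpow_mul (by positivity), ← Real.rpow_natCast]
    congr 1
    ring
  rw [e1, e3]
  calc _ ≤ ∫⁻ x, ‖h x‖ₑ * ∫⁻ x', ‖h x'‖ₑ * ‖G (x - x')‖ₑ := by
        refine (enorm_integral_le_lintegral_enorm _).trans (lintegral_mono fun x => ?_)
        rw [enorm_mul]
        gcongr
        refine (enorm_integral_le_lintegral_enorm _).trans (lintegral_mono fun x' => ?_)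
        rw [enorm_mul, RCLike.enorm_conj]
        simp [← ofReal_norm, Complex.norm_real]
    _ = ∫⁻ x, ∫⁻ x', ‖G (x - x')‖ₑ * ‖h x'‖ₑ * ‖h x‖ₑ := by
        refine lintegral_congr fun x => ?_
        rw [← lintegral_const_mul _ (by fun_prop)]
        refine lintegral_congr fun x' => ?_
        ring
    _ ≤ _ := by
        refine (lintegral_lintegral_conv_mul_le (k := fun t => ‖G t‖ₑ) (by fun_prop)
          (by fun_prop : Measurable fun x => ‖h x‖ₑ) (by fun_prop : Measurable fun x => ‖h x‖ₑ)
          Real.HolderConjugate.two_two).trans ?_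
        rw [hGl, mul_assoc, ← ENNReal.rpow_add_of_nonneg _ _ (by norm_num) (by norm_num)]
        norm_num

theorem lintegral_fourier_sq_le {h : (ι → ℝ) → ℂ} (hm : Measurable h) (hi : Integrable h) :
    ∫⁻ ξ : ι → ℝ, ‖∫ x : ι → ℝ, chr ξ x * h x‖ₑ ^ (2 : ℝ) ≤
      ENNReal.ofReal ((2 * Real.pi) ^ Fintype.card ι) * ∫⁻ x, ‖h x‖ₑ ^ (2 : ℝ) := by
  have hHm := measurable_fourier hm
  have ht : Filter.Tendsto (fun k : ℕ => 1 / ((k : ℝ) + 1)) Filter.atTop (nhds 0) :=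
    tendsto_one_div_add_atTop_nhds_zero_nat
  have := lintegral_tendsto_of_tendsto_of_monotone (μ := volume)
    (f := fun (k : ℕ) (ξ : ι → ℝ) => ‖∫ x : ι → ℝ, chr ξ x * h x‖ₑ ^ (2 : ℝ) *
        ENNReal.ofReal (Real.exp (-(1 / ((k : ℝ) + 1)) * ∑ i, ξ i ^ 2)))
    (F := fun ξ => ‖∫ x : ι → ℝ, chr ξ x * h x‖ₑ ^ (2 : ℝ)) (fun k => by fun_prop) ?_ ?_
  · exact le_of_tendsto' this fun k => lintegral_fourier_sq_mul_gaussian_le hm hi (by positivity)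
  · refine Filter.Eventually.of_forall fun ξ j k hjk => ?_
    simp only
    gcongr
  · refine Filter.Eventually.of_forall fun ξ => ?_
    have h1 : Filter.Tendsto (fun k : ℕ =>
        ENNReal.ofReal (Real.exp (-(1 / ((k : ℝ) + 1)) * ∑ i, ξ i ^ 2))) Filter.atTop
        (nhds 1) := by
      rw [← ENNReal.ofReal_one, ← Real.exp_zero]
      refine ENNReal.tendsto_ofReal ((Real.continuous_exp.tendsto _).comp ?_)
      simpa using (ht.neg).mul_const (∑ i, ξ i ^ 2)
    have h2 := ENNReal.Tendsto.const_mul (a := ‖∫ x : ι → ℝ, chr ξ x * h x‖ₑ ^ (2 : ℝ)) h1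
      (Or.inl one_ne_zero)
    simpa using h2

end chr

theorem lintegral_gamma {s r : ℝ} (hs : 0 < s) (hr : 0 < r) :
    ∫⁻ t in Ioi (0 : ℝ), ENNReal.ofReal (t ^ (s - 1) * Real.exp (-(r * t))) =
      ENNReal.ofReal (Real.Gamma s * r ^ (-s)) := by
  have hi : IntegrableOn (fun t : ℝ => t ^ (s - 1) * Real.exp (-(r * t))) (Ioi 0) := by
    have h := integrableOn_rpow_mul_exp_neg_mul_rpow (p := 1) (s := s - 1) (b := r)
      (by linarith) one_pos hr
    simpa using h
  rw [← ofReal_integral_eq_lintegral_ofReal hi, Real.integral_rpow_mul_exp_neg_mul_Ioi hs hr]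
  · rw [Real.rpow_neg hr.le, one_div, Real.inv_rpow hr.le, mul_comm]
  · refine (ae_restrict_mem measurableSet_Ioi).mono fun t (ht : 0 < t) => ?_
    positivity

theorem lintegral_add_sq_rpow {ι : Type*} [Fintype ι] {a A : ℝ}
    (ha : (Fintype.card ι : ℝ) / 2 < a) (hA : 0 < A) :
    ∫⁻ x : ι → ℝ, ENNReal.ofReal ((A + ∑ i, x i ^ 2) ^ (-a)) =
      ENNReal.ofReal (Real.pi ^ (Fintype.card ι / 2 : ℝ) * Real.Gamma (a - Fintype.card ι / 2) /
        Real.Gamma a * A ^ ((Fintype.card ι : ℝ) / 2 - a)) := by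
  set d : ℝ := (Fintype.card ι : ℝ) / 2 with hd
  have hd0 : 0 ≤ d := by positivity
  have ha0 : 0 < a := by linarith
  have hΓ : 0 < Real.Gamma a := Real.Gamma_pos_of_pos ha0
  have hS : ∀ x : ι → ℝ, 0 ≤ ∑ i, x i ^ 2 := fun x => Finset.sum_nonneg fun i _ => by positivity
  have key : ENNReal.ofReal (Real.Gamma a) *
      ∫⁻ x : ι → ℝ, ENNReal.ofReal ((A + ∑ i, x i ^ 2) ^ (-a)) =
      ENNReal.ofReal (Real.pi ^ d * (Real.Gamma (a - d) * A ^ (-(a - d)))) := by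
    rw [← lintegral_const_mul _ (by fun_prop)]
    have e1 : ∀ x : ι → ℝ, ENNReal.ofReal (Real.Gamma a) *
        ENNReal.ofReal ((A + ∑ i, x i ^ 2) ^ (-a)) =
        ∫⁻ t in Ioi (0 : ℝ), ENNReal.ofReal (t ^ (a - 1) * Real.exp (-(A * t))) *
          ENNReal.ofReal (Real.exp (-t * ∑ i, x i ^ 2)) := by
      intro x
      rw [← ENNReal.ofReal_mul hΓ.le, ← lintegral_gamma ha0 (by linarith [hS x])]
      refine lintegral_congr fun t => ?_
      rw [← ENNReal.ofReal_mul' (by positivity), mul_assoc, ← Real.exp_add]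
      congr 3
      ring_nf
    simp_rw [e1]
    rw [lintegral_lintegral_swap (by apply Measurable.aemeasurable; fun_prop),
      ENNReal.ofReal_mul (by positivity),
      ← lintegral_gamma (by linarith) hA, ← lintegral_const_mul _ (by fun_prop)]
    refine setLIntegral_congr_fun measurableSet_Ioi fun t (ht : 0 < t) => ?_
    rw [lintegral_const_mul _ (by fun_prop),
      ← ofReal_integral_eq_lintegral_ofReal (integrable_gaussian ht)
        (Filter.Eventually.of_forall fun x => by positivity), integral_gaussian_pi ht,
      ← ENNReal.ofReal_mul (by positivity), ← ENNReal.ofReal_mul (by positivity)]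
    congr 1
    rw [Real.div_rpow Real.pi_pos.le ht.le, ← hd, sub_right_comm, Real.rpow_sub ht (a - 1)]
    ring
  have hne : ENNReal.ofReal (Real.Gamma a) ≠ 0 := by simpa using hΓ
  rw [(ENNReal.eq_div_iff hne ENNReal.ofReal_ne_top).2 key, ← ENNReal.ofReal_div_of_pos hΓ, neg_sub]
  congr 1
  ring

theorem exists_lintegral_Ioi_rpow_le {α β : ℝ} (hα : 0 < α) (hβ : α < β) :
    ∃ C : ℝ, 0 < C ∧ ∀ x₀ : ℝ, 0 < x₀ →
      ∫⁻ x in Ioi (0 : ℝ), ENNReal.ofReal (x ^ (α - 1) * (x₀ + x) ^ (-β)) ≤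
        ENNReal.ofReal (C * x₀ ^ (α - β)) := by
  have hC : 0 < 1 / α + 1 / (β - α) := by
    have : 0 < β - α := by linarith
    positivity
  refine ⟨_, hC, fun x₀ hx => ?_⟩
  rw [← Ioc_union_Ioi_eq_Ioi hx.le, add_mul, ENNReal.ofReal_add (by positivity)
    (by have : 0 < β - α := by linarith
        positivity)]
  refine (lintegral_union_le _ _ _).trans (add_le_add ?_ ?_)
  · have hi : IntegrableOn (fun x : ℝ => x ^ (α - 1) * x₀ ^ (-β)) (Ioc 0 x₀) :=
      ((intervalIntegrable_iff_integrableOn_Ioc_of_le hx.le).1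
        (intervalIntegral.intervalIntegrable_rpow' (by linarith))).mul_const _
    calc _ ≤ ∫⁻ x in Ioc 0 x₀, ENNReal.ofReal (x ^ (α - 1) * x₀ ^ (-β)) := by
          refine setLIntegral_mono (by fun_prop) fun x hx' => ?_
          have h0 : 0 < x := hx'.1
          gcongr ENNReal.ofReal (_ * ?_)
          exact Real.rpow_le_rpow_of_nonpos hx (by linarith) (by linarith)
      _ = _ := by
          rw [← ofReal_integral_eq_lintegral_ofReal hi, integral_mul_const,
            ← intervalIntegral.integral_of_le hx.le, integral_rpow (Or.inl (by linarith))]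
          · congr 1
            rw [sub_add_cancel, Real.zero_rpow hα.ne', sub_zero, sub_eq_add_neg α, Real.rpow_add hx]
            ring
          · refine (ae_restrict_mem measurableSet_Ioc).mono fun t ht => ?_
            have : 0 < t := ht.1
            positivity
  · have hi : IntegrableOn (fun x : ℝ => x ^ (α - 1 - β)) (Ioi x₀) :=
      integrableOn_Ioi_rpow_of_lt (by linarith) hx
    calc _ ≤ ∫⁻ x in Ioi x₀, ENNReal.ofReal (x ^ (α - 1 - β)) := by
          refine setLIntegral_mono (by fun_prop) fun x hx' => ?_
          have h0 : 0 < x := hx.trans hx'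
          rw [sub_eq_add_neg (α - 1) β, Real.rpow_add h0]
          gcongr ENNReal.ofReal (_ * ?_)
          exact Real.rpow_le_rpow_of_nonpos h0 (by linarith) (by linarith)
      _ = _ := by
          rw [← ofReal_integral_eq_lintegral_ofReal hi, integral_Ioi_rpow_of_lt (by linarith) hx]
          · congr 1
            have h1 : α - 1 - β + 1 = -(β - α) := by ring
            rw [h1, neg_sub, neg_div, ← div_neg, neg_sub]
            ring
          · refine (ae_restrict_mem measurableSet_Ioi).mono fun t (ht : x₀ < t) => ?_
            have : 0 < t := hx.trans ht
            positivity

section geometry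

variable {m : ℕ}

/-- The squared Euclidean norm. -/
def nsq (x : Fin m → ℝ) : ℝ := ∑ i, x i ^ 2

theorem nsq_nonneg (x : Fin m → ℝ) : 0 ≤ nsq x := Finset.sum_nonneg fun i _ => by positivity

@[fun_prop]
theorem measurable_nsq : Measurable (nsq : (Fin m → ℝ) → ℝ) := by
  unfold nsq
  fun_prop

/-- The coordinates of `y` from the third on. -/
def tail (y : Fin (m + 2) → ℝ) : Fin m → ℝ := fun i => y i.succ.succ

/-- The first light-cone coordinate. -/
def uC (y : Fin (m + 2) → ℝ) : ℝ := y 0 - y 1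

/-- The second light-cone coordinate. -/
def wC (y : Fin (m + 2) → ℝ) : ℝ := y 0 + y 1

/-- The ratio `Q / (y₀ - y₁)`. -/
def rC (y : Fin (m + 2) → ℝ) : ℝ := lorentzQ (m + 2) y / uC y

theorem sum_filter_ne_zero {M : Type*} [AddCommMonoid M] (f : Fin (m + 2) → M) :
    ∑ k ∈ Finset.univ.filter (fun k : Fin (m + 2) => k ≠ 0), f k =
      f 1 + ∑ i : Fin m, f i.succ.succ := by
  rw [Finset.sum_filter, Fin.sum_univ_succ, Fin.sum_univ_succ]
  simp [Fin.succ_ne_zero]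

theorem lorentzQ_eq (y : Fin (m + 2) → ℝ) : lorentzQ (m + 2) y = uC y * wC y - nsq (tail y) := by
  unfold lorentzQ
  rw [sum_filter_ne_zero]
  unfold uC wC nsq tail
  ring

theorem lorentzQC_eq (z : Fin (m + 2) → ℂ) :
    lorentzQC (m + 2) z = (z 0 - z 1) * (z 0 + z 1) - ∑ i : Fin m, z i.succ.succ ^ 2 := by
  unfold lorentzQC
  rw [sum_filter_ne_zero]
  ring

@[fun_prop]
theorem continuous_lorentzQ : Continuous (lorentzQ (m + 2)) := by
  unfold lorentzQ
  fun_prop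

@[fun_prop]
theorem measurable_lorentzQ : Measurable (lorentzQ (m + 2)) := continuous_lorentzQ.measurable

@[fun_prop]
theorem measurable_uC : Measurable (uC : (Fin (m + 2) → ℝ) → ℝ) := by
  unfold uC
  fun_prop

@[fun_prop]
theorem measurable_rC : Measurable (rC : (Fin (m + 2) → ℝ) → ℝ) := by
  unfold rC
  fun_prop

theorem isOpen_lightCone : IsOpen (lightCone (m + 2)) :=
  (isOpen_lt continuous_const (continuous_apply _)).inter
    (isOpen_lt continuous_const continuous_lorentzQ)

theorem measurableSet_lightCone : MeasurableSet (lightCone (m + 2)) :=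
  isOpen_lightCone.measurableSet

theorem mem_lightCone_iff {y : Fin (m + 2) → ℝ} :
    y ∈ lightCone (m + 2) ↔ 0 < uC y ∧ 0 < lorentzQ (m + 2) y := by
  have hn := nsq_nonneg (tail y)
  constructor
  · rintro ⟨h0, h1⟩
    refine ⟨?_, h1⟩
    rw [lorentzQ_eq] at h1
    by_contra h
    unfold uC wC at *
    nlinarith
  · rintro ⟨h0, h1⟩
    refine ⟨?_, h1⟩
    rw [lorentzQ_eq] at h1
    have : 0 < wC y := by
      by_contra h
      nlinarith
    unfold uC wC at *
    linarith

theorem uC_pos {y : Fin (m + 2) → ℝ} (hy : y ∈ lightCone (m + 2)) : 0 < uC y :=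
  (mem_lightCone_iff.1 hy).1

theorem Q_pos {y : Fin (m + 2) → ℝ} (hy : y ∈ lightCone (m + 2)) : 0 < lorentzQ (m + 2) y := hy.2

theorem rC_pos {y : Fin (m + 2) → ℝ} (hy : y ∈ lightCone (m + 2)) : 0 < rC y :=
  div_pos (Q_pos hy) (uC_pos hy)

theorem Q_eq_mul {y : Fin (m + 2) → ℝ} (hy : y ∈ lightCone (m + 2)) :
    lorentzQ (m + 2) y = uC y * rC y := by
  unfold rC
  rw [mul_div_cancel₀ _ (uC_pos hy).ne']

theorem wC_eq {y : Fin (m + 2) → ℝ} (hy : y ∈ lightCone (m + 2)) :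
    wC y = rC y + nsq (tail y) / uC y := by
  have := (uC_pos hy).ne'
  unfold rC
  rw [lorentzQ_eq]
  field_simp
  ring

theorem wC_pos {y : Fin (m + 2) → ℝ} (hy : y ∈ lightCone (m + 2)) : 0 < wC y := by
  rw [wC_eq hy]
  have := rC_pos hy
  have := div_nonneg (nsq_nonneg (tail y)) (uC_pos hy).le
  linarith

theorem uC_add (y v : Fin (m + 2) → ℝ) : uC (y + v) = uC y + uC v := by
  simp only [uC, Pi.add_apply]
  ring

theorem Q_add {y v : Fin (m + 2) → ℝ} (hy : y ∈ lightCone (m + 2)) (hv : v ∈ lightCone (m + 2)) :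
    lorentzQ (m + 2) (y + v) = (uC y + uC v) * (rC y + rC v) +
      uC y / uC v * nsq (tail v - (uC v / uC y) • tail y) := by
  have h1 := (uC_pos hy).ne'
  have h2 := (uC_pos hv).ne'
  have hw : wC (y + v) = wC y + wC v := by
    simp only [wC, Pi.add_apply]
    ring
  have h3 : nsq (tail (y + v)) = nsq (tail y) + nsq (tail v) + 2 * ∑ i, tail y i * tail v i := by
    simp only [nsq, tail, Pi.add_apply, Finset.mul_sum, ← Finset.sum_add_distrib]
    exact Finset.sum_congr rfl fun i _ => by ring
  have h4 : nsq (tail v - (uC v / uC y) • tail y) = nsq (tail v) +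
      (uC v / uC y) ^ 2 * nsq (tail y) - 2 * (uC v / uC y) * ∑ i, tail y i * tail v i := by
    simp only [nsq, Pi.sub_apply, Pi.smul_apply, smul_eq_mul, Finset.mul_sum,
      ← Finset.sum_add_distrib, ← Finset.sum_sub_distrib]
    exact Finset.sum_congr rfl fun i _ => by ring
  rw [lorentzQ_eq, uC_add, hw, h3, h4, wC_eq hy, wC_eq hv]
  field_simp
  ring

theorem add_mem_lightCone {y v : Fin (m + 2) → ℝ} (hy : y ∈ lightCone (m + 2))
    (hv : v ∈ lightCone (m + 2)) : y + v ∈ lightCone (m + 2) := by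
  refine mem_lightCone_iff.2 ⟨by rw [uC_add]; exact add_pos (uC_pos hy) (uC_pos hv), ?_⟩
  rw [Q_add hy hv]
  have := uC_pos hy
  have := uC_pos hv
  have := rC_pos hy
  have := rC_pos hv
  have := nsq_nonneg (tail v - (uC v / uC y) • tail y)
  positivity

theorem Q_le_Q_add {y v : Fin (m + 2) → ℝ} (hy : y ∈ lightCone (m + 2))
    (hv : v ∈ lightCone (m + 2)) : lorentzQ (m + 2) y ≤ lorentzQ (m + 2) (y + v) := by
  rw [Q_add hy hv, Q_eq_mul hy]
  have h1 := uC_pos hy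
  have h2 := uC_pos hv
  have h3 := rC_pos hy
  have h4 := rC_pos hv
  have : 0 ≤ uC y / uC v * nsq (tail v - (uC v / uC y) • tail y) :=
    mul_nonneg (by positivity) (nsq_nonneg _)
  nlinarith [mul_pos h1 h4, mul_pos h2 h3, mul_pos h2 h4]

/-- The parametrisation of the cone by `u = y₀ - y₁`, `ρ = Q(y) / u` and the remaining coordinates. -/
def prm (p : ℝ × ℝ × (Fin m → ℝ)) : Fin (m + 2) → ℝ :=
  Fin.cons ((p.2.1 + nsq p.2.2 / p.1 + p.1) / 2)
    (Fin.cons ((p.2.1 + nsq p.2.2 / p.1 - p.1) / 2) p.2.2 : Fin (m + 1) → ℝ)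

@[simp] theorem prm_zero (p : ℝ × ℝ × (Fin m → ℝ)) :
    prm p 0 = (p.2.1 + nsq p.2.2 / p.1 + p.1) / 2 := rfl

@[simp] theorem prm_one (p : ℝ × ℝ × (Fin m → ℝ)) :
    prm p 1 = (p.2.1 + nsq p.2.2 / p.1 - p.1) / 2 := rfl

@[simp] theorem prm_succ_succ (p : ℝ × ℝ × (Fin m → ℝ)) (i : Fin m) :
    prm p i.succ.succ = p.2.2 i := rfl

@[simp] theorem tail_prm (p : ℝ × ℝ × (Fin m → ℝ)) : tail (prm p) = p.2.2 := rfl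

@[simp] theorem uC_prm (p : ℝ × ℝ × (Fin m → ℝ)) : uC (prm p) = p.1 := by
  simp only [uC, prm_zero, prm_one]
  ring

theorem wC_prm (p : ℝ × ℝ × (Fin m → ℝ)) : wC (prm p) = p.2.1 + nsq p.2.2 / p.1 := by
  simp only [wC, prm_zero, prm_one]
  ring

theorem Q_prm {p : ℝ × ℝ × (Fin m → ℝ)} (hp : p.1 ≠ 0) : lorentzQ (m + 2) (prm p) = p.1 * p.2.1 := by
  rw [lorentzQ_eq, uC_prm, wC_prm, tail_prm]
  field_simp
  ring

theorem rC_prm {p : ℝ × ℝ × (Fin m → ℝ)} (hp : p.1 ≠ 0) : rC (prm p) = p.2.1 := by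
  rw [rC, Q_prm hp, uC_prm, mul_div_cancel_left₀ _ hp]

theorem prm_mem_iff {p : ℝ × ℝ × (Fin m → ℝ)} (hp : p.1 ≠ 0) :
    prm p ∈ lightCone (m + 2) ↔ 0 < p.1 ∧ 0 < p.2.1 := by
  rw [mem_lightCone_iff, uC_prm, Q_prm hp]
  constructor
  · rintro ⟨h1, h2⟩
    exact ⟨h1, (mul_pos_iff_of_pos_left h1).1 h2⟩
  · rintro ⟨h1, h2⟩
    exact ⟨h1, mul_pos h1 h2⟩

@[fun_prop]
theorem measurable_prm : Measurable (prm : ℝ × ℝ × (Fin m → ℝ) → Fin (m + 2) → ℝ) := by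
  rw [measurable_pi_iff]
  intro k
  refine Fin.cases ?_ (fun k => Fin.cases ?_ (fun i => ?_) k) k
  · simp only [prm_zero]
    fun_prop
  · change Measurable fun p : ℝ × ℝ × (Fin m → ℝ) => (p.2.1 + nsq p.2.2 / p.1 - p.1) / 2
    fun_prop
  · simp only [prm_succ_succ]
    fun_prop

theorem measurable_cons {k : ℕ} :
    Measurable fun q : ℝ × (Fin k → ℝ) => (Fin.cons q.1 q.2 : Fin (k + 1) → ℝ) := by
  rw [measurable_pi_iff]
  intro j
  refine Fin.cases ?_ (fun j => ?_) j
  · simp only [Fin.cons_zero]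
    fun_prop
  · simp only [Fin.cons_succ]
    fun_prop

theorem lintegral_fin_succ {k : ℕ} {F : (Fin (k + 1) → ℝ) → ℝ≥0∞} (hF : Measurable F) :
    ∫⁻ y, F y = ∫⁻ x : Fin k → ℝ, ∫⁻ t : ℝ, F (Fin.cons t x) := by
  have h := (volume_preserving_piFinSuccAbove (fun _ : Fin (k + 1) => ℝ) 0).symm
  rw [← h.lintegral_comp hF, Measure.volume_eq_prod, lintegral_prod_symm']
  · refine lintegral_congr fun x => lintegral_congr fun t => congrArg F ?_
    exact Fin.insertNth_zero' t x
  · exact hF.comp (MeasurableEquiv.measurable _)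

theorem lintegral_affine (g : ℝ → ℝ≥0∞) (c : ℝ) (hg : Measurable g) :
    ∫⁻ t, g t = 2⁻¹ * ∫⁻ ρ, g ((ρ + c) / 2) := by
  have h1 : ∫⁻ ρ, g ((ρ + c) / 2) = ∫⁻ ρ, g (ρ / 2) :=
    lintegral_add_right_eq_self (fun ρ => g (ρ / 2)) c
  have h2 : ∫⁻ ρ, g (ρ / 2) = 2 * ∫⁻ t, g t := by
    have h3 := Real.map_volume_mul_left (a := 1 / 2) (by norm_num)
    have h4 : ∫⁻ ρ, g (ρ / 2) = ∫⁻ t, g t ∂(Measure.map (1 / 2 * ·) volume) := by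
      rw [lintegral_map hg (by fun_prop)]
      refine lintegral_congr fun ρ => ?_
      rw [one_div_mul_eq_div]
    rw [h4, h3, lintegral_smul_measure]
    norm_num
  rw [h1, h2, ← mul_assoc, ENNReal.inv_mul_cancel (by norm_num) (by norm_num), one_mul]

theorem lintegral_prm {F : (Fin (m + 2) → ℝ) → ℝ≥0∞} (hF : Measurable F) :
    ∫⁻ y, F y = 2⁻¹ * ∫⁻ u : ℝ, ∫⁻ ρ : ℝ, ∫⁻ x : Fin m → ℝ, F (prm (u, ρ, x)) := by
  have hc : Measurable fun q : ℝ × (Fin (m + 1) → ℝ) => (Fin.cons q.1 q.2 : Fin (m + 2) → ℝ) := measurable_cons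
  have hc' : Measurable fun q : ℝ × (Fin m → ℝ) => (Fin.cons q.1 q.2 : Fin (m + 1) → ℝ) := measurable_cons
  have hcc : Measurable fun q : ℝ × ℝ × (Fin m → ℝ) =>
      (Fin.cons q.1 (Fin.cons q.2.1 q.2.2 : Fin (m + 1) → ℝ) : Fin (m + 2) → ℝ) :=
    hc.comp (measurable_fst.prodMk (hc'.comp measurable_snd))
  have hG : Measurable fun q : ℝ × ℝ × (Fin m → ℝ) =>
      F (Fin.cons q.1 (Fin.cons q.2.1 q.2.2 : Fin (m + 1) → ℝ)) := hF.comp hcc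
  have hP : Measurable fun q : ℝ × ℝ × (Fin m → ℝ) => F (prm q) := hF.comp measurable_prm
  rw [lintegral_fin_succ hF, lintegral_fin_succ (Measurable.lintegral_prod_left'
    (f := fun q : ℝ × (Fin (m + 1) → ℝ) => F (Fin.cons q.1 q.2)) (hF.comp hc))]
  calc _ = ∫⁻ x : Fin m → ℝ, ∫⁻ u : ℝ, ∫⁻ t : ℝ,
        F (Fin.cons (u + t) (Fin.cons t x : Fin (m + 1) → ℝ)) := by
        refine lintegral_congr fun x => ?_
        calc ∫⁻ t : ℝ, ∫⁻ s : ℝ, F (Fin.cons s (Fin.cons t x : Fin (m + 1) → ℝ))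
            = ∫⁻ t : ℝ, ∫⁻ u : ℝ, F (Fin.cons (u + t) (Fin.cons t x : Fin (m + 1) → ℝ)) :=
              lintegral_congr fun t => (lintegral_add_right_eq_self (μ := volume)
                (fun s => F (Fin.cons s (Fin.cons t x : Fin (m + 1) → ℝ))) t).symm
          _ = _ := lintegral_lintegral_swap (Measurable.aemeasurable (hG.comp
                (by fun_prop : Measurable fun q : ℝ × ℝ => (q.2 + q.1, q.1, x))))
    _ = ∫⁻ x : Fin m → ℝ, ∫⁻ u : ℝ, 2⁻¹ * ∫⁻ ρ : ℝ, F (prm (u, ρ, x)) := by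
        refine lintegral_congr fun x => lintegral_congr fun u => ?_
        rw [lintegral_affine _ (nsq x / u - u)]
        · congr 1
          refine lintegral_congr fun ρ => ?_
          congr 1
          unfold prm
          congr 1
          · ring
          · congr 1
            ring
        · exact hG.comp (by fun_prop : Measurable fun t : ℝ => (u + t, t, x))
    _ = 2⁻¹ * ∫⁻ x : Fin m → ℝ, ∫⁻ u : ℝ, ∫⁻ ρ : ℝ, F (prm (u, ρ, x)) := by
        rw [← lintegral_const_mul]
        · refine lintegral_congr fun x => ?_
          rw [lintegral_const_mul]
          exact Measurable.lintegral_prod_right' (f := fun q : ℝ × ℝ => F (prm (q.1, q.2, x)))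
            (hP.comp (by fun_prop))
        · exact Measurable.lintegral_prod_right'
            (f := fun q : (Fin m → ℝ) × ℝ => ∫⁻ ρ, F (prm (q.2, ρ, q.1)))
            (Measurable.lintegral_prod_right'
              (f := fun q : ((Fin m → ℝ) × ℝ) × ℝ => F (prm (q.1.2, q.2, q.1.1)))
              (hP.comp (by fun_prop)))
    _ = _ := by
        congr 1
        rw [lintegral_lintegral_swap]
        · refine lintegral_congr fun u => ?_
          rw [lintegral_lintegral_swap]
          exact (hP.comp (by fun_prop :
            Measurable fun q : (Fin m → ℝ) × ℝ => (u, q.2, q.1))).aemeasurable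
        · apply Measurable.aemeasurable
          exact Measurable.lintegral_prod_right'
            (f := fun q : ((Fin m → ℝ) × ℝ) × ℝ => F (prm (q.1.2, q.2, q.1.1)))
            (hP.comp (by fun_prop))

theorem lintegral_lightCone {F : (Fin (m + 2) → ℝ) → ℝ≥0∞} (hF : Measurable F) :
    ∫⁻ y in lightCone (m + 2), F y = 2⁻¹ * ∫⁻ u in Ioi (0 : ℝ), ∫⁻ ρ in Ioi (0 : ℝ),
      ∫⁻ x : Fin m → ℝ, F (prm (u, ρ, x)) := by
  rw [← lintegral_indicator measurableSet_lightCone,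
    lintegral_prm (hF.indicator measurableSet_lightCone), ← lintegral_indicator measurableSet_Ioi]
  congr 1
  refine lintegral_congr_ae ?_
  have : ∀ᵐ u : ℝ, u ≠ 0 := by simp [ae_iff]
  filter_upwards [this] with u hu
  by_cases h : 0 < u
  · rw [indicator_of_mem (by exact h), ← lintegral_indicator measurableSet_Ioi]
    refine lintegral_congr fun ρ => ?_
    by_cases h' : 0 < ρ
    · rw [indicator_of_mem (by exact h')]
      refine lintegral_congr fun x => ?_
      rw [indicator_of_mem ((prm_mem_iff hu).2 ⟨h, h'⟩)]
    · rw [indicator_of_notMem (by exact h'), lintegral_eq_zero_of_ae_eq_zero]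
      refine Filter.Eventually.of_forall fun x => ?_
      exact indicator_of_notMem (fun h2 => h' ((prm_mem_iff hu).1 h2).2) _
  · rw [indicator_of_notMem (by exact h), lintegral_eq_zero_of_ae_eq_zero]
    refine Filter.Eventually.of_forall fun ρ => ?_
    refine lintegral_eq_zero_of_ae_eq_zero ?_
    refine Filter.Eventually.of_forall fun x => ?_
    exact indicator_of_notMem (fun h2 => h ((prm_mem_iff hu).1 h2).1) _

theorem restrict_lightCone : volume.restrict (lightCone (m + 2)) = (2⁻¹ : ℝ≥0∞) •
    Measure.map prm ((volume.restrict (Ioi (0 : ℝ))).prod ((volume.restrict (Ioi (0 : ℝ))).prod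
      (volume : Measure (Fin m → ℝ)))) := by
  ext s hs
  rw [← lintegral_indicator_one hs, lintegral_lightCone (measurable_one.indicator hs),
    Measure.smul_apply, ← lintegral_indicator_one hs, lintegral_map (measurable_one.indicator hs)
    measurable_prm, smul_eq_mul]
  have h : Measurable fun q : ℝ × ℝ × (Fin m → ℝ) => (s.indicator 1 (prm q) : ℝ≥0∞) :=
    (measurable_one.indicator hs).comp measurable_prm
  rw [lintegral_prod _ h.aemeasurable]
  congr 1
  refine lintegral_congr fun u => ?_
  rw [lintegral_prod _ (by fun_prop)]

end geometry

section geometry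

variable {m : ℕ}

theorem lintegral_add_mul_nsq_rpow {a A c : ℝ} (ha : (m : ℝ) / 2 < a) (hA : 0 < A) (hc : 0 < c)
    (t : Fin m → ℝ) :
    ∫⁻ x : Fin m → ℝ, ENNReal.ofReal ((A + c * nsq (x - t)) ^ (-a)) =
      ENNReal.ofReal (Real.pi ^ ((m : ℝ) / 2) * Real.Gamma (a - m / 2) / Real.Gamma a *
        (c ^ (-((m : ℝ) / 2)) * A ^ ((m : ℝ) / 2 - a))) := by
  rw [lintegral_sub_right_eq_self (fun x => ENNReal.ofReal ((A + c * nsq x) ^ (-a))) t]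
  have e1 : ∀ x : Fin m → ℝ, ENNReal.ofReal ((A + c * nsq x) ^ (-a)) =
      ENNReal.ofReal (c ^ (-a)) * ENNReal.ofReal ((A / c + ∑ i, x i ^ 2) ^ (-a)) := by
    intro x
    have := nsq_nonneg x
    have h : A + c * nsq x = c * (A / c + nsq x) := by field_simp
    rw [← ENNReal.ofReal_mul (by positivity), h, Real.mul_rpow hc.le
      (add_nonneg (by positivity) this)]
    rfl
  simp_rw [e1]
  rw [lintegral_const_mul _ (by fun_prop), lintegral_add_sq_rpow (by simpa using ha)
    (by positivity), ← ENNReal.ofReal_mul (by positivity), Fintype.card_fin]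
  congr 1
  rw [Real.div_rpow hA.le hc.le, div_eq_mul_inv (A ^ _), ← Real.rpow_neg hc.le]
  have : c ^ (-((m : ℝ) / 2)) = c ^ (-a) * c ^ (-((m : ℝ) / 2 - a)) := by
    rw [← Real.rpow_add hc]
    congr 1
    ring
  rw [this]
  ring

theorem exists_lintegral_Q_add_le {a α β : ℝ} (h1 : 0 < α + m / 2 + 1)
    (h2 : α + m / 2 + 1 < a - m / 2) (h3 : 0 < β + 1) (h4 : β + 1 < a - m / 2) :
    ∃ C : ℝ, 0 < C ∧ ∀ y ∈ lightCone (m + 2),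
      ∫⁻ v in lightCone (m + 2),
        ENNReal.ofReal (lorentzQ (m + 2) (y + v) ^ (-a) * (uC v ^ α * rC v ^ β)) ≤
      ENNReal.ofReal (C * (uC y ^ (α + 1 + m / 2 - a) * rC y ^ (β + 1 + m / 2 - a))) := by
  obtain ⟨C₁, hC₁, H₁⟩ := exists_lintegral_Ioi_rpow_le h1 h2
  obtain ⟨C₂, hC₂, H₂⟩ := exists_lintegral_Ioi_rpow_le h3 h4
  set K : ℝ := Real.pi ^ ((m : ℝ) / 2) * Real.Gamma (a - m / 2) / Real.Gamma a with hK
  have hm0 : (0 : ℝ) ≤ m / 2 := by positivity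
  have hK0 : 0 < K := by
    have := Real.Gamma_pos_of_pos (by linarith : 0 < a)
    have := Real.Gamma_pos_of_pos (by linarith : 0 < a - m / 2)
    positivity
  refine ⟨2⁻¹ * (K * (C₁ * C₂)), by positivity, fun y hy => ?_⟩
  have hu0 := uC_pos hy
  have hr0 := rC_pos hy
  rw [lintegral_lightCone (by fun_prop)]
  have e1 : ∀ u ∈ Ioi (0 : ℝ), ∀ ρ ∈ Ioi (0 : ℝ), ∫⁻ x : Fin m → ℝ,
      ENNReal.ofReal (lorentzQ (m + 2) (y + prm (u, ρ, x)) ^ (-a) *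
        (uC (prm (u, ρ, x)) ^ α * rC (prm (u, ρ, x)) ^ β)) =
      ENNReal.ofReal (K * uC y ^ (-((m : ℝ) / 2))) *
      (ENNReal.ofReal (u ^ (α + m / 2 + 1 - 1) * (uC y + u) ^ (-(a - m / 2))) *
      ENNReal.ofReal (ρ ^ (β + 1 - 1) * (rC y + ρ) ^ (-(a - m / 2)))) := by
    intro u (hu : 0 < u) ρ (hρ : 0 < ρ)
    have hmem : ∀ x : Fin m → ℝ, prm (u, ρ, x) ∈ lightCone (m + 2) := fun x =>
      (prm_mem_iff hu.ne').2 ⟨hu, hρ⟩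
    have e2 : ∀ x : Fin m → ℝ, ENNReal.ofReal (lorentzQ (m + 2) (y + prm (u, ρ, x)) ^ (-a) *
        (uC (prm (u, ρ, x)) ^ α * rC (prm (u, ρ, x)) ^ β)) =
        ENNReal.ofReal (((uC y + u) * (rC y + ρ) +
          uC y / u * nsq (x - (u / uC y) • tail y)) ^ (-a)) * ENNReal.ofReal (u ^ α * ρ ^ β) := by
      intro x
      rw [Q_add hy (hmem x), uC_prm, tail_prm, rC_prm (by exact hu.ne'),
        ENNReal.ofReal_mul' (by positivity)]
    simp_rw [e2]
    rw [lintegral_mul_const _ (by fun_prop),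
      lintegral_add_mul_nsq_rpow (by linarith) (by positivity) (by positivity), ← hK,
      ← ENNReal.ofReal_mul (by positivity), ← ENNReal.ofReal_mul (by positivity),
      ← ENNReal.ofReal_mul (by positivity)]
    congr 1
    rw [Real.mul_rpow (by positivity) (by positivity), Real.div_rpow hu0.le hu.le,
      Real.rpow_neg hu.le, div_inv_eq_mul, neg_sub, add_sub_cancel_right, add_sub_cancel_right,
      Real.rpow_add hu]
    ring
  calc _ = 2⁻¹ * ∫⁻ u in Ioi (0 : ℝ), ∫⁻ ρ in Ioi (0 : ℝ),
        ENNReal.ofReal (K * uC y ^ (-((m : ℝ) / 2))) *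
      (ENNReal.ofReal (u ^ (α + m / 2 + 1 - 1) * (uC y + u) ^ (-(a - m / 2))) *
      ENNReal.ofReal (ρ ^ (β + 1 - 1) * (rC y + ρ) ^ (-(a - m / 2)))) := by
        congr 1
        refine setLIntegral_congr_fun measurableSet_Ioi fun u hu => ?_
        exact setLIntegral_congr_fun measurableSet_Ioi fun ρ hρ => e1 u hu ρ hρ
    _ = 2⁻¹ * (ENNReal.ofReal (K * uC y ^ (-((m : ℝ) / 2))) *
        ((∫⁻ u in Ioi (0 : ℝ), ENNReal.ofReal
          (u ^ (α + m / 2 + 1 - 1) * (uC y + u) ^ (-(a - m / 2)))) *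
        ∫⁻ ρ in Ioi (0 : ℝ), ENNReal.ofReal (ρ ^ (β + 1 - 1) * (rC y + ρ) ^ (-(a - m / 2))))) := by
        congr 1
        rw [← lintegral_mul_const _ (by fun_prop), ← lintegral_const_mul _ (by fun_prop)]
        refine lintegral_congr fun u => ?_
        rw [lintegral_const_mul _ (by fun_prop), lintegral_const_mul _ (by fun_prop)]
    _ ≤ 2⁻¹ * (ENNReal.ofReal (K * uC y ^ (-((m : ℝ) / 2))) *
        (ENNReal.ofReal (C₁ * uC y ^ (α + m / 2 + 1 - (a - m / 2))) *
          ENNReal.ofReal (C₂ * rC y ^ (β + 1 - (a - m / 2))))) := by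
        gcongr
        · exact H₁ _ hu0
        · exact H₂ _ hr0
    _ = _ := by
        have h5 : (2⁻¹ : ℝ≥0∞) = ENNReal.ofReal 2⁻¹ := by
          rw [ENNReal.ofReal_inv_of_pos (by norm_num)]
          simp
        rw [h5, ← ENNReal.ofReal_mul (by positivity), ← ENNReal.ofReal_mul (by positivity),
          ← ENNReal.ofReal_mul (by positivity)]
        congr 1
        have h6 : uC y ^ (α + 1 + m / 2 - a) = uC y ^ (-((m : ℝ) / 2)) *
            uC y ^ (α + m / 2 + 1 - (a - m / 2)) := by
          rw [← Real.rpow_add hu0]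
          congr 1
          ring
        have h7 : β + 1 + m / 2 - a = β + 1 - (a - m / 2) := by ring
        rw [h6, h7]
        ring

end geometry

section schur

variable {m : ℕ}

/-- The weight `Q ^ (ν - n / 2)` for `n = m + 2`. -/
def wgt (m : ℕ) (ν : ℝ) (y : Fin (m + 2) → ℝ) : ℝ := lorentzQ (m + 2) y ^ (ν - m / 2 - 1)

@[fun_prop]
theorem measurable_wgt {ν : ℝ} : Measurable (wgt m ν) := by
  unfold wgt
  fun_prop

/-- The weighted measure on the light cone. -/
def coneMeasure (m : ℕ) (ν : ℝ) : Measure (Fin (m + 2) → ℝ) :=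
  (volume.restrict (lightCone (m + 2))).withDensity fun y => ENNReal.ofReal (wgt m ν y)

instance (ν : ℝ) : SFinite (coneMeasure m ν) := by
  unfold coneMeasure
  infer_instance

theorem ae_mem_lightCone (ν : ℝ) : ∀ᵐ y ∂(coneMeasure m ν), y ∈ lightCone (m + 2) :=
  (withDensity_absolutelyContinuous _ _).ae_le (ae_restrict_mem measurableSet_lightCone)

theorem lintegral_coneMeasure {ν : ℝ} {F : (Fin (m + 2) → ℝ) → ℝ≥0∞} (hF : Measurable F) :
    ∫⁻ y, F y ∂(coneMeasure m ν) =
      ∫⁻ y in lightCone (m + 2), ENNReal.ofReal (wgt m ν y) * F y := by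
  unfold coneMeasure
  rw [lintegral_withDensity_eq_lintegral_mul _ (by fun_prop) hF]
  rfl

theorem lintegral_coneMeasure_congr {ν : ℝ} {F G : (Fin (m + 2) → ℝ) → ℝ≥0∞}
    (h : ∀ y ∈ lightCone (m + 2), F y = G y) :
    ∫⁻ y, F y ∂(coneMeasure m ν) = ∫⁻ y, G y ∂(coneMeasure m ν) :=
  lintegral_congr_ae ((ae_mem_lightCone ν).mono h)

theorem lintegral_coneMeasure_mono {ν : ℝ} {F G : (Fin (m + 2) → ℝ) → ℝ≥0∞}
    (h : ∀ y ∈ lightCone (m + 2), F y ≤ G y) :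
    ∫⁻ y, F y ∂(coneMeasure m ν) ≤ ∫⁻ y, G y ∂(coneMeasure m ν) :=
  lintegral_mono_ae ((ae_mem_lightCone ν).mono h)

theorem exists_lintegral_coneMeasure_Q_add_le {ν a s t : ℝ} (h1 : s < ν) (h2 : ν - s < a - m / 2)
    (h3 : t < ν - m / 2) (h4 : ν - m / 2 - t < a - m / 2) :
    ∃ C : ℝ, 0 < C ∧ ∀ y ∈ lightCone (m + 2),
      ∫⁻ v, ENNReal.ofReal (lorentzQ (m + 2) (y + v) ^ (-a)) *
        ENNReal.ofReal (uC v ^ (-s) * rC v ^ (-t)) ∂(coneMeasure m ν) ≤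
      ENNReal.ofReal C * ENNReal.ofReal (uC y ^ (ν - a - s) * rC y ^ (ν - a - t)) := by
  obtain ⟨C, hC, H⟩ := exists_lintegral_Q_add_le (m := m) (a := a) (α := ν - m / 2 - 1 - s)
    (β := ν - m / 2 - 1 - t) (by linarith) (by linarith) (by linarith) (by linarith)
  refine ⟨C, hC, fun y hy => ?_⟩
  rw [lintegral_coneMeasure (by fun_prop), ← ENNReal.ofReal_mul hC.le]
  refine le_trans (le_of_eq ?_) ((H y hy).trans (le_of_eq ?_))
  · refine setLIntegral_congr_fun measurableSet_lightCone fun v hv => ?_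
    have hu := uC_pos hv
    have hr := rC_pos hv
    have hQ := Q_pos (add_mem_lightCone hy hv)
    unfold wgt
    rw [Q_eq_mul hv, Real.mul_rpow hu.le hr.le]
    rw [← ENNReal.ofReal_mul (by positivity), ← ENNReal.ofReal_mul (by positivity)]
    congr 1
    rw [sub_eq_add_neg _ s, sub_eq_add_neg _ t, Real.rpow_add hu, Real.rpow_add hr]
    ring
  · ring_nf

theorem exists_lintegral_coneMeasure_Q_add_rpow_le {ν a : ℝ} (hν : (m : ℝ) / 2 < ν)
    (ha : ν + m / 2 < a) : ∃ C : ℝ, 0 < C ∧ ∀ y ∈ lightCone (m + 2),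
      ∫⁻ v, ENNReal.ofReal (lorentzQ (m + 2) (y + v) ^ (-a)) ∂(coneMeasure m ν) ≤
        ENNReal.ofReal (C * lorentzQ (m + 2) y ^ (ν - a)) := by
  have hm0 : (0 : ℝ) ≤ m / 2 := by positivity
  obtain ⟨C, hC, H⟩ := exists_lintegral_coneMeasure_Q_add_le (m := m) (ν := ν) (a := a) (s := 0)
    (t := 0) (by linarith) (by linarith) (by linarith) (by linarith)
  refine ⟨C, hC, fun y hy => ?_⟩
  have := H y hy
  simp only [neg_zero, Real.rpow_zero, mul_one, ENNReal.ofReal_one, sub_zero] at this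
  rwa [← Real.mul_rpow (uC_pos hy).le (rC_pos hy).le, ← Q_eq_mul hy,
    ← ENNReal.ofReal_mul hC.le] at this

theorem exists_schur_exponents {N ν r r' : ℝ} (hN : 0 < N) (hν : N < ν)
    (hr : r.HolderConjugate r') (h1 : r < 1 + ν / N) (h2 : r' < 1 + ν / N) :
    ∃ s t : ℝ, (N < s * r ∧ s * r < ν) ∧ (N < s * r' ∧ s * r' < ν) ∧
      (0 < t * r ∧ t * r < ν - N) ∧ (0 < t * r' ∧ t * r' < ν - N) := by
  have hr0 := hr.pos
  have hr0' := hr.symm.pos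
  have hmul := hr.mul_eq_add
  have e1 : N * r < ν * r' := by
    have h : r < 1 + ν / N := h1
    have h3 : r * (r' - 1) = r' := by linarith
    have h4 : r' * (r - 1) = r := by linarith
    have h5 : r - 1 < ν / N := by linarith
    rw [lt_div_iff₀ hN] at h5
    nlinarith
  have e2 : N * r' < ν * r := by
    have h4 : r * (r' - 1) = r' := by linarith
    have h5 : r' - 1 < ν / N := by linarith
    rw [lt_div_iff₀ hN] at h5
    nlinarith
  obtain ⟨s, hs1, hs2⟩ := exists_between (a₁ := max (N / r) (N / r')) (a₂ := min (ν / r) (ν / r')) (by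
    rw [max_lt_iff, lt_min_iff, lt_min_iff]
    refine ⟨⟨by gcongr, ?_⟩, ?_, by gcongr⟩
    · rw [div_lt_div_iff₀ hr0 hr0']
      linarith
    · rw [div_lt_div_iff₀ hr0' hr0]
      linarith)
  obtain ⟨t, ht1, ht2⟩ := exists_between (a₁ := 0) (a₂ := min ((ν - N) / r) ((ν - N) / r')) (by
    have : 0 < ν - N := by linarith
    positivity)
  rw [max_lt_iff, div_lt_iff₀ hr0, div_lt_iff₀ hr0'] at hs1
  rw [lt_min_iff, lt_div_iff₀ hr0, lt_div_iff₀ hr0'] at hs2 ht2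
  exact ⟨s, t, ⟨hs1.1, hs2.1⟩, ⟨hs1.2, hs2.2⟩, ⟨by positivity, ht2.1⟩, ⟨by positivity, ht2.2⟩⟩

theorem exists_lintegral_coneMeasure_schur {ν r r' : ℝ} (hm : 0 < m) (hν : (m : ℝ) / 2 < ν)
    (hr : r.HolderConjugate r') (h1 : r < 1 + ν / (m / 2)) (h2 : r' < 1 + ν / (m / 2)) :
    ∃ C : ℝ≥0∞, C ≠ ∞ ∧ ∀ f : (Fin (m + 2) → ℝ) → ℝ≥0∞, Measurable f →
      ∫⁻ y, (∫⁻ v, ENNReal.ofReal (lorentzQ (m + 2) (y + v) ^ (-ν)) * f v ∂(coneMeasure m ν)) ^ r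
        ∂(coneMeasure m ν) ≤ C * ∫⁻ v, f v ^ r ∂(coneMeasure m ν) := by
  obtain ⟨s, t, ⟨hs1, hs2⟩, ⟨hs3, hs4⟩, ⟨ht1, ht2⟩, ⟨ht3, ht4⟩⟩ :=
    exists_schur_exponents (N := m / 2) (by positivity) hν hr h1 h2
  obtain ⟨A, hA, HA⟩ := exists_lintegral_coneMeasure_Q_add_le (m := m) (ν := ν) (a := ν)
    (s := s * r') (t := t * r') (by linarith) (by linarith) (by linarith) (by linarith)
  obtain ⟨B, hB, HB⟩ := exists_lintegral_coneMeasure_Q_add_le (m := m) (ν := ν) (a := ν)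
    (s := s * r) (t := t * r) (by linarith) (by linarith) (by linarith) (by linarith)
  simp only [sub_self, zero_sub] at HA HB
  set h : (Fin (m + 2) → ℝ) → ℝ≥0∞ := fun v => ENNReal.ofReal (uC v ^ (-s) * rC v ^ (-t)) with hh
  have hpow : ∀ v ∈ lightCone (m + 2), ∀ c : ℝ, 0 < c →
      h v ^ c = ENNReal.ofReal (uC v ^ (-(s * c)) * rC v ^ (-(t * c))) := by
    intro v hv c hc
    have hu := uC_pos hv
    have hr := rC_pos hv
    simp only [hh]
    rw [ENNReal.ofReal_rpow_of_pos (by positivity), Real.mul_rpow (by positivity) (by positivity),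
      ← Real.rpow_mul hu.le, ← Real.rpow_mul hr.le, neg_mul, neg_mul]
  refine ⟨ENNReal.ofReal A ^ (r / r') * ENNReal.ofReal B, ENNReal.mul_ne_top
    (ENNReal.rpow_ne_top_of_nonneg (div_nonneg hr.nonneg hr.symm.nonneg) ENNReal.ofReal_ne_top)
    ENNReal.ofReal_ne_top, fun f hf => ?_⟩
  refine lintegral_schur (h := h) (K := fun y v => ENNReal.ofReal (lorentzQ (m + 2) (y + v) ^ (-ν)))
    (by unfold Function.uncurry; fun_prop) hr (by fun_prop) ?_ ?_ ?_ hf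
  · filter_upwards [ae_mem_lightCone ν] with v hv
    have hu := uC_pos hv
    have hr := rC_pos hv
    refine ⟨?_, ENNReal.ofReal_ne_top⟩
    simp only [hh, ne_eq, ENNReal.ofReal_eq_zero, not_le]
    positivity
  · filter_upwards [ae_mem_lightCone ν] with y hy
    rw [hpow y hy _ hr.symm.pos]
    refine le_trans (le_of_eq ?_) (HA y hy)
    refine lintegral_coneMeasure_congr fun v hv => ?_
    rw [hpow v hv _ hr.symm.pos]
  · filter_upwards [ae_mem_lightCone ν] with v hv
    rw [hpow v hv _ hr.pos]
    refine le_trans (le_of_eq ?_) (HB v hv)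
    refine lintegral_coneMeasure_congr fun y hy => ?_
    rw [hpow y hy _ hr.pos, add_comm y v]

end schur

section laplace

variable {m : ℕ}

/-- The Euclidean pairing. -/
def dot (y ξ : Fin (m + 2) → ℝ) : ℝ := ∑ k, y k * ξ k

/-- The complex bilinear extension of `dot`. -/
def dotC (z : Fin (m + 2) → ℂ) (ξ : Fin (m + 2) → ℝ) : ℂ := ∑ k, z k * ξ k

@[fun_prop]
theorem measurable_dot (y : Fin (m + 2) → ℝ) : Measurable (dot y) := by
  unfold dot
  fun_prop

@[fun_prop]
theorem measurable_dotC (z : Fin (m + 2) → ℂ) : Measurable (dotC z) := by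
  unfold dotC
  fun_prop

theorem dotC_re (z : Fin (m + 2) → ℂ) (ξ : Fin (m + 2) → ℝ) :
    (dotC z ξ).re = dot (fun k => (z k).re) ξ := by
  simp [dotC, dot]

theorem dotC_prm (z : Fin (m + 2) → ℂ) (u ρ : ℝ) (x : Fin m → ℝ) :
    dotC z (prm (u, ρ, x)) = (z 0 - z 1) / 2 * u + (z 0 + z 1) / 2 * (ρ + (∑ i, (x i : ℂ) ^ 2) / u) +
      ∑ i, z i.succ.succ * x i := by
  unfold dotC
  rw [Fin.sum_univ_succ, Fin.sum_univ_succ]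
  have h1 : prm (u, ρ, x) (Fin.succ 0) = (ρ + nsq x / u - u) / 2 := rfl
  simp only [prm_zero, h1, prm_succ_succ, nsq]
  push_cast
  have : (Fin.succ 0 : Fin (m + 2)) = 1 := rfl
  rw [this]
  ring

theorem dot_prm (y : Fin (m + 2) → ℝ) (u ρ : ℝ) (x : Fin m → ℝ) :
    dot y (prm (u, ρ, x)) = uC y / 2 * u + wC y / 2 * (ρ + nsq x / u) + ∑ i, tail y i * x i := by
  have h := dotC_prm (fun k => (y k : ℂ)) u ρ x
  have h2 : dotC (fun k => (y k : ℂ)) (prm (u, ρ, x)) = (dot y (prm (u, ρ, x)) : ℝ) := by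
    simp [dot, dotC]
  rw [h2] at h
  unfold uC wC tail nsq
  exact_mod_cast h

theorem mul_cpow_of_re_pos {x y : ℂ} (hx : 0 < x.re) (hy : 0 < y.re) (s : ℂ) :
    (x * y) ^ s = x ^ s * y ^ s := by
  have hx0 : x ≠ 0 := fun h => by simp [h] at hx
  have hy0 : y ≠ 0 := fun h => by simp [h] at hy
  have h1 := abs_lt.1 (Complex.abs_arg_lt_pi_div_two_iff.2 (Or.inl hx))
  have h2 := abs_lt.1 (Complex.abs_arg_lt_pi_div_two_iff.2 (Or.inl hy))
  rw [cpow_def_of_ne_zero (mul_ne_zero hx0 hy0), cpow_def_of_ne_zero hx0, cpow_def_of_ne_zero hy0,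
    Complex.log_mul hx0 hy0 ⟨by linarith, by linarith⟩, add_mul, Complex.exp_add]

theorem inv_cpow_of_re_pos {x : ℂ} (hx : 0 < x.re) (s : ℂ) : x⁻¹ ^ s = x ^ (-s) := by
  have h1 := abs_lt.1 (Complex.abs_arg_lt_pi_div_two_iff.2 (Or.inl hx))
  rw [Complex.inv_cpow _ _ (by have := Real.pi_pos; linarith), cpow_neg]

theorem integral_gaussian_linear {b : ℝ} (hb : 0 < b) (c : Fin m → ℝ) :
    Integrable (fun x : Fin m → ℝ => Real.exp (-b * nsq x + ∑ i, c i * x i)) ∧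
    ∫ x : Fin m → ℝ, Real.exp (-b * nsq x + ∑ i, c i * x i) =
      (Real.pi / b) ^ ((m : ℝ) / 2) * Real.exp (nsq c / (4 * b)) := by
  have hb' : 0 < (b : ℂ).re := by simpa
  have he : ∀ x : Fin m → ℝ, cexp (-(b : ℂ) * ∑ i, (x i : ℂ) ^ 2 + ∑ i, (c i : ℂ) * x i) =
      ((Real.exp (-b * nsq x + ∑ i, c i * x i) : ℝ) : ℂ) := fun x => by
    simp [nsq]
  constructor
  · have := GaussianFourier.integrable_cexp_neg_mul_sum_add hb' (fun i => (c i : ℂ))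
    simp only [he] at this
    exact this.re
  · have := GaussianFourier.integral_cexp_neg_mul_sum_add hb' (fun i => (c i : ℂ))
    simp only [he] at this
    rw [integral_complex_ofReal] at this
    apply Complex.ofReal_injective
    rw [this, Complex.ofReal_mul, Complex.ofReal_cpow (by positivity)]
    simp [nsq]

/-- The constant in the Laplace transform of `Q ^ t` over the cone. -/
def laplaceConst (m : ℕ) (t : ℝ) : ℝ :=
  2⁻¹ * Real.Gamma (t + 1) * Real.Gamma (t + 1 + m / 2) * Real.pi ^ ((m : ℝ) / 2) *
    4 ^ (t + 1 + m / 2 : ℝ)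

theorem laplaceConst_pos {t : ℝ} (ht : -1 < t) : 0 < laplaceConst m t := by
  have h1 := Real.Gamma_pos_of_pos (show 0 < t + 1 by linarith)
  have h2 := Real.Gamma_pos_of_pos (show 0 < t + 1 + (m : ℝ) / 2 from add_pos_of_pos_of_nonneg (by linarith) (by positivity))
  unfold laplaceConst
  positivity

theorem lintegral_laplace {t : ℝ} (ht : -1 < t) {y : Fin (m + 2) → ℝ} (hy : y ∈ lightCone (m + 2)) :
    ∫⁻ ξ in lightCone (m + 2), ENNReal.ofReal (Real.exp (-dot y ξ) * lorentzQ (m + 2) ξ ^ t) =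
      ENNReal.ofReal (laplaceConst m t * lorentzQ (m + 2) y ^ (-(t + 1 + m / 2))) := by
  have hQ := Q_pos hy
  have hu := uC_pos hy
  have hw := wC_pos hy
  have hQe := lorentzQ_eq y
  set B := wC y / 2 with hB
  have hB0 : 0 < B := by positivity
  set D := uC y / 2 - nsq (tail y) / (4 * B) with hD
  have hDB : 4 * B * D = lorentzQ (m + 2) y := by
    rw [hD, hQe, hB]
    field_simp
    ring
  have hD0 : 0 < D := by
    by_contra h
    nlinarith
  have hΓ1 := Real.Gamma_pos_of_pos (show 0 < t + 1 by linarith)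
  have hs : 0 < t + 1 + (m : ℝ) / 2 :=
    add_pos_of_pos_of_nonneg (by linarith) (by positivity)
  have hΓ2 := Real.Gamma_pos_of_pos hs
  rw [lintegral_lightCone (by fun_prop)]
  have inner : ∀ u ∈ Ioi (0 : ℝ), ∫⁻ ρ in Ioi (0 : ℝ), ∫⁻ x : Fin m → ℝ,
      ENNReal.ofReal (Real.exp (-dot y (prm (u, ρ, x))) * lorentzQ (m + 2) (prm (u, ρ, x)) ^ t) =
      ENNReal.ofReal (Real.Gamma (t + 1) * B ^ (-(t + 1)) * (Real.pi / B) ^ ((m : ℝ) / 2)) *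
        ENNReal.ofReal (u ^ (t + 1 + (m : ℝ) / 2 - 1) * Real.exp (-(D * u))) := by
    intro u hu'
    have hu0 : 0 < u := hu'
    obtain ⟨gi, gv⟩ := integral_gaussian_linear (m := m) (b := B / u) (by positivity)
      (fun i => -tail y i)
    have hx : ∀ ρ ∈ Ioi (0 : ℝ), ∫⁻ x : Fin m → ℝ, ENNReal.ofReal (Real.exp
        (-dot y (prm (u, ρ, x))) * lorentzQ (m + 2) (prm (u, ρ, x)) ^ t) =
        ENNReal.ofReal (u ^ t * Real.exp (-(uC y / 2 * u)) *
          ((Real.pi / (B / u)) ^ ((m : ℝ) / 2) * Real.exp (nsq (tail y) / (4 * (B / u))))) *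
        ENNReal.ofReal (ρ ^ (t + 1 - 1) * Real.exp (-(B * ρ))) := by
      intro ρ hρ
      have hρ0 : 0 < ρ := hρ
      have e1 : ∀ x : Fin m → ℝ, ENNReal.ofReal (Real.exp
          (-dot y (prm (u, ρ, x))) * lorentzQ (m + 2) (prm (u, ρ, x)) ^ t) =
          ENNReal.ofReal (u ^ t * Real.exp (-(uC y / 2 * u)) *
            (ρ ^ (t + 1 - 1) * Real.exp (-(B * ρ)))) *
          ENNReal.ofReal (Real.exp (-(B / u) * nsq x + ∑ i, -tail y i * x i)) := by
        intro x
        rw [← ENNReal.ofReal_mul (by positivity)]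
        congr 1
        rw [dot_prm, Q_prm hu0.ne', Real.mul_rpow hu0.le hρ0.le, add_sub_cancel_right]
        have : -(uC y / 2 * u + wC y / 2 * (ρ + nsq x / u) + ∑ i, tail y i * x i) =
            -(uC y / 2 * u) + -(B * ρ) + (-(B / u) * nsq x + ∑ i, -tail y i * x i) := by
          simp only [neg_mul, Finset.sum_neg_distrib, hB]
          ring
        rw [this, Real.exp_add, Real.exp_add]
        ring
      simp only [e1]
      rw [lintegral_const_mul _ (by fun_prop), ← ofReal_integral_eq_lintegral_ofReal gi
        (Filter.Eventually.of_forall fun x => (Real.exp_pos _).le), gv,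
        ← ENNReal.ofReal_mul (by positivity), ← ENNReal.ofReal_mul (by positivity)]
      congr 1
      have : nsq (fun i => -tail y i) = nsq (tail y) := by simp [nsq]
      rw [this]
      ring
    rw [setLIntegral_congr_fun measurableSet_Ioi hx, lintegral_const_mul _ (by fun_prop),
      lintegral_gamma (by linarith) hB0, ← ENNReal.ofReal_mul (by positivity),
      ← ENNReal.ofReal_mul (by positivity)]
    congr 1
    have e2 : Real.pi / (B / u) = Real.pi / B * u := by field_simp
    have e3 : Real.exp (-(D * u)) = Real.exp (-(uC y / 2 * u)) *
        Real.exp (nsq (tail y) / (4 * (B / u))) := by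
      rw [← Real.exp_add]
      congr 1
      rw [hD]
      field_simp
      ring
    have e4 : u ^ (t + 1 + (m : ℝ) / 2 - 1) = u ^ t * u ^ ((m : ℝ) / 2) := by
      rw [← Real.rpow_add hu0]
      ring_nf
    rw [e2, e3, e4, Real.mul_rpow (by positivity) hu0.le]
    ring
  rw [setLIntegral_congr_fun measurableSet_Ioi inner, lintegral_const_mul _ (by fun_prop),
    lintegral_gamma hs hD0, ← ENNReal.ofReal_mul (by positivity),
    show (2⁻¹ : ℝ≥0∞) = ENNReal.ofReal 2⁻¹ by
      rw [ENNReal.ofReal_inv_of_pos (by norm_num)]; norm_num,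
    ← ENNReal.ofReal_mul (by positivity)]
  congr 1
  rw [← hDB, Real.mul_rpow (by positivity) hD0.le, Real.mul_rpow (by positivity) hB0.le,
    Real.div_rpow Real.pi_pos.le hB0.le]
  have e5 : B ^ (-(t + 1 + (m : ℝ) / 2)) = B ^ (-(t + 1)) * (B ^ ((m : ℝ) / 2))⁻¹ := by
    rw [← Real.rpow_neg hB0.le, ← Real.rpow_add hB0]
    ring_nf
  have e6 : (4 : ℝ) ^ (t + 1 + (m : ℝ) / 2) * (4 : ℝ) ^ (-(t + 1 + (m : ℝ) / 2)) = 1 := by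
    rw [← Real.rpow_add (by norm_num)]
    simp
  unfold laplaceConst
  rw [e5]
  linear_combination (-(2⁻¹ * Real.Gamma (t + 1) * Real.Gamma (t + 1 + (m : ℝ) / 2) *
    Real.pi ^ ((m : ℝ) / 2) * B ^ (-(t + 1)) * (B ^ ((m : ℝ) / 2))⁻¹ *
      D ^ (-(t + 1 + (m : ℝ) / 2)))) * e6

/-- The coordinatewise real part. -/
def reC (z : Fin (m + 2) → ℂ) : Fin (m + 2) → ℝ := fun k => (z k).re

theorem re_sq_div_le (z : ℂ) {B : ℂ} (hB : 0 < B.re) : (z ^ 2 / B).re ≤ z.re ^ 2 / B.re := by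
  have hn : 0 < Complex.normSq B := Complex.normSq_pos.2 fun h => by simp [h] at hB
  rw [Complex.div_re, ← add_div, div_le_div_iff₀ hn hB, Complex.normSq_apply]
  have h1 : (z ^ 2).re = z.re ^ 2 - z.im ^ 2 := by rw [pow_two, Complex.mul_re]; ring
  have h2 : (z ^ 2).im = 2 * z.re * z.im := by rw [pow_two, Complex.mul_im]; ring
  rw [h1, h2]
  nlinarith [sq_nonneg (z.re * B.im - z.im * B.re)]

theorem integrableOn_laplace {t : ℝ} (ht : -1 < t) {z : Fin (m + 2) → ℂ}
    (hz : reC z ∈ lightCone (m + 2)) :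
    IntegrableOn (fun ξ => cexp (-dotC z ξ) * ((lorentzQ (m + 2) ξ ^ t : ℝ) : ℂ))
      (lightCone (m + 2)) := by
  refine ⟨by fun_prop, ?_⟩
  rw [hasFiniteIntegral_iff_enorm, setLIntegral_congr_fun (g := fun ξ => ENNReal.ofReal
    (Real.exp (-dot (reC z) ξ) * lorentzQ (m + 2) ξ ^ t)) measurableSet_lightCone]
  · rw [lintegral_laplace ht hz]
    exact ENNReal.ofReal_lt_top
  · intro ξ hξ
    have := Q_pos hξ
    change ‖_‖ₑ = ENNReal.ofReal _
    rw [← ofReal_norm, norm_mul, Complex.norm_exp, Complex.norm_real, Real.norm_of_nonneg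
      (by positivity), Complex.neg_re, dotC_re]
    rfl

theorem integral_laplace {t : ℝ} (ht : -1 < t) {z : Fin (m + 2) → ℂ}
    (hz : reC z ∈ lightCone (m + 2)) :
    ∫ ξ in lightCone (m + 2), cexp (-dotC z ξ) * ((lorentzQ (m + 2) ξ ^ t : ℝ) : ℂ) =
      (laplaceConst m t : ℂ) * lorentzQC (m + 2) z ^ (-(t + 1 + m / 2) : ℂ) := by
  have hi := integrableOn_laplace ht hz
  have hQ := Q_pos hz
  have hw := wC_pos hz
  have hQe := lorentzQ_eq (reC z)
  set A := (z 0 - z 1) / 2 with hA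
  set B := (z 0 + z 1) / 2 with hB
  have hAre : A.re = uC (reC z) / 2 := by simp [hA, uC, reC]
  have hBre : B.re = wC (reC z) / 2 := by simp [hB, wC, reC]
  have hB0 : 0 < B.re := by rw [hBre]; positivity
  have hBn : B ≠ 0 := fun h => by simp [h] at hB0
  set S := ∑ i : Fin m, z i.succ.succ ^ 2 with hS
  set D := A - S / B / 4 with hD
  have hDB : 4 * (B * D) = lorentzQC (m + 2) z := by
    rw [lorentzQC_eq, ← hS, hD]
    field_simp
    rw [hA, hB]
    ring
  have hD0 : 0 < D.re := by
    have h1 : (S / B).re ≤ nsq (tail (reC z)) / B.re := by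
      rw [hS, Finset.sum_div, Complex.re_sum, nsq, Finset.sum_div]
      exact Finset.sum_le_sum fun i _ => re_sq_div_le _ hB0
    have h2 : D.re = A.re - (S / B).re / 4 := by
      rw [hD, Complex.sub_re, show (4 : ℂ) = ((4 : ℝ) : ℂ) by norm_num, Complex.div_ofReal_re]
    have h3 : 4 * B.re * (A.re - nsq (tail (reC z)) / B.re / 4) = lorentzQ (m + 2) (reC z) := by
      rw [hQe, hAre, hBre]
      field_simp
      ring
    have h4 : 0 < A.re - nsq (tail (reC z)) / B.re / 4 := by
      by_contra h
      nlinarith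
    linarith
  have hs : 0 < t + 1 + (m : ℝ) / 2 :=
    add_pos_of_pos_of_nonneg (by linarith) (by positivity)
  rw [IntegrableOn, restrict_lightCone] at hi
  have hi' := ((integrable_smul_measure (by simp) (by simp)).1 hi).comp_measurable measurable_prm
  rw [restrict_lightCone, integral_smul_measure, integral_map measurable_prm.aemeasurable
    (by fun_prop)]
  simp only [Function.comp_def] at hi'
  rw [integral_prod _ hi']
  have inner : ∀ u ∈ Ioi (0 : ℝ), ∫ p : ℝ × (Fin m → ℝ), cexp (-dotC z (prm (u, p))) *
      ((lorentzQ (m + 2) (prm (u, p)) ^ t : ℝ) : ℂ) ∂((volume.restrict (Ioi (0 : ℝ))).prod volume) =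
      (Real.Gamma (t + 1) * B ^ (-(t + 1) : ℂ) * (Real.pi ^ ((m : ℂ) / 2) * B ^ (-(m / 2) : ℂ))) *
        (((u ^ (t + 1 + (m : ℝ) / 2 - 1) : ℝ) : ℂ) * cexp (-(D * u))) := by
    intro u hu'
    have hu0 : 0 < u := hu'
    have hun : (u : ℂ) ≠ 0 := by exact_mod_cast hu0.ne'
    have hBu : 0 < (B / u).re := by
      rw [Complex.div_ofReal_re]
      positivity
    have e1 : ∀ᵐ p : ℝ × (Fin m → ℝ) ∂((volume.restrict (Ioi (0 : ℝ))).prod volume),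
        cexp (-dotC z (prm (u, p))) * ((lorentzQ (m + 2) (prm (u, p)) ^ t : ℝ) : ℂ) =
        (((u ^ t : ℝ) : ℂ) * cexp (-(A * u)) * (((p.1 ^ (t + 1 - 1) : ℝ) : ℂ) * cexp (-(B * p.1)))) *
          cexp (-(B / u) * ∑ i, (p.2 i : ℂ) ^ 2 + ∑ i, -z i.succ.succ * p.2 i) := by
      have : ∀ᵐ p : ℝ × (Fin m → ℝ) ∂((volume.restrict (Ioi (0 : ℝ))).prod volume),
          p.1 ∈ Ioi (0 : ℝ) :=
        Measure.quasiMeasurePreserving_fst.ae (ae_restrict_mem measurableSet_Ioi)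
      filter_upwards [this] with p hp
      obtain ⟨ρ, x⟩ := p
      have hρ0 : 0 < ρ := hp
      rw [dotC_prm, Q_prm hu0.ne', Real.mul_rpow hu0.le hρ0.le, add_sub_cancel_right, ← hA, ← hB]
      have : -(A * u + B * (ρ + (∑ i, (x i : ℂ) ^ 2) / u) + ∑ i, z i.succ.succ * x i) =
          -(A * u) + -(B * ρ) + (-(B / u) * ∑ i, (x i : ℂ) ^ 2 + ∑ i, -z i.succ.succ * x i) := by
        simp only [neg_mul, Finset.sum_neg_distrib]
        ring
      rw [this, Complex.exp_add, Complex.exp_add]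
      push_cast
      ring
    rw [integral_congr_ae e1, integral_prod_mul (fun ρ : ℝ => ((u ^ t : ℝ) : ℂ) * cexp (-(A * u)) *
      (((ρ ^ (t + 1 - 1) : ℝ) : ℂ) * cexp (-(B * ρ)))) (fun x : Fin m → ℝ =>
        cexp (-(B / u) * ∑ i, (x i : ℂ) ^ 2 + ∑ i, -z i.succ.succ * x i)),
      integral_const_mul, integral_rpow_mul_cexp (by linarith) hB0,
      GaussianFourier.integral_cexp_neg_mul_sum_add hBu, Fintype.card_fin]
    have e2 : (Real.pi / (B / u) : ℂ) ^ ((m : ℂ) / 2) =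
        Real.pi ^ ((m : ℂ) / 2) * B ^ (-(m / 2) : ℂ) * ((u ^ ((m : ℝ) / 2) : ℝ) : ℂ) := by
      have h1 : (Real.pi / (B / u) : ℂ) = ((Real.pi * u : ℝ) : ℂ) * B⁻¹ := by
        push_cast
        field_simp
      have hBi : 0 < (B⁻¹).re := by
        rw [Complex.inv_re]
        exact div_pos hB0 (Complex.normSq_pos.2 hBn)
      rw [h1, mul_cpow_of_re_pos (by rw [Complex.ofReal_re]; positivity) hBi,
        inv_cpow_of_re_pos hB0, Complex.ofReal_mul, mul_cpow_ofReal_nonneg Real.pi_pos.le hu0.le,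
        Complex.ofReal_cpow hu0.le]
      push_cast
      ring
    have e3 : cexp (-(D * u)) = cexp (-(A * u)) * cexp ((∑ i, (-z (Fin.succ (Fin.succ i))) ^ 2) / (4 * (B / u))) := by
      rw [← Complex.exp_add]
      congr 1
      simp only [neg_sq, ← hS]
      rw [hD]
      field_simp
      ring
    have e4 : u ^ (t + 1 + (m : ℝ) / 2 - 1) = u ^ t * u ^ ((m : ℝ) / 2) := by
      rw [← Real.rpow_add hu0]
      ring_nf
    rw [e2, e3, e4]
    push_cast
    ring
  rw [setIntegral_congr_fun measurableSet_Ioi inner, integral_const_mul,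
    integral_rpow_mul_cexp hs hD0, ← hDB]
  have hBD : 0 < B.re ∧ 0 < D.re := ⟨hB0, hD0⟩
  have e5 : (4 * (B * D)) ^ (-(t + 1 + m / 2) : ℂ) = ((4 ^ (t + 1 + m / 2 : ℝ) : ℝ) : ℂ)⁻¹ *
      (B ^ (-(t + 1) : ℂ) * B ^ (-(m / 2) : ℂ)) * D ^ (-(t + 1 + m / 2) : ℂ) := by
    rw [← mul_assoc, mul_cpow_of_re_pos _ hD0, mul_cpow_of_re_pos _ hB0, ← cpow_add _ _ hBn,
      ← Complex.ofReal_inv, ← Real.rpow_neg (by norm_num), Complex.ofReal_cpow (by norm_num)]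
    · push_cast
      ring_nf
    · norm_num
    · simpa using hB0
  have e6 : (((4 : ℝ) ^ (t + 1 + m / 2 : ℝ) : ℝ) : ℂ) ≠ 0 := by
    have : (4 : ℝ) ^ (t + 1 + m / 2 : ℝ) ≠ 0 := by positivity
    exact_mod_cast this
  have e7 : ((Real.pi ^ ((m : ℝ) / 2) : ℝ) : ℂ) = Real.pi ^ ((m : ℂ) / 2) := by
    rw [Complex.ofReal_cpow Real.pi_pos.le]
    push_cast
    rfl
  rw [e5, laplaceConst]
  simp only [Complex.ofReal_mul, e7]
  rw [Complex.real_smul, show (2⁻¹ : ℝ≥0∞).toReal = 2⁻¹ by simp]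
  push_cast
  generalize (((4 : ℝ) ^ (t + 1 + m / 2 : ℝ) : ℝ) : ℂ) = E at e6 ⊢
  field_simp

theorem norm_lorentzQC_cpow_le {a : ℝ} (ha : (m : ℝ) / 2 < a) {z : Fin (m + 2) → ℂ}
    (hz : reC z ∈ lightCone (m + 2)) :
    ‖lorentzQC (m + 2) z ^ (-a : ℂ)‖ ≤ lorentzQ (m + 2) (reC z) ^ (-a) := by
  set t := a - 1 - (m : ℝ) / 2 with ht
  have ht1 : -1 < t := by linarith
  have hc := laplaceConst_pos (m := m) ht1
  have h1 := integral_laplace ht1 hz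
  have h2 : (-(t + 1 + m / 2) : ℂ) = -a := by rw [ht]; push_cast; ring
  have h2' : -(t + 1 + m / 2) = -a := by rw [ht]; ring
  have h3 := lintegral_laplace ht1 hz
  rw [h2] at h1
  rw [h2'] at h3
  have hQ := Q_pos hz
  have h4 : ‖(laplaceConst m t : ℂ) * lorentzQC (m + 2) z ^ (-a : ℂ)‖ₑ ≤
      ENNReal.ofReal (laplaceConst m t * lorentzQ (m + 2) (reC z) ^ (-a)) := by
    rw [← h1, ← h3]
    refine (enorm_integral_le_lintegral_enorm _).trans (le_of_eq ?_)
    refine setLIntegral_congr_fun measurableSet_lightCone fun ξ hξ => ?_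
    have := Q_pos hξ
    change ‖_‖ₑ = ENNReal.ofReal _
    rw [← ofReal_norm, norm_mul, Complex.norm_exp, Complex.norm_real, Real.norm_of_nonneg
      (by positivity), Complex.neg_re, dotC_re]
    rfl
  rw [← ofReal_norm, ENNReal.ofReal_le_ofReal_iff (by positivity), norm_mul,
    Complex.norm_real, Real.norm_of_nonneg hc.le] at h4
  exact le_of_mul_le_mul_left h4 hc

end laplace

section kernel

variable {m : ℕ}

/-- The point `w - i x`. -/
def zpt (x w : Fin (m + 2) → ℝ) : Fin (m + 2) → ℂ := fun k => (w k : ℂ) - x k * I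

@[simp] theorem reC_zpt (x w : Fin (m + 2) → ℝ) : reC (zpt x w) = w := by
  ext k
  simp [reC, zpt]

/-- The Bergman kernel at `w - i x`. -/
def kern (ν : ℝ) (x w : Fin (m + 2) → ℝ) : ℂ :=
  lorentzQC (m + 2) (zpt x w) ^ (-((ν + m / 2 + 1 : ℝ) : ℂ))

@[fun_prop]
theorem measurable_kern {α : Type*} [MeasurableSpace α] (ν : ℝ) {f g : α → Fin (m + 2) → ℝ}
    (hf : Measurable f) (hg : Measurable g) : Measurable fun p => kern ν (f p) (g p) := by
  unfold kern lorentzQC zpt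
  fun_prop

theorem norm_kern_le {ν : ℝ} (hν : (m : ℝ) / 2 < ν) (x : Fin (m + 2) → ℝ) {w : Fin (m + 2) → ℝ}
    (hw : w ∈ lightCone (m + 2)) : ‖kern ν x w‖ ≤ lorentzQ (m + 2) w ^ (-(ν + m / 2 + 1)) := by
  have hm : (0 : ℝ) ≤ m / 2 := by positivity
  have := norm_lorentzQC_cpow_le (m := m) (a := ν + m / 2 + 1) (by linarith) (z := zpt x w)
    (by simpa using hw)
  rwa [reC_zpt] at this

theorem cexp_neg_dotC_zpt (x w ξ : Fin (m + 2) → ℝ) :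
    cexp (-dotC (zpt x w) ξ) = chr x ξ * (Real.exp (-dot w ξ) : ℝ) := by
  unfold chr
  rw [Complex.ofReal_exp, ← Complex.exp_add]
  congr 1
  simp only [dotC, zpt, dot, sub_mul, Finset.sum_sub_distrib]
  push_cast
  rw [Finset.sum_mul]
  have : ∀ k, (x k : ℂ) * I * ξ k = x k * ξ k * I := fun k => by ring
  simp only [this]
  ring

theorem integral_chr_laplace {t : ℝ} (ht : -1 < t) (x : Fin (m + 2) → ℝ) {w : Fin (m + 2) → ℝ}
    (hw : w ∈ lightCone (m + 2)) :
    ∫ ξ in lightCone (m + 2), chr x ξ * ((Real.exp (-dot w ξ) * lorentzQ (m + 2) ξ ^ t : ℝ) : ℂ) =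
      (laplaceConst m t : ℂ) * lorentzQC (m + 2) (zpt x w) ^ (-((t + 1 + m / 2 : ℝ) : ℂ)) := by
  have := integral_laplace ht (z := zpt x w) (by simpa using hw)
  simp only [cexp_neg_dotC_zpt] at this
  push_cast
  rw [← this]
  refine integral_congr_ae (Filter.Eventually.of_forall fun ξ => ?_)
  push_cast
  ring

theorem kern_eq_integral {ν : ℝ} (hν : (m : ℝ) / 2 < ν) (x : Fin (m + 2) → ℝ)
    {w : Fin (m + 2) → ℝ} (hw : w ∈ lightCone (m + 2)) :
    (laplaceConst m ν : ℂ) * kern ν x w = ∫ ξ in lightCone (m + 2),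
      chr x ξ * ((Real.exp (-dot w ξ) * lorentzQ (m + 2) ξ ^ ν : ℝ) : ℂ) := by
  have hm : (0 : ℝ) ≤ m / 2 := by positivity
  rw [integral_chr_laplace (by linarith) x hw, kern]
  congr 4
  ring

theorem kern_neg {ν : ℝ} (hν : (m : ℝ) / 2 < ν) (x : Fin (m + 2) → ℝ)
    {w : Fin (m + 2) → ℝ} (hw : w ∈ lightCone (m + 2)) :
    kern ν (-x) w = (starRingEnd ℂ) (kern ν x w) := by
  have hm : (0 : ℝ) ≤ m / 2 := by positivity
  have h1 := kern_eq_integral hν x hw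
  have h2 := kern_eq_integral hν (-x) hw
  have hc : (laplaceConst m ν : ℂ) ≠ 0 := by
    exact_mod_cast (laplaceConst_pos (by linarith)).ne'
  apply mul_left_cancel₀ hc
  rw [h2, ← Complex.conj_ofReal (laplaceConst m ν), ← map_mul, h1, ← integral_conj]
  refine integral_congr_ae (Filter.Eventually.of_forall fun ξ => ?_)
  simp only [map_mul, Complex.conj_ofReal]
  congr 1
  simp [chr, ← Complex.exp_conj]

theorem integrableOn_exp_mul_Q_rpow {t : ℝ} (ht : -1 < t) {w : Fin (m + 2) → ℝ}
    (hw : w ∈ lightCone (m + 2)) :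
    IntegrableOn (fun ξ => ((Real.exp (-dot w ξ) * lorentzQ (m + 2) ξ ^ t : ℝ) : ℂ))
      (lightCone (m + 2)) := by
  have := integrableOn_laplace ht (z := zpt 0 w) (by simpa using hw)
  simp only [cexp_neg_dotC_zpt] at this
  refine this.congr (Filter.Eventually.of_forall fun ξ => ?_)
  simp [chr]

theorem lorentzQ_smul (c : ℝ) (y : Fin (m + 2) → ℝ) :
    lorentzQ (m + 2) (c • y) = c ^ 2 * lorentzQ (m + 2) y := by
  simp only [lorentzQ, Pi.smul_apply, smul_eq_mul, mul_sub, Finset.mul_sum, mul_pow]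

theorem smul_mem_lightCone {c : ℝ} (hc : 0 < c) {y : Fin (m + 2) → ℝ}
    (hy : y ∈ lightCone (m + 2)) : c • y ∈ lightCone (m + 2) := by
  obtain ⟨h1, h2⟩ := hy
  refine ⟨by simp only [Pi.smul_apply, smul_eq_mul]; positivity, ?_⟩
  rw [lorentzQ_smul]
  positivity

theorem exists_lintegral_kern_le {ν : ℝ} (hν : (m : ℝ) / 2 < ν) : ∃ C : ℝ, 0 < C ∧
    ∀ w ∈ lightCone (m + 2), ∫⁻ x, ‖kern ν x w‖ₑ ≤
      ENNReal.ofReal (C * lorentzQ (m + 2) w ^ (-ν)) := by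
  have hm : (0 : ℝ) ≤ m / 2 := by positivity
  set t := (ν - m / 2 - 1) / 2 with ht
  have ht1 : -1 < t := by linarith
  have ht2 : -1 < 2 * t := by linarith
  set c := laplaceConst m t with hc
  have hc0 : 0 < c := laplaceConst_pos ht1
  have hd0 : 0 < laplaceConst m (2 * t) := laplaceConst_pos ht2
  set D := (2 * Real.pi) ^ (m + 2) * (laplaceConst m (2 * t) * 4 ^ (-ν)) with hD
  have hD0 : 0 < D := by positivity
  refine ⟨D / c ^ 2, by positivity, fun w hw => ?_⟩
  have hQ := Q_pos hw
  have hi := integrableOn_exp_mul_Q_rpow ht1 hw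
  set h : (Fin (m + 2) → ℝ) → ℂ := (lightCone (m + 2)).indicator
    fun ξ => ((Real.exp (-dot w ξ) * lorentzQ (m + 2) ξ ^ t : ℝ) : ℂ) with hh
  have hmeas : Measurable h := Measurable.indicator (by fun_prop) measurableSet_lightCone
  have h1 := lintegral_fourier_sq_le hmeas ((integrable_indicator_iff measurableSet_lightCone).2 hi)
  have h2 : ∀ x, ‖∫ ξ, chr x ξ * h ξ‖ₑ ^ (2 : ℝ) = ENNReal.ofReal (c ^ 2) * ‖kern ν x w‖ₑ := by
    intro x
    have e : ∀ ξ, chr x ξ * h ξ = (lightCone (m + 2)).indicator (fun ξ =>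
        chr x ξ * ((Real.exp (-dot w ξ) * lorentzQ (m + 2) ξ ^ t : ℝ) : ℂ)) ξ := fun ξ => by
      rw [hh, ← Set.indicator_mul_right]
    simp only [e]
    rw [integral_indicator measurableSet_lightCone, integral_chr_laplace ht1 x hw, ← ofReal_norm,
      ← ofReal_norm, norm_mul, kern, ← Complex.ofReal_neg, ← Complex.ofReal_neg,
      Complex.norm_cpow_real, Complex.norm_cpow_real, Complex.norm_real, Real.norm_of_nonneg hc0.le,
      ENNReal.ofReal_rpow_of_nonneg (by positivity) (by norm_num),
      ← ENNReal.ofReal_mul (by positivity), Real.mul_rpow hc0.le (by positivity),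
      ← Real.rpow_mul (norm_nonneg _), Real.rpow_two,
      show -(t + 1 + m / 2) * 2 = -(ν + m / 2 + 1) by rw [ht]; ring]
  have h3 : ∫⁻ ξ, ‖h ξ‖ₑ ^ (2 : ℝ) = ENNReal.ofReal
      (laplaceConst m (2 * t) * lorentzQ (m + 2) ((2 : ℝ) • w) ^ (-(2 * t + 1 + m / 2))) := by
    rw [← lintegral_laplace ht2 (smul_mem_lightCone (by norm_num) hw),
      ← lintegral_indicator measurableSet_lightCone]
    refine lintegral_congr fun ξ => ?_
    by_cases hξ : ξ ∈ lightCone (m + 2)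
    · have hQ' := Q_pos hξ
      rw [hh, indicator_of_mem hξ, indicator_of_mem hξ, ← ofReal_norm, Complex.norm_real,
        Real.norm_of_nonneg (by positivity),
        ENNReal.ofReal_rpow_of_nonneg (by positivity) (by norm_num),
        Real.mul_rpow (by positivity) (by positivity), ← Real.exp_mul, ← Real.rpow_mul hQ'.le]
      congr 3
      · simp only [dot, Pi.smul_apply, smul_eq_mul, mul_assoc, ← Finset.mul_sum]
        ring
      · ring
    · rw [hh, indicator_of_notMem hξ, indicator_of_notMem hξ]
      simp
  simp only [h2] at h1
  rw [h3, lintegral_const_mul _ (by fun_prop), lorentzQ_smul, Fintype.card_fin,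
    ← ENNReal.ofReal_mul (by positivity), Real.mul_rpow (by norm_num) hQ.le,
    show -(2 * t + 1 + m / 2) = -ν by rw [ht]; ring] at h1
  have h4 : ENNReal.ofReal (c ^ 2) ≠ 0 := by simp [hc0.ne']
  rw [← ENNReal.mul_le_mul_iff_right h4 ENNReal.ofReal_ne_top]
  refine h1.trans (le_of_eq ?_)
  rw [← ENNReal.ofReal_mul (by positivity), hD]
  congr 1
  field_simp
  norm_num

theorem sqrt_Q_mul_Q_le_dot {y ξ : Fin (m + 2) → ℝ} (hy : y ∈ lightCone (m + 2))
    (hξ : ξ ∈ lightCone (m + 2)) :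
    √(lorentzQ (m + 2) y * lorentzQ (m + 2) ξ) ≤ dot y ξ := by
  have hd : dot y ξ = uC y * uC ξ / 2 + wC y * wC ξ / 2 + ∑ i, tail y i * tail ξ i := by
    simp only [dot, Fin.sum_univ_succ, uC, wC, tail]
    have : (Fin.succ 0 : Fin (m + 2)) = 1 := rfl
    rw [this]
    ring
  have h1 := uC_pos hy
  have h2 := uC_pos hξ
  have h3 := wC_pos hy
  have h4 := wC_pos hξ
  have h5 := lorentzQ_eq y
  have h6 := lorentzQ_eq ξ
  have h7 := Q_pos hy
  have h8 := Q_pos hξ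
  have h9 := nsq_nonneg (tail y)
  have h10 := nsq_nonneg (tail ξ)
  set r := √(nsq (tail y) * nsq (tail ξ)) with hr
  set p := √(lorentzQ (m + 2) y * lorentzQ (m + 2) ξ) with hp
  have hr2 : r ^ 2 = nsq (tail y) * nsq (tail ξ) := Real.sq_sqrt (by positivity)
  have hp2 : p ^ 2 = lorentzQ (m + 2) y * lorentzQ (m + 2) ξ := Real.sq_sqrt (by positivity)
  have hcs : |∑ i, tail y i * tail ξ i| ≤ r := by
    rw [hr]
    exact Real.abs_le_sqrt (Finset.sum_mul_sq_le_sq_mul_sq _ _ _)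
  have hAM : p + r ≤ uC y * uC ξ / 2 + wC y * wC ξ / 2 := by
    refine abs_le_of_sq_le_sq' ?_ (by positivity) |>.2
    have e1 : (uC y * wC y) * (uC ξ * wC ξ) =
        (lorentzQ (m + 2) y + nsq (tail y)) * (lorentzQ (m + 2) ξ + nsq (tail ξ)) := by
      rw [h5, h6]; ring
    have e2 : 2 * (p * r) ≤ lorentzQ (m + 2) y * nsq (tail ξ) + lorentzQ (m + 2) ξ * nsq (tail y) := by
      refine abs_le_of_sq_le_sq' ?_ (by positivity) |>.2
      have : (p * r) ^ 2 = (lorentzQ (m + 2) y * nsq (tail ξ)) * (lorentzQ (m + 2) ξ * nsq (tail y)) := by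
        rw [mul_pow, hr2, hp2]; ring
      nlinarith [sq_nonneg (lorentzQ (m + 2) y * nsq (tail ξ) - lorentzQ (m + 2) ξ * nsq (tail y))]
    nlinarith [sq_nonneg (uC y * uC ξ - wC y * wC ξ)]
  rw [hd]
  linarith [neg_abs_le (∑ i, tail y i * tail ξ i)]

theorem exp_neg_dot_mul_Q_rpow_le {ν : ℝ} (hν : 0 < ν) {y ξ : Fin (m + 2) → ℝ}
    (hy : y ∈ lightCone (m + 2)) (hξ : ξ ∈ lightCone (m + 2)) :
    Real.exp (-dot y ξ) * lorentzQ (m + 2) ξ ^ ν ≤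
      (2 * ν) ^ (2 * ν) * lorentzQ (m + 2) y ^ (-ν) := by
  have h := sqrt_Q_mul_Q_le_dot hy hξ
  have h7 := Q_pos hy
  have h8 := Q_pos hξ
  set p := √(lorentzQ (m + 2) y * lorentzQ (m + 2) ξ) with hp
  have hp0 : 0 ≤ p := Real.sqrt_nonneg _
  have h1 : p ^ (2 * ν) ≤ (2 * ν) ^ (2 * ν) * Real.exp p := by
    have h2 : p / (2 * ν) ≤ Real.exp (p / (2 * ν)) := by
      have := Real.add_one_le_exp (p / (2 * ν))
      linarith
    have h3 := Real.rpow_le_rpow (by positivity) h2 (show 0 ≤ 2 * ν by positivity)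
    rw [← Real.exp_mul, div_mul_cancel₀ _ (by positivity), Real.div_rpow hp0 (by positivity),
      div_le_iff₀ (by positivity)] at h3
    linarith
  have h2 : p ^ (2 * ν) = lorentzQ (m + 2) y ^ ν * lorentzQ (m + 2) ξ ^ ν := by
    rw [Real.rpow_mul hp0, ← Real.mul_rpow h7.le h8.le, Real.rpow_two, Real.sq_sqrt (by positivity)]
  have h3 : Real.exp (-dot y ξ) ≤ Real.exp (-p) := Real.exp_le_exp.2 (by linarith)
  calc Real.exp (-dot y ξ) * lorentzQ (m + 2) ξ ^ ν
      ≤ Real.exp (-p) * lorentzQ (m + 2) ξ ^ ν := by gcongr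
    _ = Real.exp (-p) * p ^ (2 * ν) * lorentzQ (m + 2) y ^ (-ν) := by
        rw [h2, Real.rpow_neg h7.le]
        have : lorentzQ (m + 2) y ^ ν ≠ 0 := by positivity
        field_simp
    _ ≤ Real.exp (-p) * ((2 * ν) ^ (2 * ν) * Real.exp p) * lorentzQ (m + 2) y ^ (-ν) := by gcongr
    _ = _ := by
        rw [Real.exp_neg]
        field_simp

end kernel

section absolute

variable {m : ℕ}

/-- The weighted measure on the tube, in the coordinates `(y, x)`. -/
def tubeMeasure (m : ℕ) (ν : ℝ) : Measure ((Fin (m + 2) → ℝ) × (Fin (m + 2) → ℝ)) :=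
  (coneMeasure m ν).prod volume

instance (ν : ℝ) : SFinite (tubeMeasure m ν) := by
  unfold tubeMeasure
  infer_instance

/-- The `L^p` norm in the second variable, parametrised by `a = 1 / p`. -/
def pn (a : ℝ) (f : (Fin (m + 2) → ℝ) × (Fin (m + 2) → ℝ) → ℂ) (y : Fin (m + 2) → ℝ) : ℝ≥0∞ :=
  (∫⁻ x, ‖f (y, x)‖ₑ ^ (1 / a)) ^ a

/-- The mixed norm, parametrised by `a = 1 / p` and `b = 1 / q`. -/
def mn (ν a b : ℝ) (f : (Fin (m + 2) → ℝ) × (Fin (m + 2) → ℝ) → ℂ) : ℝ≥0∞ :=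
  (∫⁻ y, pn a f y ^ (1 / b) ∂(coneMeasure m ν)) ^ b

/-- The Bergman kernel as a function of two points of the tube. -/
def bilKernel (ν : ℝ)
    (P : ((Fin (m + 2) → ℝ) × (Fin (m + 2) → ℝ)) × ((Fin (m + 2) → ℝ) × (Fin (m + 2) → ℝ))) : ℂ :=
  kern ν (P.1.2 - P.2.2) (P.1.1 + P.2.1)

/-- The bilinear form of the Bergman operator. -/
def bil (ν : ℝ) (f g : (Fin (m + 2) → ℝ) × (Fin (m + 2) → ℝ) → ℂ) : ℂ :=
  ∫ P, bilKernel ν P * (f P.2 * g P.1) ∂((tubeMeasure m ν).prod (tubeMeasure m ν))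

@[fun_prop]
theorem measurable_pn {a : ℝ} {f : (Fin (m + 2) → ℝ) × (Fin (m + 2) → ℝ) → ℂ} (hf : Measurable f) :
    Measurable (pn a f) := by
  unfold pn
  exact (Measurable.lintegral_prod_right' (f := fun p => ‖f p‖ₑ ^ (1 / a))
    (by fun_prop)).pow_const _

@[fun_prop]
theorem measurable_bilKernel (ν : ℝ) : Measurable (bilKernel (m := m) ν) := by
  unfold bilKernel
  fun_prop

theorem lintegral_tubeMeasure {ν : ℝ} {F : (Fin (m + 2) → ℝ) × (Fin (m + 2) → ℝ) → ℝ≥0∞}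
    (hF : Measurable F) :
    ∫⁻ p, F p ∂(tubeMeasure m ν) = ∫⁻ y, (∫⁻ x, F (y, x)) ∂(coneMeasure m ν) := by
  unfold tubeMeasure
  rw [lintegral_prod _ hF.aemeasurable]

theorem exists_lintegral_bilKernel_le {ν a b : ℝ} (hm : 0 < m) (hν : (m : ℝ) / 2 < ν)
    (ha0 : 0 < a) (ha1 : a < 1) (hb0 : 0 < b) (hb1 : b < 1)
    (h1 : 1 / b < 1 + ν / (m / 2)) (h2 : 1 / (1 - b) < 1 + ν / (m / 2)) :
    ∃ C : ℝ≥0∞, C ≠ ∞ ∧ ∀ f g : (Fin (m + 2) → ℝ) × (Fin (m + 2) → ℝ) → ℂ,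
      Measurable f → Measurable g →
      ∫⁻ P, ‖bilKernel ν P‖ₑ * (‖f P.2‖ₑ * ‖g P.1‖ₑ) ∂((tubeMeasure m ν).prod (tubeMeasure m ν)) ≤
        C * mn ν a b f * mn ν (1 - a) (1 - b) g := by
  have conj : ∀ t : ℝ, 0 < t → t < 1 → (1 / t).HolderConjugate (1 / (1 - t)) := by
    intro t h0 h1
    rw [Real.holderConjugate_iff]
    refine ⟨by rw [lt_div_iff₀ h0]; linarith, ?_⟩
    simp
  obtain ⟨K, hK, HK⟩ := exists_lintegral_kern_le hν
  obtain ⟨S, hS, HS⟩ := exists_lintegral_coneMeasure_schur hm hν (conj b hb0 hb1) h1 h2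
  refine ⟨ENNReal.ofReal K * S ^ b, ENNReal.mul_ne_top ENNReal.ofReal_ne_top
    (ENNReal.rpow_ne_top_of_nonneg hb0.le hS), fun f g hf hg => ?_⟩
  have hm1 : Measurable fun P : ((Fin (m + 2) → ℝ) × (Fin (m + 2) → ℝ)) ×
      ((Fin (m + 2) → ℝ) × (Fin (m + 2) → ℝ)) =>
      ‖bilKernel ν P‖ₑ * (‖f P.2‖ₑ * ‖g P.1‖ₑ) := by fun_prop
  have hm2 : Measurable fun p : (Fin (m + 2) → ℝ) × (Fin (m + 2) → ℝ) =>
      ENNReal.ofReal (lorentzQ (m + 2) (p.1 + p.2) ^ (-ν)) * pn a f p.2 := by fun_prop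
  calc ∫⁻ P, ‖bilKernel ν P‖ₑ * (‖f P.2‖ₑ * ‖g P.1‖ₑ) ∂((tubeMeasure m ν).prod (tubeMeasure m ν))
      = ∫⁻ y, (∫⁻ v, (∫⁻ x, ∫⁻ u, ‖kern ν (x - u) (y + v)‖ₑ * ‖f (v, u)‖ₑ * ‖g (y, x)‖ₑ)
          ∂(coneMeasure m ν)) ∂(coneMeasure m ν) := by
        rw [lintegral_prod _ hm1.aemeasurable, lintegral_tubeMeasure hm1.lintegral_prod_right']
        refine lintegral_congr fun y => ?_
        have e : ∀ x, ∫⁻ p, ‖bilKernel ν ((y, x), p)‖ₑ * (‖f p‖ₑ * ‖g (y, x)‖ₑ)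
            ∂(tubeMeasure m ν) = ∫⁻ v, (∫⁻ u, ‖kern ν (x - u) (y + v)‖ₑ * ‖f (v, u)‖ₑ * ‖g (y, x)‖ₑ)
            ∂(coneMeasure m ν) := by
          intro x
          rw [lintegral_tubeMeasure (by fun_prop)]
          simp only [bilKernel, mul_assoc]
        simp only [e]
        refine lintegral_lintegral_swap (Measurable.aemeasurable ?_)
        exact Measurable.lintegral_prod_right' (f := fun q : ((Fin (m + 2) → ℝ) ×
          (Fin (m + 2) → ℝ)) × (Fin (m + 2) → ℝ) =>
          ‖kern ν (q.1.1 - q.2) (y + q.1.2)‖ₑ * ‖f (q.1.2, q.2)‖ₑ * ‖g (y, q.1.1)‖ₑ) (by fun_prop)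
    _ ≤ ∫⁻ y, ∫⁻ v, ENNReal.ofReal K * (ENNReal.ofReal (lorentzQ (m + 2) (y + v) ^ (-ν)) *
          pn a f v) * pn (1 - a) g y ∂(coneMeasure m ν) ∂(coneMeasure m ν) := by
        refine lintegral_coneMeasure_mono fun y hy => lintegral_coneMeasure_mono fun v hv => ?_
        have h := lintegral_lintegral_conv_mul_le (k := fun x => ‖kern ν x (y + v)‖ₑ)
          (f := fun u => ‖f (v, u)‖ₑ) (g := fun x => ‖g (y, x)‖ₑ) (by fun_prop) (by fun_prop)
          (by fun_prop) (conj a ha0 ha1)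
        refine h.trans ?_
        rw [one_div_one_div, one_div_one_div]
        unfold pn
        rw [← mul_assoc (ENNReal.ofReal K), ← ENNReal.ofReal_mul hK.le]
        gcongr
        exact HK _ (add_mem_lightCone hy hv)
    _ = ENNReal.ofReal K * ∫⁻ y, (∫⁻ v, ENNReal.ofReal (lorentzQ (m + 2) (y + v) ^ (-ν)) *
          pn a f v ∂(coneMeasure m ν)) * pn (1 - a) g y ∂(coneMeasure m ν) := by
        have hm3 : Measurable fun y => ∫⁻ v, ENNReal.ofReal (lorentzQ (m + 2) (y + v) ^ (-ν)) *
          pn a f v ∂(coneMeasure m ν) := hm2.lintegral_prod_right'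
        rw [← lintegral_const_mul _ (by fun_prop)]
        refine lintegral_congr fun y => ?_
        rw [lintegral_mul_const _ (by fun_prop), lintegral_const_mul _ (by fun_prop), mul_assoc]
    _ ≤ ENNReal.ofReal K * ((∫⁻ y, (∫⁻ v, ENNReal.ofReal (lorentzQ (m + 2) (y + v) ^ (-ν)) *
          pn a f v ∂(coneMeasure m ν)) ^ (1 / b) ∂(coneMeasure m ν)) ^ b * mn ν (1 - a) (1 - b) g) := by
        have hm3 : Measurable fun y => ∫⁻ v, ENNReal.ofReal (lorentzQ (m + 2) (y + v) ^ (-ν)) *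
          pn a f v ∂(coneMeasure m ν) := hm2.lintegral_prod_right'
        have h := ENNReal.lintegral_mul_le_Lp_mul_Lq (coneMeasure m ν) (conj b hb0 hb1)
          hm3.aemeasurable (measurable_pn (a := 1 - a) hg).aemeasurable
        rw [one_div_one_div, one_div_one_div] at h
        unfold mn
        gcongr ENNReal.ofReal K * ?_
        exact h
    _ ≤ ENNReal.ofReal K * ((S * ∫⁻ v, pn a f v ^ (1 / b) ∂(coneMeasure m ν)) ^ b *
          mn ν (1 - a) (1 - b) g) := by
        gcongr
        exact HS _ (measurable_pn hf)
    _ = _ := by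
        rw [ENNReal.mul_rpow_of_nonneg _ _ hb0.le]
        unfold mn
        ring

end absolute

section plancherel

variable {m : ℕ}

/-- Integrable functions supported away from the boundary of the cone. -/
structure Adm (ν : ℝ) (f : (Fin (m + 2) → ℝ) × (Fin (m + 2) → ℝ) → ℂ) : Prop where
  measurable : Measurable f
  integrable : Integrable f (tubeMeasure m ν)
  exists_le : ∃ k : ℝ, 0 < k ∧ ∀ p, f p ≠ 0 → k ≤ lorentzQ (m + 2) p.1

@[fun_prop]
theorem measurable_dot₂ {α : Type*} [MeasurableSpace α] {f g : α → Fin (m + 2) → ℝ}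
    (hf : Measurable f) (hg : Measurable g) : Measurable fun p => dot (f p) (g p) := by
  unfold dot
  fun_prop

theorem measurable_chr₂ {α : Type*} [MeasurableSpace α] {f g : α → Fin (m + 2) → ℝ}
    (hf : Measurable f) (hg : Measurable g) : Measurable fun p => chr (f p) (g p) :=
  measurable_chr.comp (hf.prodMk hg)

theorem chr_comm (ξ x : Fin (m + 2) → ℝ) : chr ξ x = chr x ξ := by
  unfold chr
  simp only [mul_comm]

theorem chr_neg_left (ξ x : Fin (m + 2) → ℝ) : chr (-ξ) x = chr ξ (-x) := by
  unfold chr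
  simp

theorem chr_add_right (ξ x y : Fin (m + 2) → ℝ) : chr ξ (x + y) = chr ξ x * chr ξ y := by
  unfold chr
  rw [← Complex.exp_add]
  congr 1
  simp only [Pi.add_apply, mul_add, Finset.sum_add_distrib]
  push_cast
  ring

theorem dot_add_left (y v ξ : Fin (m + 2) → ℝ) : dot (y + v) ξ = dot y ξ + dot v ξ := by
  simp [dot, add_mul, Finset.sum_add_distrib]

theorem dot_comm (y ξ : Fin (m + 2) → ℝ) : dot y ξ = dot ξ y := by
  simp [dot, mul_comm]

theorem dot_nonneg {y ξ : Fin (m + 2) → ℝ} (hy : y ∈ lightCone (m + 2))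
    (hξ : ξ ∈ lightCone (m + 2)) : 0 ≤ dot y ξ :=
  (Real.sqrt_nonneg _).trans (sqrt_Q_mul_Q_le_dot hy hξ)

/-- The Fourier-Laplace transform over the tube. -/
def lap (ν : ℝ) (f : (Fin (m + 2) → ℝ) × (Fin (m + 2) → ℝ) → ℂ) (η ξ : Fin (m + 2) → ℝ) : ℂ :=
  ∫ p, chr η p.2 * (Real.exp (-dot p.1 ξ) : ℂ) * f p ∂(tubeMeasure m ν)

/-- The Fourier transform in the second variable. -/
def ft (f : (Fin (m + 2) → ℝ) × (Fin (m + 2) → ℝ) → ℂ) (y η : Fin (m + 2) → ℝ) : ℂ :=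
  ∫ x, chr η x * f (y, x)

@[fun_prop]
theorem measurable_ft {α : Type*} [MeasurableSpace α]
    {f : (Fin (m + 2) → ℝ) × (Fin (m + 2) → ℝ) → ℂ} (hf : Measurable f)
    {u v : α → Fin (m + 2) → ℝ} (hu : Measurable u) (hv : Measurable v) :
    Measurable fun a => ft f (u a) (v a) := by
  have hz : Measurable fun z : ((Fin (m + 2) → ℝ) × (Fin (m + 2) → ℝ)) × (Fin (m + 2) → ℝ) =>
      chr z.1.2 z.2 :=
    measurable_chr₂ (measurable_snd.comp measurable_fst) measurable_snd
  have h : Measurable fun z : ((Fin (m + 2) → ℝ) × (Fin (m + 2) → ℝ)) × (Fin (m + 2) → ℝ) =>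
      chr z.1.2 z.2 * f (z.1.1, z.2) :=
    hz.mul (hf.comp ((measurable_fst.comp measurable_fst).prodMk measurable_snd))
  have h2 : Measurable fun z : (Fin (m + 2) → ℝ) × (Fin (m + 2) → ℝ) => ft f z.1 z.2 :=
    (StronglyMeasurable.integral_prod_right' (ν := volume) h.stronglyMeasurable).measurable
  have h3 := h2.comp (hu.prodMk hv)
  exact h3

theorem enorm_lap_le {ν : ℝ} (f : (Fin (m + 2) → ℝ) × (Fin (m + 2) → ℝ) → ℂ)
    (η ξ : Fin (m + 2) → ℝ) :
    ‖lap ν f η ξ‖ₑ ≤ ∫⁻ y, ENNReal.ofReal (Real.exp (-dot y ξ)) * ‖ft f y η‖ₑ ∂(coneMeasure m ν) := by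
  unfold lap
  by_cases hi : Integrable (fun p => chr η p.2 * (Real.exp (-dot p.1 ξ) : ℂ) * f p) (tubeMeasure m ν)
  · unfold tubeMeasure at hi ⊢
    rw [integral_prod _ hi]
    refine (enorm_integral_le_lintegral_enorm _).trans (lintegral_mono fun y => ?_)
    have e : ∫ x, chr η x * (Real.exp (-dot y ξ) : ℂ) * f (y, x) =
        (Real.exp (-dot y ξ) : ℂ) * ft f y η := by
      unfold ft
      rw [← integral_const_mul]
      congr 1
      ext x
      ring
    simp only [e]
    rw [enorm_mul, ← ofReal_norm, Complex.norm_real, Real.norm_of_nonneg (Real.exp_pos _).le]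
  · rw [integral_undef hi]
    simp

theorem laplaceConst_mul_bil {ν : ℝ} (hν : (m : ℝ) / 2 < ν)
    {f g : (Fin (m + 2) → ℝ) × (Fin (m + 2) → ℝ) → ℂ} (hf : Adm ν f) (hg : Adm ν g) :
    (laplaceConst m ν : ℂ) * bil ν f g = ∫ ξ in lightCone (m + 2),
      ((lorentzQ (m + 2) ξ ^ ν : ℝ) : ℂ) * (lap ν f (-ξ) ξ * lap ν g ξ ξ) := by
  have hm : (0 : ℝ) ≤ m / 2 := by positivity
  have hmf := hf.measurable
  have hmg := hg.measurable
  have hmem : ∀ᵐ p ∂(tubeMeasure m ν), p.1 ∈ lightCone (m + 2) :=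
    Measure.quasiMeasurePreserving_fst.ae (ae_mem_lightCone ν)
  have hmem2 : ∀ᵐ P ∂((tubeMeasure m ν).prod (tubeMeasure m ν)),
      P.1.1 ∈ lightCone (m + 2) ∧ P.2.1 ∈ lightCone (m + 2) :=
    (Measure.quasiMeasurePreserving_fst.ae hmem).and (Measure.quasiMeasurePreserving_snd.ae hmem)
  set Ψ : ((Fin (m + 2) → ℝ) × (Fin (m + 2) → ℝ)) × ((Fin (m + 2) → ℝ) × (Fin (m + 2) → ℝ)) →
      (Fin (m + 2) → ℝ) → ℂ := fun P ξ => chr ξ (P.1.2 - P.2.2) *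
        ((Real.exp (-dot (P.1.1 + P.2.1) ξ) * lorentzQ (m + 2) ξ ^ ν : ℝ) : ℂ) *
          (f P.2 * g P.1) with hΨ
  have hΨm : Measurable (Function.uncurry Ψ) := by
    have := measurable_chr₂ (f := fun z : (((Fin (m + 2) → ℝ) × (Fin (m + 2) → ℝ)) ×
      ((Fin (m + 2) → ℝ) × (Fin (m + 2) → ℝ))) × (Fin (m + 2) → ℝ) => z.2)
      (g := fun z => z.1.1.2 - z.1.2.2) (by fun_prop) (by fun_prop)
    simp only [hΨ, Function.uncurry_def]
    fun_prop
  have hint : Integrable (Function.uncurry Ψ)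
      (((tubeMeasure m ν).prod (tubeMeasure m ν)).prod (volume.restrict (lightCone (m + 2)))) := by
    refine ⟨hΨm.aestronglyMeasurable, ?_⟩
    obtain ⟨k, hk, Hk⟩ := hf.exists_le
    unfold HasFiniteIntegral
    rw [lintegral_prod _ hΨm.enorm.aemeasurable]
    calc ∫⁻ P, (∫⁻ ξ in lightCone (m + 2), ‖Function.uncurry Ψ (P, ξ)‖ₑ)
          ∂((tubeMeasure m ν).prod (tubeMeasure m ν))
        ≤ ∫⁻ P, ENNReal.ofReal (laplaceConst m ν * k ^ (-(ν + 1 + m / 2))) * (‖g P.1‖ₑ * ‖f P.2‖ₑ)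
          ∂((tubeMeasure m ν).prod (tubeMeasure m ν)) := by
          refine lintegral_mono_ae (hmem2.mono fun P hP => ?_)
          have e : ∀ ξ ∈ lightCone (m + 2), ‖Function.uncurry Ψ (P, ξ)‖ₑ = ENNReal.ofReal
              (Real.exp (-dot (P.1.1 + P.2.1) ξ) * lorentzQ (m + 2) ξ ^ ν) *
              (‖g P.1‖ₑ * ‖f P.2‖ₑ) := by
            intro ξ hξ
            simp only [hΨ, Function.uncurry_apply_pair, enorm_mul]
            rw [← ofReal_norm (chr _ _), norm_chr, ← ofReal_norm ((_ : ℝ) : ℂ), Complex.norm_real,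
              Real.norm_of_nonneg (mul_nonneg (Real.exp_pos _).le
                (Real.rpow_nonneg (Q_pos hξ).le _)), ENNReal.ofReal_one, one_mul]
            ring
          rw [setLIntegral_congr_fun measurableSet_lightCone e, lintegral_mul_const _ (by fun_prop),
            lintegral_laplace (by linarith) (add_mem_lightCone hP.1 hP.2)]
          by_cases h0 : f P.2 = 0
          · simp [h0]
          · have h1 := Hk _ h0
            have h2 : lorentzQ (m + 2) P.2.1 ≤ lorentzQ (m + 2) (P.1.1 + P.2.1) := by
              have := Q_le_Q_add hP.2 hP.1
              rwa [add_comm P.2.1] at this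
            have hc := (laplaceConst_pos (m := m) (t := ν) (by linarith)).le
            gcongr ENNReal.ofReal (_ * ?_) * _
            exact Real.rpow_le_rpow_of_nonpos hk (h1.trans h2) (by linarith)
      _ < ∞ := by
          rw [lintegral_const_mul _ (by fun_prop), lintegral_prod_mul
            (f := fun p => ‖g p‖ₑ) (g := fun p => ‖f p‖ₑ) (by fun_prop) (by fun_prop)]
          exact ENNReal.mul_lt_top ENNReal.ofReal_lt_top
            (ENNReal.mul_lt_top hg.integrable.2 hf.integrable.2)
  calc (laplaceConst m ν : ℂ) * bil ν f g
      = ∫ P, (∫ ξ in lightCone (m + 2), Ψ P ξ) ∂((tubeMeasure m ν).prod (tubeMeasure m ν)) := by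
        unfold bil
        rw [← integral_const_mul]
        refine integral_congr_ae (hmem2.mono fun P hP => ?_)
        simp only [hΨ]
        rw [integral_mul_const, ← mul_assoc, bilKernel,
          kern_eq_integral hν _ (add_mem_lightCone hP.1 hP.2)]
        simp only [chr_comm]
    _ = ∫ ξ in lightCone (m + 2), (∫ P, Ψ P ξ ∂((tubeMeasure m ν).prod (tubeMeasure m ν))) :=
        integral_integral_swap hint
    _ = _ := by
        congr 1
        ext ξ
        rw [mul_comm (lap ν f _ _)]
        unfold lap
        rw [← integral_prod_mul, ← integral_const_mul]
        congr 1
        ext P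
        simp only [hΨ]
        rw [sub_eq_add_neg, chr_add_right, ← chr_neg_left, dot_add_left, neg_add, Real.exp_add]
        push_cast
        ring

end plancherel

section plancherel

variable {m : ℕ}

theorem lintegral_exp_neg_dot {ν : ℝ} (hν : (m : ℝ) / 2 < ν) {ξ : Fin (m + 2) → ℝ}
    (hξ : ξ ∈ lightCone (m + 2)) :
    ∫⁻ v, ENNReal.ofReal (Real.exp (-dot v ξ)) ∂(coneMeasure m ν) =
      ENNReal.ofReal (laplaceConst m (ν - m / 2 - 1) * lorentzQ (m + 2) ξ ^ (-ν)) := by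
  rw [lintegral_coneMeasure (by fun_prop)]
  have h := lintegral_laplace (m := m) (t := ν - m / 2 - 1) (by linarith) hξ
  rw [show -(ν - m / 2 - 1 + 1 + m / 2) = -ν by ring] at h
  rw [← h]
  refine setLIntegral_congr_fun measurableSet_lightCone fun v hv => ?_
  rw [wgt, ← ENNReal.ofReal_mul (Real.rpow_nonneg (Q_pos hv).le _), dot_comm, mul_comm]

theorem exists_laplace_sq_le {ν : ℝ} (hν : (m : ℝ) / 2 < ν) : ∃ A : ℝ, 0 < A ∧
    ∀ F : (Fin (m + 2) → ℝ) → ℝ≥0∞, Measurable F → ∀ y ∈ lightCone (m + 2),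
      ∀ ξ ∈ lightCone (m + 2),
      (ENNReal.ofReal (Real.exp (-dot y ξ) * lorentzQ (m + 2) ξ ^ ν) *
        ∫⁻ v, ENNReal.ofReal (Real.exp (-dot v ξ)) * F v ∂(coneMeasure m ν)) ^ (2 : ℝ) ≤
      ENNReal.ofReal A * ∫⁻ v, ENNReal.ofReal (lorentzQ (m + 2) (y + v) ^ (-ν)) * F v ^ (2 : ℝ)
        ∂(coneMeasure m ν) := by
  have hm : (0 : ℝ) ≤ m / 2 := by positivity
  have hν0 : 0 < ν := by linarith
  set L := laplaceConst m (ν - m / 2 - 1) with hL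
  have hLpos : 0 < L := laplaceConst_pos (by linarith)
  refine ⟨L * (2 * ν) ^ (2 * ν), by positivity, fun F hF y hy ξ hξ => ?_⟩
  have hQ := Q_pos hξ
  have hcs : (∫⁻ v, ENNReal.ofReal (Real.exp (-dot v ξ)) * F v ∂(coneMeasure m ν)) ^ (2 : ℝ) ≤
      ENNReal.ofReal (L * lorentzQ (m + 2) ξ ^ (-ν)) *
        ∫⁻ v, ENNReal.ofReal (Real.exp (-dot v ξ)) * F v ^ (2 : ℝ) ∂(coneMeasure m ν) := by
    have h2 : (2 : ℝ).HolderConjugate 2 := Real.HolderConjugate.two_two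
    have h := ENNReal.lintegral_mul_le_Lp_mul_Lq (coneMeasure m ν) h2
      (f := fun v => ENNReal.ofReal (Real.exp (-dot v ξ)) ^ (1 / 2 : ℝ))
      (g := fun v => ENNReal.ofReal (Real.exp (-dot v ξ)) ^ (1 / 2 : ℝ) * F v)
      (by fun_prop) (by fun_prop)
    have e1 : ∀ v, ((fun v => ENNReal.ofReal (Real.exp (-dot v ξ)) ^ (1 / 2 : ℝ)) *
        fun v => ENNReal.ofReal (Real.exp (-dot v ξ)) ^ (1 / 2 : ℝ) * F v) v =
        ENNReal.ofReal (Real.exp (-dot v ξ)) * F v := by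
      intro v
      simp only [Pi.mul_apply]
      rw [← mul_assoc, ← ENNReal.rpow_add_of_nonneg _ _ (by norm_num) (by norm_num)]
      norm_num
    have e2 : ∀ x : ℝ≥0∞, (x ^ (1 / 2 : ℝ)) ^ (2 : ℝ) = x := by
      intro x
      rw [← ENNReal.rpow_mul]
      norm_num
    simp only [e1, ENNReal.mul_rpow_of_nonneg _ _ (show (0 : ℝ) ≤ 2 by norm_num), e2] at h
    rw [lintegral_exp_neg_dot hν hξ] at h
    refine (ENNReal.rpow_le_rpow h (by norm_num : (0 : ℝ) ≤ 2)).trans ?_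
    rw [ENNReal.mul_rpow_of_nonneg _ _ (by norm_num), e2, e2]
  rw [ENNReal.mul_rpow_of_nonneg _ _ (by norm_num)]
  refine (mul_le_mul_right hcs _).trans ?_
  rw [← mul_assoc, ENNReal.ofReal_rpow_of_nonneg (by positivity) (by norm_num),
    ← ENNReal.ofReal_mul (by positivity), ← lintegral_const_mul _ (by fun_prop),
    ← lintegral_const_mul _ (by fun_prop)]
  refine lintegral_coneMeasure_mono fun v hv => ?_
  rw [← mul_assoc _ (ENNReal.ofReal (Real.exp _)), ← mul_assoc (ENNReal.ofReal (L * (2 * ν) ^ _)),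
    ← ENNReal.ofReal_mul (by positivity), ← ENNReal.ofReal_mul (by positivity)]
  gcongr ?_ * _
  refine ENNReal.ofReal_le_ofReal ?_
  have h1 := exp_neg_dot_mul_Q_rpow_le hν0 (add_mem_lightCone hy hv) hξ
  have h3 : Real.exp (-dot y ξ) ^ 2 ≤ Real.exp (-dot y ξ) := by
    have : Real.exp (-dot y ξ) ≤ 1 := Real.exp_le_one_iff.2 (by have := dot_nonneg hy hξ; linarith)
    nlinarith [Real.exp_pos (-dot y ξ)]
  have h4 : lorentzQ (m + 2) ξ ^ ν * lorentzQ (m + 2) ξ ^ (-ν) = 1 := by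
    rw [← Real.rpow_add hQ]
    simp
  rw [dot_add_left, neg_add, Real.exp_add] at h1
  calc (Real.exp (-dot y ξ) * lorentzQ (m + 2) ξ ^ ν) ^ (2 : ℝ) * (L * lorentzQ (m + 2) ξ ^ (-ν)) *
        Real.exp (-dot v ξ)
      = L * (Real.exp (-dot y ξ) ^ 2 * Real.exp (-dot v ξ) * lorentzQ (m + 2) ξ ^ ν) *
        (lorentzQ (m + 2) ξ ^ ν * lorentzQ (m + 2) ξ ^ (-ν)) := by
        rw [Real.rpow_two]
        ring
    _ ≤ L * (Real.exp (-dot y ξ) * Real.exp (-dot v ξ) * lorentzQ (m + 2) ξ ^ ν) := by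
        rw [h4, mul_one]
        gcongr
    _ ≤ L * ((2 * ν) ^ (2 * ν) * lorentzQ (m + 2) (y + v) ^ (-ν)) := by gcongr
    _ = _ := by ring

theorem pn_half_sq (f : (Fin (m + 2) → ℝ) × (Fin (m + 2) → ℝ) → ℂ) (y : Fin (m + 2) → ℝ) :
    pn (1 / 2) f y ^ (2 : ℝ) = ∫⁻ x, ‖f (y, x)‖ₑ ^ (2 : ℝ) := by
  unfold pn
  rw [← ENNReal.rpow_mul]
  norm_num

theorem lintegral_ft_sq_le {ν : ℝ} {f : (Fin (m + 2) → ℝ) × (Fin (m + 2) → ℝ) → ℂ} (hf : Adm ν f) :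
    ∀ᵐ y ∂(coneMeasure m ν), ∫⁻ η, ‖ft f y η‖ₑ ^ (2 : ℝ) ≤
      ENNReal.ofReal ((2 * Real.pi) ^ (m + 2)) * pn (1 / 2) f y ^ (2 : ℝ) := by
  have h := hf.integrable
  unfold tubeMeasure at h
  refine h.prod_right_ae.mono fun y hy => ?_
  have hm : Measurable fun x => f (y, x) := by
    have := hf.measurable
    fun_prop
  have := lintegral_fourier_sq_le hm hy
  rw [pn_half_sq]
  unfold ft
  simpa using this

theorem exists_enorm_bil_two_le {ν b : ℝ} (hm : 0 < m) (hν : (m : ℝ) / 2 < ν)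
    (hb0 : 0 < b) (hb1 : 2 * b < 1)
    (h1 : 1 / (2 * b) < 1 + ν / (m / 2)) (h2 : 1 / (1 - 2 * b) < 1 + ν / (m / 2)) :
    ∃ C : ℝ≥0∞, C ≠ ∞ ∧ ∀ f g : (Fin (m + 2) → ℝ) × (Fin (m + 2) → ℝ) → ℂ,
      Adm ν f → Adm ν g →
      ‖bil ν f g‖ₑ ≤ C * mn ν (1 / 2) b f * mn ν (1 / 2) (1 - b) g := by
  have hm2 : (0 : ℝ) ≤ m / 2 := by positivity
  have conj : ∀ t : ℝ, 0 < t → t < 1 → (1 / t).HolderConjugate (1 / (1 - t)) := by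
    intro t h0 h1
    rw [Real.holderConjugate_iff]
    refine ⟨by rw [lt_div_iff₀ h0]; linarith, ?_⟩
    simp
  obtain ⟨A, hA, HA⟩ := exists_laplace_sq_le hν
  obtain ⟨S, hS, HS⟩ := exists_lintegral_coneMeasure_schur hm hν (conj (2 * b) (by linarith) hb1) h1 h2
  set c := laplaceConst m ν with hc
  have hcpos : 0 < c := laplaceConst_pos (by linarith)
  set P := ENNReal.ofReal ((2 * Real.pi) ^ (m + 2)) with hP
  set A' := ENNReal.ofReal A with hA'
  refine ⟨(ENNReal.ofReal c)⁻¹ * (P * A' ^ (1 / 2 : ℝ) * S ^ b), ?_, fun f g hf hg => ?_⟩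
  · have : ENNReal.ofReal c ≠ 0 := by simpa using hcpos
    refine ENNReal.mul_ne_top (ENNReal.inv_ne_top.2 this) (ENNReal.mul_ne_top
      (ENNReal.mul_ne_top ENNReal.ofReal_ne_top (ENNReal.rpow_ne_top_of_nonneg (by norm_num)
        ENNReal.ofReal_ne_top)) (ENNReal.rpow_ne_top_of_nonneg hb0.le hS))
  have hmf := hf.measurable
  have hmg := hg.measurable
  have e2 : ∀ x : ℝ≥0∞, (x ^ (1 / 2 : ℝ)) ^ (2 : ℝ) = x := by
    intro x
    rw [← ENNReal.rpow_mul]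
    norm_num
  have e2' : ∀ x : ℝ≥0∞, (x ^ (2 : ℝ)) ^ (1 / 2 : ℝ) = x := by
    intro x
    rw [← ENNReal.rpow_mul]
    norm_num
  have hmd : Measurable fun z : (Fin (m + 2) → ℝ) × (Fin (m + 2) → ℝ) =>
      ENNReal.ofReal (lorentzQ (m + 2) (z.1 + z.2) ^ (-ν)) * pn (1 / 2) f z.2 ^ (2 : ℝ) := by fun_prop
  set T : (Fin (m + 2) → ℝ) → ℝ≥0∞ := fun y => ∫⁻ v,
    ENNReal.ofReal (lorentzQ (m + 2) (y + v) ^ (-ν)) * pn (1 / 2) f v ^ (2 : ℝ)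
      ∂(coneMeasure m ν) with hT
  have hTm : Measurable T := hmd.lintegral_prod_right'
  set h : (Fin (m + 2) → ℝ) → (Fin (m + 2) → ℝ) → ℝ≥0∞ := fun y ξ =>
    ENNReal.ofReal (Real.exp (-dot y ξ) * lorentzQ (m + 2) ξ ^ ν) *
      ∫⁻ v, ENNReal.ofReal (Real.exp (-dot v ξ)) * ‖ft f v (-ξ)‖ₑ ∂(coneMeasure m ν) with hh
  have hhm : Measurable fun z : (Fin (m + 2) → ℝ) × (Fin (m + 2) → ℝ) => h z.1 z.2 := by
    have : Measurable fun z : ((Fin (m + 2) → ℝ) × (Fin (m + 2) → ℝ)) × (Fin (m + 2) → ℝ) =>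
      ENNReal.ofReal (Real.exp (-dot z.2 z.1.2)) * ‖ft f z.2 (-z.1.2)‖ₑ := by fun_prop
    have h3 : Measurable fun z : (Fin (m + 2) → ℝ) × (Fin (m + 2) → ℝ) => ∫⁻ v,
        ENNReal.ofReal (Real.exp (-dot v z.2)) * ‖ft f v (-z.2)‖ₑ ∂(coneMeasure m ν) :=
      this.lintegral_prod_right'
    simp only [hh]
    fun_prop
  have hh2 : ∀ y ∈ lightCone (m + 2), ∫⁻ ξ in lightCone (m + 2), h y ξ ^ (2 : ℝ) ≤
      A' * (P * T y) := by
    intro y hy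
    calc ∫⁻ ξ in lightCone (m + 2), h y ξ ^ (2 : ℝ)
        ≤ ∫⁻ ξ in lightCone (m + 2), A' * ∫⁻ v, ENNReal.ofReal (lorentzQ (m + 2) (y + v) ^ (-ν)) *
            ‖ft f v (-ξ)‖ₑ ^ (2 : ℝ) ∂(coneMeasure m ν) :=
          setLIntegral_mono' measurableSet_lightCone fun ξ hξ =>
            HA (fun v => ‖ft f v (-ξ)‖ₑ) (by fun_prop) y hy ξ hξ
      _ ≤ ∫⁻ ξ, A' * ∫⁻ v, ENNReal.ofReal (lorentzQ (m + 2) (y + v) ^ (-ν)) *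
            ‖ft f v (-ξ)‖ₑ ^ (2 : ℝ) ∂(coneMeasure m ν) := setLIntegral_le_lintegral _ _
      _ = A' * ∫⁻ v, (∫⁻ ξ, ENNReal.ofReal (lorentzQ (m + 2) (y + v) ^ (-ν)) *
            ‖ft f v (-ξ)‖ₑ ^ (2 : ℝ)) ∂(coneMeasure m ν) := by
          rw [lintegral_const_mul', lintegral_lintegral_swap]
          · exact Measurable.aemeasurable (by simp only [Function.uncurry_def]; fun_prop)
          · exact ENNReal.ofReal_ne_top
      _ ≤ A' * ∫⁻ v, P * (ENNReal.ofReal (lorentzQ (m + 2) (y + v) ^ (-ν)) *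
            pn (1 / 2) f v ^ (2 : ℝ)) ∂(coneMeasure m ν) := by
          gcongr A' * ?_
          refine lintegral_mono_ae ((lintegral_ft_sq_le hf).mono fun v hv => ?_)
          rw [lintegral_const_mul _ (by fun_prop), mul_left_comm]
          gcongr
          rwa [lintegral_neg_eq_self fun ξ => ‖ft f v ξ‖ₑ ^ (2 : ℝ)]
      _ = A' * (P * T y) := by rw [lintegral_const_mul _ (by fun_prop)]
  have key : ENNReal.ofReal c * ‖bil ν f g‖ₑ ≤
      P * A' ^ (1 / 2 : ℝ) * S ^ b * (mn ν (1 / 2) b f * mn ν (1 / 2) (1 - b) g) := by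
    calc ENNReal.ofReal c * ‖bil ν f g‖ₑ
        = ‖(c : ℂ) * bil ν f g‖ₑ := by
          rw [enorm_mul, ← ofReal_norm (c : ℂ), Complex.norm_real, Real.norm_of_nonneg hcpos.le]
      _ ≤ ∫⁻ ξ in lightCone (m + 2), ∫⁻ y, ‖ft g y ξ‖ₑ * h y ξ ∂(coneMeasure m ν) := by
          rw [laplaceConst_mul_bil hν hf hg]
          refine (enorm_integral_le_lintegral_enorm _).trans
            (setLIntegral_mono' measurableSet_lightCone fun ξ hξ => ?_)
          have hQ := Real.rpow_nonneg (Q_pos hξ).le ν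
          rw [enorm_mul, enorm_mul, ← ofReal_norm ((_ : ℝ) : ℂ), Complex.norm_real,
            Real.norm_of_nonneg hQ]
          refine (mul_le_mul_right (mul_le_mul' (enorm_lap_le f _ _) (enorm_lap_le g _ _)) _).trans
            (le_of_eq ?_)
          rw [← mul_assoc, ← lintegral_const_mul _ (by fun_prop)]
          refine lintegral_congr fun y => ?_
          simp only [hh]
          rw [ENNReal.ofReal_mul (Real.exp_pos _).le]
          ring
      _ = ∫⁻ y, (∫⁻ ξ in lightCone (m + 2), ‖ft g y ξ‖ₑ * h y ξ) ∂(coneMeasure m ν) := by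
          rw [lintegral_lintegral_swap]
          exact Measurable.aemeasurable (by simp only [Function.uncurry_def]; fun_prop)
      _ ≤ ∫⁻ y, (P ^ (1 / 2 : ℝ) * pn (1 / 2) g y) * (A' * (P * T y)) ^ (1 / 2 : ℝ)
            ∂(coneMeasure m ν) := by
          refine lintegral_mono_ae (((lintegral_ft_sq_le hg).and (ae_mem_lightCone ν)).mono
            fun y hy => ?_)
          have hcs := ENNReal.lintegral_mul_le_Lp_mul_Lq (volume.restrict (lightCone (m + 2)))
            Real.HolderConjugate.two_two (f := fun ξ => ‖ft g y ξ‖ₑ) (g := fun ξ => h y ξ)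
            (by fun_prop) (by fun_prop)
          refine hcs.trans (mul_le_mul' ?_ (ENNReal.rpow_le_rpow (hh2 y hy.2) (by norm_num)))
          rw [← e2' (P ^ (1 / 2 : ℝ) * pn (1 / 2) g y), ENNReal.mul_rpow_of_nonneg _ _ (by norm_num : (0:ℝ) ≤ 2), e2]
          exact ENNReal.rpow_le_rpow ((setLIntegral_le_lintegral _ _).trans hy.1) (by norm_num)
      _ = P * A' ^ (1 / 2 : ℝ) * ∫⁻ y, T y ^ (1 / 2 : ℝ) * pn (1 / 2) g y ∂(coneMeasure m ν) := by
          rw [← lintegral_const_mul _ (by fun_prop)]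
          refine lintegral_congr fun y => ?_
          rw [ENNReal.mul_rpow_of_nonneg _ _ (by norm_num), ENNReal.mul_rpow_of_nonneg _ _ (by norm_num)]
          have : P = P ^ (1 / 2 : ℝ) * P ^ (1 / 2 : ℝ) := by
            rw [← ENNReal.rpow_add_of_nonneg _ _ (by norm_num) (by norm_num)]
            norm_num
          nth_rw 3 [this]
          ring
      _ ≤ P * A' ^ (1 / 2 : ℝ) * ((∫⁻ y, T y ^ (1 / (2 * b)) ∂(coneMeasure m ν)) ^ b *
            mn ν (1 / 2) (1 - b) g) := by
          have h3 := ENNReal.lintegral_mul_le_Lp_mul_Lq (coneMeasure m ν) (conj b hb0 (by linarith))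
            (f := fun y => T y ^ (1 / 2 : ℝ)) (g := fun y => pn (1 / 2) g y)
            (by fun_prop) (by fun_prop)
          simp only [one_div_one_div, ← ENNReal.rpow_mul] at h3
          rw [show 1 / 2 * (1 / b) = 1 / (2 * b) by field_simp] at h3
          unfold mn
          gcongr _ * ?_
          exact h3
      _ ≤ P * A' ^ (1 / 2 : ℝ) * ((S * ∫⁻ y, pn (1 / 2) f y ^ (1 / b) ∂(coneMeasure m ν)) ^ b *
            mn ν (1 / 2) (1 - b) g) := by
          gcongr
          refine (HS (fun v => pn (1 / 2) f v ^ (2 : ℝ)) (by fun_prop)).trans (le_of_eq ?_)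
          simp only [← ENNReal.rpow_mul]
          rw [show 2 * (1 / (2 * b)) = 1 / b by field_simp]
      _ = _ := by
          rw [ENNReal.mul_rpow_of_nonneg _ _ hb0.le]
          unfold mn
          ring
  have hc0 : ENNReal.ofReal c ≠ 0 := by simpa using hcpos
  rw [mul_assoc, mul_assoc, ← ENNReal.div_eq_inv_mul, ENNReal.le_div_iff_mul_le (Or.inl hc0)
    (Or.inl ENNReal.ofReal_ne_top), mul_comm]
  exact key

end plancherel

section nice

variable {m : ℕ}

/-- A bounded part of the cone, away from its boundary. -/
def coneBox (m : ℕ) (k : ℝ) : Set (Fin (m + 2) → ℝ) :=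
  {y | y ∈ lightCone (m + 2) ∧ ‖y‖ ≤ k ∧ 1 / k ≤ lorentzQ (m + 2) y}

/-- A bounded part of the tube, away from its boundary. -/
def tubeBox (m : ℕ) (k : ℝ) : Set ((Fin (m + 2) → ℝ) × (Fin (m + 2) → ℝ)) :=
  coneBox m k ×ˢ Metric.closedBall 0 k

theorem measurableSet_coneBox (k : ℝ) : MeasurableSet (coneBox m k) :=
  measurableSet_lightCone.inter ((measurableSet_le measurable_norm measurable_const).inter
    (measurableSet_le measurable_const continuous_lorentzQ.measurable))

theorem measurableSet_tubeBox (k : ℝ) : MeasurableSet (tubeBox m k) :=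
  (measurableSet_coneBox k).prod measurableSet_closedBall

theorem Q_le_sq (y : Fin (m + 2) → ℝ) : lorentzQ (m + 2) y ≤ ‖y‖ ^ 2 := by
  have h1 : |y 0| ≤ ‖y‖ := norm_le_pi_norm y 0
  have h2 : y 0 ^ 2 ≤ ‖y‖ ^ 2 := sq_le_sq' (by linarith [neg_abs_le (y 0)]) ((le_abs_self _).trans h1)
  have h3 : 0 ≤ ∑ k ∈ Finset.univ.filter (fun k : Fin (m + 2) => k ≠ 0), y k ^ 2 :=
    Finset.sum_nonneg fun _ _ => sq_nonneg _
  unfold lorentzQ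
  linarith

theorem coneMeasure_coneBox_lt_top (ν k : ℝ) (hk : 0 < k) : coneMeasure m ν (coneBox m k) < ∞ := by
  unfold coneMeasure
  rw [withDensity_apply _ (measurableSet_coneBox k), Measure.restrict_restrict (measurableSet_coneBox k)]
  set t := ν - m / 2 - 1 with ht
  calc ∫⁻ y in coneBox m k ∩ lightCone (m + 2), ENNReal.ofReal (wgt m ν y)
      ≤ ∫⁻ y in coneBox m k ∩ lightCone (m + 2), ENNReal.ofReal ((1 / k) ^ t + (k ^ 2) ^ t) := by
        refine setLIntegral_mono' ((measurableSet_coneBox k).inter measurableSet_lightCone)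
          fun y hy => ENNReal.ofReal_le_ofReal ?_
        obtain ⟨⟨h1, h2, h3⟩, -⟩ := hy
        have h4 : lorentzQ (m + 2) y ≤ k ^ 2 :=
          (Q_le_sq y).trans (pow_le_pow_left₀ (norm_nonneg _) h2 2)
        have hQ := Q_pos h1
        unfold wgt
        rw [← ht]
        rcases le_total 0 t with h | h
        · have := Real.rpow_le_rpow hQ.le h4 h
          have : 0 ≤ (1 / k) ^ t := by positivity
          linarith
        · have := Real.rpow_le_rpow_of_nonpos (by positivity) h3 h
          have : 0 ≤ (k ^ 2) ^ t := by positivity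
          linarith
    _ = ENNReal.ofReal ((1 / k) ^ t + (k ^ 2) ^ t) * volume (coneBox m k ∩ lightCone (m + 2)) := by
        rw [setLIntegral_const]
    _ < ∞ := by
        refine ENNReal.mul_lt_top ENNReal.ofReal_lt_top ((measure_mono fun y hy => ?_).trans_lt
          (measure_closedBall_lt_top (x := (0 : Fin (m + 2) → ℝ)) (r := k)))
        simpa using hy.1.2.1

theorem tubeMeasure_tubeBox_lt_top (ν k : ℝ) (hk : 0 < k) : tubeMeasure m ν (tubeBox m k) < ∞ := by
  unfold tubeMeasure tubeBox
  rw [Measure.prod_prod]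
  exact ENNReal.mul_lt_top (coneMeasure_coneBox_lt_top ν k hk) measure_closedBall_lt_top

/-- Measurable functions that, on their support, lie in a box and are bounded above and below
together with their fibre norms. -/
structure Nice (a : ℝ) (f : (Fin (m + 2) → ℝ) × (Fin (m + 2) → ℝ) → ℂ) : Prop where
  measurable : Measurable f
  exists_bound : ∃ k : ℝ, 1 ≤ k ∧ ∀ p, f p ≠ 0 → p ∈ tubeBox m k ∧ 1 / k ≤ ‖f p‖ ∧ ‖f p‖ ≤ k ∧
    ENNReal.ofReal (1 / k) ≤ pn a f p.1

theorem Adm.mul_bdd {ν : ℝ} {f h : (Fin (m + 2) → ℝ) × (Fin (m + 2) → ℝ) → ℂ} (hf : Adm ν f)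
    (hh : Measurable h) {R : ℝ} (hR : ∀ p, ‖h p‖ ≤ R) : Adm ν fun p => f p * h p := by
  refine ⟨hf.measurable.mul hh, hf.integrable.mul_bdd hh.aestronglyMeasurable
    (Filter.Eventually.of_forall hR), ?_⟩
  obtain ⟨k, hk, H⟩ := hf.exists_le
  exact ⟨k, hk, fun p hp => H p (left_ne_zero_of_mul hp)⟩

theorem Nice.adm {a : ℝ} {f : (Fin (m + 2) → ℝ) × (Fin (m + 2) → ℝ) → ℂ} (hf : Nice a f) (ν : ℝ) :
    Adm ν f := by
  obtain ⟨k, hk, H⟩ := hf.exists_bound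
  have hk0 : 0 < k := by linarith
  refine ⟨hf.measurable, ?_, 1 / k, by positivity, fun p hp => (H p hp).1.1.2.2⟩
  have h1 : Integrable ((tubeBox m k).indicator fun _ => (k : ℝ)) (tubeMeasure m ν) :=
    (integrable_indicator_iff (measurableSet_tubeBox k)).2
      (integrableOn_const (tubeMeasure_tubeBox_lt_top ν k hk0).ne)
  refine h1.mono' hf.measurable.aestronglyMeasurable (Filter.Eventually.of_forall fun p => ?_)
  by_cases hp : f p = 0
  · rw [hp, norm_zero]
    exact Set.indicator_nonneg (fun _ _ => hk0.le) _
  · rw [Set.indicator_of_mem (H p hp).1]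
    exact (H p hp).2.2.1

theorem pn_le_of_bdd {a k : ℝ} (ha : 0 < a) {f : (Fin (m + 2) → ℝ) × (Fin (m + 2) → ℝ) → ℂ}
    (H : ∀ p, f p ≠ 0 → p ∈ tubeBox m k ∧ ‖f p‖ ≤ k) (y : Fin (m + 2) → ℝ) :
    pn a f y ≤ (coneBox m k).indicator (fun _ => (ENNReal.ofReal k ^ (1 / a) *
      volume (Metric.closedBall (0 : Fin (m + 2) → ℝ) k)) ^ a) y := by
  have ha' : 0 < 1 / a := by positivity
  unfold pn
  by_cases hy : y ∈ coneBox m k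
  · rw [Set.indicator_of_mem hy]
    refine ENNReal.rpow_le_rpow ?_ ha.le
    rw [← setLIntegral_const, ← lintegral_indicator measurableSet_closedBall]
    refine lintegral_mono fun x => ?_
    by_cases hp : f (y, x) = 0
    · rw [hp, enorm_zero, ENNReal.zero_rpow_of_pos ha']
      exact zero_le
    · obtain ⟨h1, h2⟩ := H _ hp
      rw [Set.indicator_of_mem h1.2]
      refine ENNReal.rpow_le_rpow ?_ ha'.le
      rw [← ofReal_norm]
      exact ENNReal.ofReal_le_ofReal h2
  · have : ∀ x, f (y, x) = 0 := fun x => by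
      by_contra hp
      exact hy (H _ hp).1.1
    simp only [this, enorm_zero, ENNReal.zero_rpow_of_pos ha', lintegral_zero,
      ENNReal.zero_rpow_of_pos ha]
    exact zero_le

theorem mn_lt_top_of_bdd {ν a b k : ℝ} (hk : 0 < k) (ha : 0 < a) (hb : 0 < b)
    {f : (Fin (m + 2) → ℝ) × (Fin (m + 2) → ℝ) → ℂ}
    (H : ∀ p, f p ≠ 0 → p ∈ tubeBox m k ∧ ‖f p‖ ≤ k) : mn ν a b f < ∞ := by
  set K := (ENNReal.ofReal k ^ (1 / a) * volume (Metric.closedBall (0 : Fin (m + 2) → ℝ) k)) ^ a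
  have hK : K ≠ ∞ := ENNReal.rpow_ne_top_of_nonneg ha.le (ENNReal.mul_ne_top
    (ENNReal.rpow_ne_top_of_nonneg (by positivity) ENNReal.ofReal_ne_top)
    measure_closedBall_lt_top.ne)
  have hb' : 0 < 1 / b := by positivity
  unfold mn
  refine ENNReal.rpow_lt_top_of_nonneg hb.le (ne_of_lt ?_)
  calc ∫⁻ y, pn a f y ^ (1 / b) ∂(coneMeasure m ν)
      ≤ ∫⁻ y, (coneBox m k).indicator (fun _ => K ^ (1 / b)) y ∂(coneMeasure m ν) := by
        refine lintegral_mono fun y => ?_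
        refine (ENNReal.rpow_le_rpow (pn_le_of_bdd ha H y) hb'.le).trans ?_
        by_cases hy : y ∈ coneBox m k
        · simp [hy, K]
        · simp [hy, ENNReal.zero_rpow_of_pos, hb]
    _ < ∞ := by
        rw [lintegral_indicator (measurableSet_coneBox k), setLIntegral_const]
        exact ENNReal.mul_lt_top (ENNReal.rpow_ne_top_of_nonneg hb'.le hK).lt_top
          (coneMeasure_coneBox_lt_top ν k hk)

theorem Nice.mn_lt_top {a : ℝ} {f : (Fin (m + 2) → ℝ) × (Fin (m + 2) → ℝ) → ℂ} (hf : Nice a f)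
    (ν : ℝ) {a' b : ℝ} (ha : 0 < a') (hb : 0 < b) : mn ν a' b f < ∞ := by
  obtain ⟨k, hk, H⟩ := hf.exists_bound
  exact mn_lt_top_of_bdd (by linarith) ha hb fun p hp => ⟨(H p hp).1, (H p hp).2.2.1⟩

/-- Two-sided bounds for the fibre norm of a nice function. -/
theorem Nice.exists_pn_bound {a : ℝ} (ha : 0 < a)
    {f : (Fin (m + 2) → ℝ) × (Fin (m + 2) → ℝ) → ℂ} (hf : Nice a f) :
    ∃ k : ℝ, 1 ≤ k ∧ ∀ p, f p ≠ 0 → 1 / k ≤ ‖f p‖ ∧ ‖f p‖ ≤ k ∧ pn a f p.1 ≠ ∞ ∧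
      1 / k ≤ (pn a f p.1).toReal ∧ (pn a f p.1).toReal ≤ k := by
  obtain ⟨k, hk, H⟩ := hf.exists_bound
  have hk0 : 0 < k := by linarith
  set K := (ENNReal.ofReal k ^ (1 / a) * volume (Metric.closedBall (0 : Fin (m + 2) → ℝ) k)) ^ a
  have hK : K ≠ ∞ := ENNReal.rpow_ne_top_of_nonneg ha.le (ENNReal.mul_ne_top
    (ENNReal.rpow_ne_top_of_nonneg (by positivity) ENNReal.ofReal_ne_top)
    measure_closedBall_lt_top.ne)
  refine ⟨k + K.toReal, by linarith [ENNReal.toReal_nonneg (a := K)], fun p hp => ?_⟩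
  obtain ⟨h1, h2, h3, h4⟩ := H p hp
  have h5 : pn a f p.1 ≤ K := by
    have := pn_le_of_bdd ha (fun p hp => ⟨(H p hp).1, (H p hp).2.2.1⟩) p.1
    rwa [Set.indicator_of_mem h1.1] at this
  have h6 : pn a f p.1 ≠ ∞ := ne_top_of_le_ne_top hK h5
  have h7 : 1 / (k + K.toReal) ≤ 1 / k :=
    one_div_le_one_div_of_le hk0 (by linarith [ENNReal.toReal_nonneg (a := K)])
  refine ⟨h7.trans h2, h3.trans (by linarith [ENNReal.toReal_nonneg (a := K)]), h6,
    h7.trans ((ENNReal.ofReal_le_iff_le_toReal h6).1 h4), ?_⟩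
  have := ENNReal.toReal_mono hK h5
  linarith

theorem integrable_bil {ν : ℝ} (hν : (m : ℝ) / 2 < ν)
    {f g : (Fin (m + 2) → ℝ) × (Fin (m + 2) → ℝ) → ℂ} (hf : Adm ν f) (hg : Adm ν g) :
    Integrable (fun P => bilKernel ν P * (f P.2 * g P.1))
      ((tubeMeasure m ν).prod (tubeMeasure m ν)) := by
  have hm : (0 : ℝ) ≤ m / 2 := by positivity
  have hmf := hf.measurable
  have hmg := hg.measurable
  have hmem : ∀ᵐ p ∂(tubeMeasure m ν), p.1 ∈ lightCone (m + 2) :=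
    Measure.quasiMeasurePreserving_fst.ae (ae_mem_lightCone ν)
  have hmem2 : ∀ᵐ P ∂((tubeMeasure m ν).prod (tubeMeasure m ν)),
      P.1.1 ∈ lightCone (m + 2) ∧ P.2.1 ∈ lightCone (m + 2) :=
    (Measure.quasiMeasurePreserving_fst.ae hmem).and (Measure.quasiMeasurePreserving_snd.ae hmem)
  obtain ⟨k, hk, Hk⟩ := hf.exists_le
  have hfg : Integrable (fun P : ((Fin (m + 2) → ℝ) × (Fin (m + 2) → ℝ)) ×
      ((Fin (m + 2) → ℝ) × (Fin (m + 2) → ℝ)) => k ^ (-(ν + m / 2 + 1)) * ‖g P.1 * f P.2‖)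
      ((tubeMeasure m ν).prod (tubeMeasure m ν)) :=
    (hg.integrable.mul_prod hf.integrable).norm.const_mul _
  refine hfg.mono' (Measurable.aestronglyMeasurable (by fun_prop)) (hmem2.mono fun P hP => ?_)
  rw [norm_mul, mul_comm (f _)]
  by_cases h0 : f P.2 = 0
  · simp [h0]
  · gcongr
    refine (norm_kern_le hν _ (add_mem_lightCone hP.1 hP.2)).trans ?_
    have h2 := Q_le_Q_add hP.2 hP.1
    rw [add_comm P.2.1] at h2
    exact Real.rpow_le_rpow_of_nonpos hk ((Hk _ h0).trans h2) (by linarith)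

end nice

section interp

variable {m : ℕ}

theorem pn_twist {a b α β : ℝ} (ha : 0 < a) (hb : 0 < b) (hα : 0 < α) (hβ : 0 < β)
    {f F : (Fin (m + 2) → ℝ) × (Fin (m + 2) → ℝ) → ℂ} (hf : Nice a f)
    (h0 : ∀ p, f p = 0 → F p = 0)
    (h1 : ∀ p, f p ≠ 0 → ‖F p‖ = ‖f p‖ ^ (α / a) * (pn a f p.1).toReal ^ (β / b - α / a))
    (y : Fin (m + 2) → ℝ) :
    pn α F y = pn a f y ^ (β / b) := by
  obtain ⟨k, hk, H⟩ := hf.exists_pn_bound ha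
  have hmf := hf.measurable
  have hα' : 0 < 1 / α := by positivity
  have ha' : 0 < 1 / a := by positivity
  by_cases hy : ∀ x, f (y, x) = 0
  · have h2 : ∀ x, F (y, x) = 0 := fun x => h0 _ (hy x)
    unfold pn
    simp only [hy, h2, enorm_zero, ENNReal.zero_rpow_of_pos hα', ENNReal.zero_rpow_of_pos ha',
      lintegral_zero, ENNReal.zero_rpow_of_pos hα, ENNReal.zero_rpow_of_pos ha]
    rw [ENNReal.zero_rpow_of_pos (by positivity)]
  · push Not at hy
    obtain ⟨x₀, hx₀⟩ := hy
    obtain ⟨-, -, hN, hN1, -⟩ := H _ hx₀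
    simp only at hN hN1
    set N := pn a f y with hNdef
    have hNpos : 0 < N.toReal := lt_of_lt_of_le (by positivity) hN1
    have hN0 : N ≠ 0 := fun h => by simp [h] at hNpos
    have e : ∀ x, ‖F (y, x)‖ₑ ^ (1 / α) =
        N ^ ((β / b - α / a) * (1 / α)) * ‖f (y, x)‖ₑ ^ (1 / a) := by
      intro x
      by_cases hx : f (y, x) = 0
      · rw [hx, h0 _ hx, enorm_zero, ENNReal.zero_rpow_of_pos hα', ENNReal.zero_rpow_of_pos ha',
          mul_zero]
      · rw [← ofReal_norm, h1 _ hx, ENNReal.ofReal_mul (by positivity),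
          ← ENNReal.ofReal_rpow_of_pos hNpos, ENNReal.ofReal_toReal hN,
          ← ENNReal.ofReal_rpow_of_pos (norm_pos_iff.2 hx), ofReal_norm,
          ENNReal.mul_rpow_of_nonneg _ _ hα'.le, ← ENNReal.rpow_mul, ← ENNReal.rpow_mul, mul_comm,
          show α / a * (1 / α) = 1 / a by field_simp]
    have e2 : ∫⁻ x, ‖f (y, x)‖ₑ ^ (1 / a) = N ^ (1 / a) := by
      rw [hNdef, pn, ← ENNReal.rpow_mul]
      rw [show a * (1 / a) = 1 by field_simp, ENNReal.rpow_one]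
    rw [pn]
    simp only [e]
    rw [lintegral_const_mul _ (by fun_prop), e2, ← ENNReal.rpow_add _ _ hN0 hN, ← ENNReal.rpow_mul]
    congr 1
    field_simp
    ring

theorem mn_twist {ν a b α β : ℝ} (ha : 0 < a) (hb : 0 < b) (hα : 0 < α) (hβ : 0 < β)
    {f F : (Fin (m + 2) → ℝ) × (Fin (m + 2) → ℝ) → ℂ} (hf : Nice a f)
    (h0 : ∀ p, f p = 0 → F p = 0)
    (h1 : ∀ p, f p ≠ 0 → ‖F p‖ = ‖f p‖ ^ (α / a) * (pn a f p.1).toReal ^ (β / b - α / a)) :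
    mn ν α β F = mn ν a b f ^ (β / b) := by
  unfold mn
  simp only [pn_twist ha hb hα hβ hf h0 h1]
  simp only [← ENNReal.rpow_mul]
  rw [show β / b * (1 / β) = 1 / b by field_simp, show b * (β / b) = β by field_simp]

/-- The real phase of the analytic family through `f` in Stein-Weiss interpolation. -/
def phase (a : ℝ) (c d : ℝ) (f : (Fin (m + 2) → ℝ) × (Fin (m + 2) → ℝ) → ℂ)
    (p : (Fin (m + 2) → ℝ) × (Fin (m + 2) → ℝ)) : ℝ :=
  {p | f p ≠ 0}.indicator
    (fun p => c * Real.log ‖f p‖ + d * Real.log (pn a f p.1).toReal) p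

theorem measurable_phase {a c d : ℝ} {f : (Fin (m + 2) → ℝ) × (Fin (m + 2) → ℝ) → ℂ}
    (hf : Measurable f) : Measurable (phase a c d f) := by
  unfold phase
  refine Measurable.indicator ?_ (hf (measurableSet_singleton 0).compl)
  have h : Measurable fun p : (Fin (m + 2) → ℝ) × (Fin (m + 2) → ℝ) => (pn a f p.1).toReal :=
    ((measurable_pn hf).comp measurable_fst).ennreal_toReal
  exact ((Real.measurable_log.comp hf.norm).const_mul _).add
    ((Real.measurable_log.comp h).const_mul _)

theorem abs_log_le_of_bounds {k x : ℝ} (hk : 1 ≤ k) (h1 : 1 / k ≤ x) (h2 : x ≤ k) :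
    |Real.log x| ≤ Real.log k := by
  have hk0 : 0 < k := by linarith
  have hx : 0 < x := lt_of_lt_of_le (by positivity) h1
  rw [abs_le]
  refine ⟨?_, Real.log_le_log hx h2⟩
  have := Real.log_le_log (by positivity) h1
  rwa [one_div, Real.log_inv] at this

theorem exists_abs_phase_le {a : ℝ} (ha : 0 < a) (c d : ℝ)
    {f : (Fin (m + 2) → ℝ) × (Fin (m + 2) → ℝ) → ℂ} (hf : Nice a f) :
    ∃ R : ℝ, ∀ p, |phase a c d f p| ≤ R := by
  obtain ⟨k, hk, H⟩ := hf.exists_pn_bound ha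
  refine ⟨|c| * Real.log k + |d| * Real.log k, fun p => ?_⟩
  have hl := Real.log_nonneg hk
  unfold phase
  by_cases hp : f p = 0
  · simp [hp]
    positivity
  · rw [Set.indicator_of_mem (by exact hp)]
    obtain ⟨h1, h2, -, h3, h4⟩ := H p hp
    refine (abs_add_le _ _).trans ?_
    rw [abs_mul, abs_mul]
    gcongr
    · exact abs_log_le_of_bounds hk h1 h2
    · exact abs_log_le_of_bounds hk h3 h4

/-- The mixed norms of the analytic family on the line `Re z = s`. -/
theorem mn_phase {ν a b a₀ a₁ b₀ b₁ θ s : ℝ} (ha : 0 < a) (hb : 0 < b)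
    (hae : a = (1 - θ) * a₀ + θ * a₁) (hbe : b = (1 - θ) * b₀ + θ * b₁)
    (hα : 0 < (1 - s) * a₀ + s * a₁) (hβ : 0 < (1 - s) * b₀ + s * b₁)
    {f : (Fin (m + 2) → ℝ) × (Fin (m + 2) → ℝ) → ℂ} (hf : Nice a f) (t : ℝ) :
    mn ν ((1 - s) * a₀ + s * a₁) ((1 - s) * b₀ + s * b₁) (fun p => f p *
      cexp ((s + t * I - θ) * phase a ((a₁ - a₀) / a) ((b₁ - b₀) / b - (a₁ - a₀) / a) f p)) =
      mn ν a b f ^ (((1 - s) * b₀ + s * b₁) / b) := by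
  refine mn_twist ha hb hα hβ hf (fun p hp => by simp [hp]) fun p hp => ?_
  obtain ⟨k, hk, H⟩ := hf.exists_pn_bound ha
  obtain ⟨-, -, -, hN, -⟩ := H p hp
  have hNpos : 0 < (pn a f p.1).toReal := lt_of_lt_of_le (by positivity) hN
  have hfpos := norm_pos_iff.2 hp
  have hre : ((s + t * I - θ) * phase a ((a₁ - a₀) / a) ((b₁ - b₀) / b - (a₁ - a₀) / a) f p : ℂ).re =
      (s - θ) * phase a ((a₁ - a₀) / a) ((b₁ - b₀) / b - (a₁ - a₀) / a) f p := by
    simp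
  rw [norm_mul, Complex.norm_exp, hre, phase, Set.indicator_of_mem (by exact hp),
    Real.rpow_def_of_pos hNpos, Real.rpow_def_of_pos hfpos, ← Real.exp_add]
  nth_rw 1 [← Real.exp_log hfpos]
  rw [← Real.exp_add]
  congr 1
  have e1 : ((1 - s) * a₀ + s * a₁) / a = 1 + (s - θ) * ((a₁ - a₀) / a) := by
    field_simp
    linarith
  have e2 : ((1 - s) * b₀ + s * b₁) / b = 1 + (s - θ) * ((b₁ - b₀) / b) := by
    field_simp
    linarith
  rw [e1, e2]
  ring

theorem bil_interp {ν : ℝ} (hν : (m : ℝ) / 2 < ν) {a b a₀ a₁ b₀ b₁ θ : ℝ} {C₀ C₁ : ℝ≥0∞}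
    (hC₀ : C₀ ≠ ∞) (hC₁ : C₁ ≠ ∞) (hθ0 : 0 < θ) (hθ1 : θ < 1)
    (ha₀ : 0 < a₀) (ha₀' : a₀ < 1) (ha₁ : 0 < a₁) (ha₁' : a₁ < 1)
    (hb₀ : 0 < b₀) (hb₀' : b₀ < 1) (hb₁ : 0 < b₁) (hb₁' : b₁ < 1)
    (hae : a = (1 - θ) * a₀ + θ * a₁) (hbe : b = (1 - θ) * b₀ + θ * b₁)
    (H₀ : ∀ f g : (Fin (m + 2) → ℝ) × (Fin (m + 2) → ℝ) → ℂ, Adm ν f → Adm ν g →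
      ‖bil ν f g‖ₑ ≤ C₀ * mn ν a₀ b₀ f * mn ν (1 - a₀) (1 - b₀) g)
    (H₁ : ∀ f g : (Fin (m + 2) → ℝ) × (Fin (m + 2) → ℝ) → ℂ, Adm ν f → Adm ν g →
      ‖bil ν f g‖ₑ ≤ C₁ * mn ν a₁ b₁ f * mn ν (1 - a₁) (1 - b₁) g)
    {f g : (Fin (m + 2) → ℝ) × (Fin (m + 2) → ℝ) → ℂ} (hf : Nice a f) (hg : Nice (1 - a) g) :
    ‖bil ν f g‖ₑ ≤ C₀ ^ (1 - θ) * C₁ ^ θ * mn ν a b f * mn ν (1 - a) (1 - b) g := by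
  have hθ' : 0 < 1 - θ := by linarith
  have ha : 0 < a := by rw [hae]; positivity
  have hb : 0 < b := by rw [hbe]; positivity
  have ha' : 0 < 1 - a := by nlinarith
  have hb' : 0 < 1 - b := by nlinarith
  have hae' : 1 - a = (1 - θ) * (1 - a₀) + θ * (1 - a₁) := by rw [hae]; ring
  have hbe' : 1 - b = (1 - θ) * (1 - b₀) + θ * (1 - b₁) := by rw [hbe]; ring
  set φ := phase a ((a₁ - a₀) / a) ((b₁ - b₀) / b - (a₁ - a₀) / a) f with hφ
  set χ := phase (1 - a) ((1 - a₁ - (1 - a₀)) / (1 - a))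
    ((1 - b₁ - (1 - b₀)) / (1 - b) - (1 - a₁ - (1 - a₀)) / (1 - a)) g with hχ
  have hφm : Measurable φ := measurable_phase hf.measurable
  have hχm : Measurable χ := measurable_phase hg.measurable
  obtain ⟨R₁, hR₁⟩ : ∃ R : ℝ, ∀ p, |φ p| ≤ R := exists_abs_phase_le ha _ _ hf
  obtain ⟨R₂, hR₂⟩ : ∃ R : ℝ, ∀ p, |χ p| ≤ R := exists_abs_phase_le ha' _ _ hg
  have hadm : ∀ (z : ℂ) (R : ℝ) (h : (Fin (m + 2) → ℝ) × (Fin (m + 2) → ℝ) → ℂ)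
      (w : (Fin (m + 2) → ℝ) × (Fin (m + 2) → ℝ) → ℝ), Adm ν h → Measurable w → (∀ p, |w p| ≤ R) →
      Adm ν fun p => h p * cexp (z * w p) := by
    intro z R h w hh hw hR
    refine hh.mul_bdd (by fun_prop) (R := Real.exp (‖z‖ * R)) fun p => ?_
    refine (Complex.norm_exp_le_exp_norm _).trans (Real.exp_le_exp.2 ?_)
    rw [norm_mul, Complex.norm_real, Real.norm_eq_abs]
    gcongr
    exact hR p
  have hbil : ∀ z : ℂ, ∫ P, bilKernel ν P * (f P.2 * g P.1) *
      cexp (z * ((φ P.2 + χ P.1 : ℝ) : ℂ)) ∂((tubeMeasure m ν).prod (tubeMeasure m ν)) =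
      bil ν (fun p => f p * cexp (z * φ p)) (fun p => g p * cexp (z * χ p)) := by
    intro z
    unfold bil
    congr 1
    ext P
    rw [Complex.ofReal_add, mul_add, Complex.exp_add]
    ring
  set X := mn ν a b f with hX
  set Y := mn ν (1 - a) (1 - b) g with hY
  have hXt : X ≠ ∞ := (hf.mn_lt_top ν ha hb).ne
  have hYt : Y ≠ ∞ := (hg.mn_lt_top ν ha' hb').ne
  have bound : ∀ (C : ℝ≥0∞), C ≠ ∞ → ∀ z : ℂ, ∀ β β' : ℝ, 0 < β → 0 < β' →
      ‖bil ν (fun p => f p * cexp (z * φ p)) (fun p => g p * cexp (z * χ p))‖ₑ ≤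
        C * X ^ β * Y ^ β' →
      ‖∫ P, bilKernel ν P * (f P.2 * g P.1) * cexp (z * ((φ P.2 + χ P.1 : ℝ) : ℂ))
        ∂((tubeMeasure m ν).prod (tubeMeasure m ν))‖ ≤ (C * X ^ β * Y ^ β').toReal := by
    intro C hC z β β' hβ hβ' h
    rw [hbil, ← toReal_enorm]
    exact ENNReal.toReal_mono (ENNReal.mul_ne_top (ENNReal.mul_ne_top hC
      (ENNReal.rpow_ne_top_of_nonneg hβ.le hXt)) (ENNReal.rpow_ne_top_of_nonneg hβ'.le hYt)) h
  have main := norm_integral_le_interp (integrable_bil hν (hf.adm ν) (hg.adm ν))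
    (ψ := fun P => φ P.2 + χ P.1) (by fun_prop) (R := R₁ + R₂)
    (fun P => (abs_add_le _ _).trans (add_le_add (hR₁ _) (hR₂ _))) hθ0 hθ1
    (M₀ := (C₀ * X ^ (b₀ / b) * Y ^ ((1 - b₀) / (1 - b))).toReal)
    (M₁ := (C₁ * X ^ (b₁ / b) * Y ^ ((1 - b₁) / (1 - b))).toReal)
    (fun t => by
      refine bound C₀ hC₀ _ _ _ (by positivity) (div_pos (by linarith) hb') ?_
      refine (H₀ _ _ (hadm _ _ _ _ (hf.adm ν) hφm hR₁) (hadm _ _ _ _ (hg.adm ν) hχm hR₂)).trans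
        (le_of_eq ?_)
      have h1 := mn_phase (ν := ν) (s := 0) ha hb hae hbe (by simpa) (by simpa) hf t
      have h2 := mn_phase (ν := ν) (s := 0) ha' hb' hae' hbe' (by simpa) (by simpa) hg t
      simp only [sub_zero, one_mul, zero_mul, add_zero, Complex.ofReal_zero, zero_add] at h1 h2
      rw [h1, h2])
    (fun t => by
      refine bound C₁ hC₁ _ _ _ (by positivity) (div_pos (by linarith) hb') ?_
      refine (H₁ _ _ (hadm _ _ _ _ (hf.adm ν) hφm hR₁) (hadm _ _ _ _ (hg.adm ν) hχm hR₂)).trans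
        (le_of_eq ?_)
      have h1 := mn_phase (ν := ν) (s := 1) ha hb hae hbe (by simpa) (by simpa) hf t
      have h2 := mn_phase (ν := ν) (s := 1) ha' hb' hae' hbe' (by simpa) (by simpa) hg t
      simp only [sub_self, one_mul, zero_mul, Complex.ofReal_one, zero_add] at h1 h2
      rw [h1, h2])
  have hrpow : ∀ (Z : ℝ≥0∞) (u v : ℝ), 0 < u → 0 < v → u * (1 - θ) + v * θ = 1 →
      (Z ^ u) ^ (1 - θ) * (Z ^ v) ^ θ = Z := by
    intro Z u v hu hv h
    rw [← ENNReal.rpow_mul, ← ENNReal.rpow_mul, ← ENNReal.rpow_add_of_nonneg _ _ (by positivity)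
      (by positivity), h, ENNReal.rpow_one]
  have hr1 := hrpow X (b₀ / b) (b₁ / b) (by positivity) (by positivity) (by
    field_simp
    linarith)
  have hr2 := hrpow Y ((1 - b₀) / (1 - b)) ((1 - b₁) / (1 - b)) (div_pos (by linarith) hb')
    (div_pos (by linarith) hb') (by
    field_simp
    linarith)
  have htop : C₀ ^ (1 - θ) * C₁ ^ θ * X * Y ≠ ∞ := ENNReal.mul_ne_top (ENNReal.mul_ne_top
    (ENNReal.mul_ne_top (ENNReal.rpow_ne_top_of_nonneg hθ'.le hC₀)
      (ENNReal.rpow_ne_top_of_nonneg hθ0.le hC₁)) hXt) hYt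
  rw [← ENNReal.ofReal_toReal htop, ← ofReal_norm]
  refine ENNReal.ofReal_le_ofReal (main.trans (le_of_eq ?_))
  rw [ENNReal.toReal_rpow, ENNReal.toReal_rpow, ← ENNReal.toReal_mul]
  congr 1
  rw [ENNReal.mul_rpow_of_nonneg _ _ hθ'.le, ENNReal.mul_rpow_of_nonneg _ _ hθ'.le,
    ENNReal.mul_rpow_of_nonneg _ _ hθ0.le, ENNReal.mul_rpow_of_nonneg _ _ hθ0.le]
  calc _ = C₀ ^ (1 - θ) * C₁ ^ θ * ((X ^ (b₀ / b)) ^ (1 - θ) * (X ^ (b₁ / b)) ^ θ) *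
        ((Y ^ ((1 - b₀) / (1 - b))) ^ (1 - θ) * (Y ^ ((1 - b₁) / (1 - b))) ^ θ) := by ring
    _ = _ := by rw [hr1, hr2]

end interp

section bound

variable {m : ℕ}

/-- Boundedness of the bilinear form on nice functions. -/
def BoundNice (m : ℕ) (ν a b : ℝ) : Prop :=
  ∃ C : ℝ≥0∞, C ≠ ∞ ∧ ∀ f g : (Fin (m + 2) → ℝ) × (Fin (m + 2) → ℝ) → ℂ,
    Nice a f → Nice (1 - a) g → ‖bil ν f g‖ₑ ≤ C * mn ν a b f * mn ν (1 - a) (1 - b) g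

theorem pn_conj (a : ℝ) (f : (Fin (m + 2) → ℝ) × (Fin (m + 2) → ℝ) → ℂ) :
    pn a (fun p => starRingEnd ℂ (f p)) = pn a f := by
  ext y
  simp [pn, enorm_eq_nnnorm]

theorem mn_conj (ν a b : ℝ) (f : (Fin (m + 2) → ℝ) × (Fin (m + 2) → ℝ) → ℂ) :
    mn ν a b (fun p => starRingEnd ℂ (f p)) = mn ν a b f := by
  unfold mn
  rw [pn_conj]

theorem Nice.conj {a : ℝ} {f : (Fin (m + 2) → ℝ) × (Fin (m + 2) → ℝ) → ℂ} (hf : Nice a f) :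
    Nice a fun p => starRingEnd ℂ (f p) := by
  obtain ⟨k, hk, H⟩ := hf.exists_bound
  refine ⟨Complex.continuous_conj.measurable.comp hf.measurable, k, hk, fun p hp => ?_⟩
  rw [pn_conj, RCLike.norm_conj]
  exact H p fun h => hp (by rw [h, map_zero])

theorem bil_swap {ν : ℝ} (hν : (m : ℝ) / 2 < ν)
    (f g : (Fin (m + 2) → ℝ) × (Fin (m + 2) → ℝ) → ℂ) :
    bil ν f g = starRingEnd ℂ
      (bil ν (fun p => starRingEnd ℂ (g p)) (fun p => starRingEnd ℂ (f p))) := by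
  have hmem : ∀ᵐ p ∂(tubeMeasure m ν), p.1 ∈ lightCone (m + 2) :=
    Measure.quasiMeasurePreserving_fst.ae (ae_mem_lightCone ν)
  have hmem2 : ∀ᵐ P ∂((tubeMeasure m ν).prod (tubeMeasure m ν)),
      P.1.1 ∈ lightCone (m + 2) ∧ P.2.1 ∈ lightCone (m + 2) :=
    (Measure.quasiMeasurePreserving_fst.ae hmem).and (Measure.quasiMeasurePreserving_snd.ae hmem)
  unfold bil
  rw [← integral_conj, ← integral_prod_swap]
  refine integral_congr_ae (hmem2.mono fun P hP => ?_)
  have h : bilKernel ν P.swap = starRingEnd ℂ (bilKernel ν P) := by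
    unfold bilKernel
    rw [← kern_neg hν _ (add_mem_lightCone hP.1 hP.2), neg_sub, Prod.fst_swap, Prod.snd_swap,
      add_comm P.2.1]
  simp only [h, map_mul, Complex.conj_conj, Prod.fst_swap, Prod.snd_swap]
  ring

theorem BoundNice.symm {ν a b : ℝ} (hν : (m : ℝ) / 2 < ν) (h : BoundNice m ν (1 - a) (1 - b)) :
    BoundNice m ν a b := by
  obtain ⟨C, hC, H⟩ := h
  refine ⟨C, hC, fun f g hf hg => ?_⟩
  rw [bil_swap hν]
  have := H _ _ hg.conj (by rw [sub_sub_cancel]; exact hf.conj)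
  rw [sub_sub_cancel, sub_sub_cancel, mn_conj, mn_conj] at this
  rw [enorm_eq_nnnorm, RCLike.nnnorm_conj, ← enorm_eq_nnnorm]
  refine this.trans (le_of_eq ?_)
  ring

theorem exists_enorm_bil_le {ν a b : ℝ} (hm : 0 < m) (hν : (m : ℝ) / 2 < ν)
    (ha0 : 0 < a) (ha1 : a < 1) (hb0 : 0 < b) (hb1 : b < 1)
    (h1 : 1 / b < 1 + ν / (m / 2)) (h2 : 1 / (1 - b) < 1 + ν / (m / 2)) :
    ∃ C : ℝ≥0∞, C ≠ ∞ ∧ ∀ f g : (Fin (m + 2) → ℝ) × (Fin (m + 2) → ℝ) → ℂ,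
      Adm ν f → Adm ν g → ‖bil ν f g‖ₑ ≤ C * mn ν a b f * mn ν (1 - a) (1 - b) g := by
  obtain ⟨C, hC, H⟩ := exists_lintegral_bilKernel_le hm hν ha0 ha1 hb0 hb1 h1 h2
  refine ⟨C, hC, fun f g hf hg => ((enorm_integral_le_lintegral_enorm _).trans (le_of_eq ?_)).trans
    (H f g hf.measurable hg.measurable)⟩
  simp only [enorm_mul]

theorem boundNice_of_le_half {ν a b κ : ℝ} (hm : 0 < m) (hν : (m : ℝ) / 2 < ν)
    (hκ : κ = 1 / (1 + ν / (m / 2))) (ha0 : 0 < a) (ha1 : a < 1) (hb : b ≤ 1 / 2)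
    (h1 : a * κ < b) (h2 : (1 - a) * κ < b) : BoundNice m ν a b := by
  have hm' : (0 : ℝ) < m / 2 := by positivity
  have hν0 : 0 < ν := hm'.trans hν
  have hκ0 : 0 < κ := by rw [hκ]; positivity
  have hκ2 : κ < 1 / 2 := by
    rw [hκ]
    refine one_div_lt_one_div_of_lt (by norm_num) ?_
    have : 1 < ν / (m / 2) := (one_lt_div hm').2 hν
    linarith
  have hκi : 1 + ν / (m / 2) = 1 / κ := by rw [hκ, one_div_one_div]
  have hb0 : 0 < b := (mul_pos ha0 hκ0).trans h1
  have lt_of : ∀ t, κ < t → 1 / t < 1 + ν / (m / 2) := fun t ht => by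
    rw [hκi]
    exact one_div_lt_one_div_of_lt hκ0 ht
  rcases lt_or_ge κ b with hκb | hbκ
  · obtain ⟨C, hC, H⟩ := exists_enorm_bil_le hm hν ha0 ha1 hb0 (by linarith) (lt_of _ hκb)
      (lt_of _ (by linarith))
    exact ⟨C, hC, fun f g hf hg => H f g (hf.adm ν) (hg.adm ν)⟩
  · obtain ⟨c, hc1, hc2⟩ : ∃ c, max (max a (1 - a)) (b / (1 - κ)) < c ∧ c < b / κ := by
      refine exists_between (max_lt (max_lt ?_ ?_) ?_)
      · rwa [lt_div_iff₀ hκ0]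
      · rwa [lt_div_iff₀ hκ0]
      · exact div_lt_div_of_pos_left hb0 hκ0 (by linarith)
    rw [max_lt_iff, max_lt_iff] at hc1
    obtain ⟨⟨hca, hca'⟩, hcb⟩ := hc1
    have hc0 : 0 < c := by linarith
    have hc1 : c < 1 := hc2.trans_le ((div_le_one hκ0).2 hbκ)
    have hb₀ : κ < b / c := by
      rw [lt_div_iff₀ hκ0] at hc2
      rw [lt_div_iff₀ hc0]
      linarith
    have hb₀' : b / c < 1 - κ := by
      rw [div_lt_iff₀ (by linarith)] at hcb
      rw [div_lt_iff₀ hc0]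
      linarith
    have hc' : 0 < 2 * c - 1 := by linarith
    have hbc : 0 < b / c := by positivity
    set a₀ := 1 / 2 + (a - 1 / 2) / (2 * c - 1) with ha₀
    have ha₀0 : 0 < a₀ := by
      have : -(1 / 2) < (a - 1 / 2) / (2 * c - 1) := by
        rw [lt_div_iff₀ hc']
        linarith
      linarith
    have ha₀1 : a₀ < 1 := by
      have : (a - 1 / 2) / (2 * c - 1) < 1 / 2 := by
        rw [div_lt_iff₀ hc']
        linarith
      linarith
    obtain ⟨C₀, hC₀, H₀⟩ := exists_enorm_bil_le hm hν ha₀0 ha₀1 hbc (by linarith)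
      (lt_of _ hb₀) (lt_of _ (by linarith))
    obtain ⟨C₁, hC₁, H₁⟩ := exists_enorm_bil_two_le (b := b / c / 2) hm hν (by linarith)
      (by linarith) (lt_of _ (by linarith)) (lt_of _ (by linarith))
    refine ⟨C₀ ^ (1 - 2 * (1 - c)) * C₁ ^ (2 * (1 - c)), ENNReal.mul_ne_top
      (ENNReal.rpow_ne_top_of_nonneg (by linarith) hC₀)
      (ENNReal.rpow_ne_top_of_nonneg (by linarith) hC₁), fun f g hf hg => ?_⟩
    refine bil_interp hν hC₀ hC₁ (by linarith) (by linarith) ha₀0 ha₀1 (by norm_num : (0:ℝ) < 1 / 2)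
      (by norm_num) hbc (by linarith) (by linarith : 0 < b / c / 2) (by linarith) ?_ ?_ H₀ ?_ hf hg
    · rw [ha₀]
      field_simp
      ring
    · field_simp
      ring
    · intro f g hf hg
      have := H₁ f g hf hg
      rwa [show (1 : ℝ) - 1 / 2 = 1 / 2 by norm_num]

theorem boundNice {ν a b κ : ℝ} (hm : 0 < m) (hν : (m : ℝ) / 2 < ν)
    (hκ : κ = 1 / (1 + ν / (m / 2))) (ha0 : 0 < a) (ha1 : a < 1)
    (h1 : a * κ < b) (h2 : (1 - a) * κ < b) (h3 : a * κ < 1 - b) (h4 : (1 - a) * κ < 1 - b) :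
    BoundNice m ν a b := by
  rcases le_total b (1 / 2) with hb | hb
  · exact boundNice_of_le_half hm hν hκ ha0 ha1 hb h1 h2
  · exact BoundNice.symm hν (boundNice_of_le_half hm hν hκ (by linarith) (by linarith)
      (by linarith) h4 (by rwa [sub_sub_cancel]))

end bound

section truncation

variable {m : ℕ}

theorem pn_mono {a : ℝ} (ha : 0 < a) {f g : (Fin (m + 2) → ℝ) × (Fin (m + 2) → ℝ) → ℂ}
    (h : ∀ p, ‖f p‖ₑ ≤ ‖g p‖ₑ) (y : Fin (m + 2) → ℝ) : pn a f y ≤ pn a g y := by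
  unfold pn
  have : 0 ≤ 1 / a := by positivity
  gcongr with x
  exact h _

theorem mn_mono {ν a b : ℝ} (ha : 0 < a) (hb : 0 < b)
    {f g : (Fin (m + 2) → ℝ) × (Fin (m + 2) → ℝ) → ℂ} (h : ∀ p, ‖f p‖ₑ ≤ ‖g p‖ₑ) :
    mn ν a b f ≤ mn ν a b g := by
  unfold mn
  have : 0 ≤ 1 / b := by positivity
  gcongr with y
  exact pn_mono ha h y

/-- The set where `f` is of size comparable to one, inside a large box. -/
def cutSet (j : ℕ) (f : (Fin (m + 2) → ℝ) × (Fin (m + 2) → ℝ) → ℂ) :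
    Set ((Fin (m + 2) → ℝ) × (Fin (m + 2) → ℝ)) :=
  tubeBox m (j + 1) ∩ {p | 1 / (j + 1 : ℝ) ≤ ‖f p‖ ∧ ‖f p‖ ≤ j + 1}

/-- The restriction of `f` to `cutSet`. -/
def cut (j : ℕ) (f : (Fin (m + 2) → ℝ) × (Fin (m + 2) → ℝ) → ℂ) :
    (Fin (m + 2) → ℝ) × (Fin (m + 2) → ℝ) → ℂ :=
  (cutSet j f).indicator f

/-- The restriction of `cut` to the fibres whose norm is not too small. -/
def trunc (a : ℝ) (j : ℕ) (f : (Fin (m + 2) → ℝ) × (Fin (m + 2) → ℝ) → ℂ) :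
    (Fin (m + 2) → ℝ) × (Fin (m + 2) → ℝ) → ℂ :=
  {p | ENNReal.ofReal (1 / (j + 1)) ≤ pn a (cut j f) p.1}.indicator (cut j f)

theorem measurable_cut {f : (Fin (m + 2) → ℝ) × (Fin (m + 2) → ℝ) → ℂ} (hf : Measurable f) (j : ℕ) :
    Measurable (cut j f) :=
  hf.indicator ((measurableSet_tubeBox _).inter
    ((measurableSet_le measurable_const hf.norm).inter (measurableSet_le hf.norm measurable_const)))

theorem measurable_trunc {a : ℝ} {f : (Fin (m + 2) → ℝ) × (Fin (m + 2) → ℝ) → ℂ}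
    (hf : Measurable f) (j : ℕ) : Measurable (trunc a j f) :=
  (measurable_cut hf j).indicator (measurableSet_le measurable_const
    ((measurable_pn (measurable_cut hf j)).comp measurable_fst))

theorem nice_trunc {a : ℝ} {f : (Fin (m + 2) → ℝ) × (Fin (m + 2) → ℝ) → ℂ}
    (hf : Measurable f) (j : ℕ) : Nice a (trunc a j f) := by
  refine ⟨measurable_trunc hf j, j + 1, by simp, fun p hp => ?_⟩
  have h1 : ENNReal.ofReal (1 / (j + 1)) ≤ pn a (cut j f) p.1 := by
    by_contra h
    exact hp (Set.indicator_of_notMem (by exact h) _)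
  have e : ∀ x, trunc a j f (p.1, x) = cut j f (p.1, x) := fun x =>
    Set.indicator_of_mem (by exact h1) _
  have h2 : p ∈ cutSet j f := by
    by_contra h
    refine hp ((e p.2).trans ?_)
    exact Set.indicator_of_notMem h _
  have e2 : trunc a j f p = f p := (e p.2).trans (Set.indicator_of_mem h2 _)
  rw [e2]
  refine ⟨h2.1, h2.2.1, h2.2.2, ?_⟩
  unfold pn
  simp only [e]
  exact h1

theorem trunc_eq_or (a : ℝ) (j : ℕ) (f : (Fin (m + 2) → ℝ) × (Fin (m + 2) → ℝ) → ℂ)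
    (p : (Fin (m + 2) → ℝ) × (Fin (m + 2) → ℝ)) : trunc a j f p = f p ∨ trunc a j f p = 0 := by
  unfold trunc cut
  by_cases h : p ∈ {p : (Fin (m + 2) → ℝ) × (Fin (m + 2) → ℝ) |
    ENNReal.ofReal (1 / (j + 1)) ≤ pn a ((cutSet j f).indicator f) p.1}
  · rw [Set.indicator_of_mem h]
    by_cases h' : p ∈ cutSet j f
    · exact Or.inl (Set.indicator_of_mem h' _)
    · exact Or.inr (Set.indicator_of_notMem h' _)
  · exact Or.inr (Set.indicator_of_notMem h _)

theorem enorm_trunc_le (a : ℝ) (j : ℕ) (f : (Fin (m + 2) → ℝ) × (Fin (m + 2) → ℝ) → ℂ)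
    (p : (Fin (m + 2) → ℝ) × (Fin (m + 2) → ℝ)) : ‖trunc a j f p‖ₑ ≤ ‖f p‖ₑ := by
  rcases trunc_eq_or a j f p with h | h <;> simp [h]

theorem cutSet_mono (f : (Fin (m + 2) → ℝ) × (Fin (m + 2) → ℝ) → ℂ) :
    Monotone fun j => cutSet j f := by
  intro i j hij p hp
  have h : (i : ℝ) + 1 ≤ j + 1 := by
    have : (i : ℝ) ≤ j := by exact_mod_cast hij
    linarith
  have h' : 1 / ((j : ℝ) + 1) ≤ 1 / ((i : ℝ) + 1) := one_div_le_one_div_of_le (by positivity) h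
  obtain ⟨⟨⟨h1, h2, h3⟩, h4⟩, h5, h6⟩ := hp
  exact ⟨⟨⟨h1, h2.trans h, h'.trans h3⟩, Metric.closedBall_subset_closedBall h h4⟩, h'.trans h5,
    h6.trans h⟩

theorem exists_mem_cutSet {f : (Fin (m + 2) → ℝ) × (Fin (m + 2) → ℝ) → ℂ}
    {p : (Fin (m + 2) → ℝ) × (Fin (m + 2) → ℝ)} (hp : p.1 ∈ lightCone (m + 2)) (hf : f p ≠ 0) :
    ∃ j, p ∈ cutSet j f := by
  have hQ := Q_pos hp
  have hn := norm_pos_iff.2 hf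
  obtain ⟨j, hj⟩ := exists_nat_ge (‖p.1‖ + 1 / lorentzQ (m + 2) p.1 + ‖p.2‖ + 1 / ‖f p‖ + ‖f p‖)
  have h1 : 0 ≤ ‖p.1‖ := norm_nonneg _
  have h2 : 0 ≤ ‖p.2‖ := norm_nonneg _
  have h3 : 0 < 1 / lorentzQ (m + 2) p.1 := by positivity
  have h4 : 0 < 1 / ‖f p‖ := by positivity
  refine ⟨j, ⟨⟨hp, by linarith, ?_⟩, ?_⟩, ?_, by linarith⟩
  · rw [one_div_le (by positivity) hQ]
    linarith
  · rw [mem_closedBall_zero_iff]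
    linarith
  · rw [one_div_le (by positivity) hn]
    linarith

theorem ae_eq_zero_of_pn_eq_zero {a : ℝ} (ha : 0 < a)
    {f : (Fin (m + 2) → ℝ) × (Fin (m + 2) → ℝ) → ℂ} (hf : Measurable f) {y : Fin (m + 2) → ℝ}
    (h : pn a f y = 0) : ∀ᵐ x, f (y, x) = 0 := by
  unfold pn at h
  rw [ENNReal.rpow_eq_zero_iff_of_pos ha, lintegral_eq_zero_iff (by fun_prop)] at h
  refine h.mono fun x hx => ?_
  rw [Pi.zero_apply, ENNReal.rpow_eq_zero_iff_of_pos (by positivity)] at hx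
  exact enorm_eq_zero.1 hx

theorem ae_eventually_trunc_eq (ν : ℝ) {a : ℝ} (ha : 0 < a)
    {f : (Fin (m + 2) → ℝ) × (Fin (m + 2) → ℝ) → ℂ} (hf : Measurable f) :
    ∀ᵐ p ∂(tubeMeasure m ν), ∀ᶠ j in Filter.atTop, trunc a j f p = f p := by
  have hmem : ∀ᵐ p ∂(tubeMeasure m ν), p.1 ∈ lightCone (m + 2) :=
    Measure.quasiMeasurePreserving_fst.ae (ae_mem_lightCone ν)
  set B : Set ((Fin (m + 2) → ℝ) × (Fin (m + 2) → ℝ)) :=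
    {p | p.1 ∈ lightCone (m + 2) ∧ f p ≠ 0} ∩ ⋂ j : ℕ, {p | pn a (cut j f) p.1 = 0} with hB
  have hBm : MeasurableSet B := by
    refine ((measurable_fst measurableSet_lightCone).inter
      (hf (measurableSet_singleton 0).compl)).inter (MeasurableSet.iInter fun j => ?_)
    exact ((measurable_pn (measurable_cut hf j)).comp measurable_fst) (measurableSet_singleton 0)
  have hB0 : tubeMeasure m ν B = 0 := by
    unfold tubeMeasure
    rw [Measure.measure_prod_null hBm]
    refine Filter.Eventually.of_forall fun y => ?_
    by_cases hy : ∀ j : ℕ, pn a (cut j f) y = 0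
    · have h1 : ∀ᵐ x, ∀ j : ℕ, cut j f (y, x) = 0 :=
        ae_all_iff.2 fun j => ae_eq_zero_of_pn_eq_zero ha (measurable_cut hf j) (hy j)
      refine measure_mono_null (fun x hx => ?_) h1
      intro hx'
      obtain ⟨j, hj⟩ := exists_mem_cutSet hx.1.1 hx.1.2
      exact hx.1.2 ((Set.indicator_of_mem hj f).symm.trans (hx' j))
    · have : Prod.mk y ⁻¹' B = ∅ := by
        ext x
        simp only [hB, Set.mem_preimage, Set.mem_inter_iff, Set.mem_iInter, Set.mem_empty_iff_false,
          iff_false, not_and]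
        exact fun _ h => hy h
      simp [this]
  have hB' : ∀ᵐ p ∂(tubeMeasure m ν), p ∉ B := measure_eq_zero_iff_ae_notMem.1 hB0
  filter_upwards [hmem, hB'] with p hp hpB
  by_cases h0 : f p = 0
  · refine Filter.Eventually.of_forall fun j => ?_
    rcases trunc_eq_or a j f p with h | h
    · exact h
    · rw [h, h0]
  · obtain ⟨i, hi⟩ := exists_mem_cutSet hp h0
    obtain ⟨l, hl⟩ : ∃ l : ℕ, pn a (cut l f) p.1 ≠ 0 := by
      by_contra! h
      exact hpB ⟨⟨hp, h0⟩, Set.mem_iInter.2 h⟩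
    have hlim : Filter.Tendsto (fun j : ℕ => ENNReal.ofReal (1 / ((j : ℝ) + 1))) Filter.atTop
        (nhds 0) := by
      rw [← ENNReal.ofReal_zero]
      exact ENNReal.tendsto_ofReal tendsto_one_div_add_atTop_nhds_zero_nat
    filter_upwards [Filter.eventually_ge_atTop i, Filter.eventually_ge_atTop l,
      hlim.eventually (gt_mem_nhds (pos_iff_ne_zero.2 hl))] with j hij hlj hj
    have h1 : pn a (cut l f) p.1 ≤ pn a (cut j f) p.1 := by
      refine pn_mono ha (fun q => ?_) _
      unfold cut
      rw [enorm_indicator_eq_indicator_enorm, enorm_indicator_eq_indicator_enorm]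
      exact Set.indicator_le_indicator_of_subset (cutSet_mono f hlj) (fun _ => zero_le) _
    unfold trunc
    rw [Set.indicator_of_mem (by exact hj.le.trans h1)]
    exact Set.indicator_of_mem (cutSet_mono f hij hi) _

/-- Fatou's lemma for the mixed norm. -/
theorem mn_le_of_tendsto {ν a b : ℝ} (ha : 0 < a) (hb : 0 < b)
    {F : ℕ → (Fin (m + 2) → ℝ) × (Fin (m + 2) → ℝ) → ℂ}
    {f : (Fin (m + 2) → ℝ) × (Fin (m + 2) → ℝ) → ℂ} (hF : ∀ j, Measurable (F j))
    (h : ∀ᵐ p ∂(tubeMeasure m ν), ∀ᶠ j in Filter.atTop, F j p = f p) {C : ℝ≥0∞}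
    (hC : ∀ j, mn ν a b (F j) ≤ C) : mn ν a b f ≤ C := by
  have ha' : 0 < 1 / a := by positivity
  have hb' : 0 < 1 / b := by positivity
  have hmono : ∀ s : ℝ, 0 < s → ∀ u : ℕ → ℝ≥0∞, Filter.liminf u Filter.atTop ^ s =
      Filter.liminf (fun j => u j ^ s) Filter.atTop := fun s hs u =>
    (ENNReal.monotone_rpow_of_nonneg hs.le).map_liminf_of_continuousAt u
      (ENNReal.continuous_rpow_const.continuousAt)
  have h1 : ∀ᵐ y ∂(coneMeasure m ν), pn a f y ^ (1 / b) ≤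
      Filter.liminf (fun j => pn a (F j) y ^ (1 / b)) Filter.atTop := by
    filter_upwards [Measure.ae_ae_of_ae_prod h] with y hy
    rw [← hmono _ hb']
    refine ENNReal.rpow_le_rpow ?_ hb'.le
    unfold pn
    rw [← hmono _ ha]
    refine ENNReal.rpow_le_rpow ?_ ha.le
    refine le_trans (lintegral_mono_ae ?_) (lintegral_liminf_le fun j => by
      have := hF j
      fun_prop)
    filter_upwards [hy] with x hx
    have : Filter.Tendsto (fun j => ‖F j (y, x)‖ₑ ^ (1 / a)) Filter.atTop
        (nhds (‖f (y, x)‖ₑ ^ (1 / a))) :=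
      tendsto_const_nhds.congr' (hx.mono fun j hj => by simp only [hj])
    exact this.liminf_eq.ge
  have h2 : ∫⁻ y, pn a f y ^ (1 / b) ∂(coneMeasure m ν) ≤ C ^ (1 / b) := by
    refine (lintegral_mono_ae h1).trans ((lintegral_liminf_le fun j => by
      have := hF j
      fun_prop).trans ?_)
    refine Filter.liminf_le_of_le (by isBoundedDefault) fun c hc => ?_
    obtain ⟨j, hj⟩ := hc.exists
    refine hj.trans ?_
    have := ENNReal.rpow_le_rpow (hC j) hb'.le
    unfold mn at this
    rwa [← ENNReal.rpow_mul, mul_one_div_cancel hb.ne', ENNReal.rpow_one] at this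
  unfold mn
  refine (ENNReal.rpow_le_rpow h2 hb.le).trans ?_
  rw [← ENNReal.rpow_mul, one_div_mul_cancel hb.ne', ENNReal.rpow_one]

end truncation

section dual

variable {m : ℕ}

theorem rpow_bounds {k x : ℝ} (hk : 1 ≤ k) (h1 : 1 / k ≤ x) (h2 : x ≤ k) (s : ℝ) :
    1 / k ^ |s| ≤ x ^ s ∧ x ^ s ≤ k ^ |s| := by
  have hk0 : 0 < k := by linarith
  have hx : 0 < x := lt_of_lt_of_le (by positivity) h1
  have h := abs_log_le_of_bounds hk h1 h2
  have h3 : |Real.log x * s| ≤ Real.log k * |s| := by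
    rw [abs_mul]
    gcongr
  rw [one_div, ← Real.rpow_neg hk0.le, Real.rpow_def_of_pos hk0, Real.rpow_def_of_pos hx,
    Real.rpow_def_of_pos hk0, Real.exp_le_exp, Real.exp_le_exp]
  have := abs_le.1 h3
  constructor <;> linarith

/-- The extremal function for the duality of the mixed norms. -/
def dualFn (a b : ℝ) (h : (Fin (m + 2) → ℝ) × (Fin (m + 2) → ℝ) → ℂ)
    (p : (Fin (m + 2) → ℝ) × (Fin (m + 2) → ℝ)) : ℂ :=
  starRingEnd ℂ (h p) *
    ((‖h p‖ ^ (1 / a - 2) * (pn a h p.1).toReal ^ (1 / b - 1 / a) : ℝ) : ℂ)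

theorem dualFn_eq_zero {a b : ℝ} {h : (Fin (m + 2) → ℝ) × (Fin (m + 2) → ℝ) → ℂ}
    {p : (Fin (m + 2) → ℝ) × (Fin (m + 2) → ℝ)} (hp : h p = 0) : dualFn a b h p = 0 := by
  simp [dualFn, hp]

theorem norm_dualFn {a b : ℝ} {h : (Fin (m + 2) → ℝ) × (Fin (m + 2) → ℝ) → ℂ}
    {p : (Fin (m + 2) → ℝ) × (Fin (m + 2) → ℝ)} (hp : h p ≠ 0) :
    ‖dualFn a b h p‖ = ‖h p‖ ^ (1 / a - 1) * (pn a h p.1).toReal ^ (1 / b - 1 / a) := by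
  have hp' := norm_pos_iff.2 hp
  unfold dualFn
  rw [norm_mul, RCLike.norm_conj, Complex.norm_real, Real.norm_of_nonneg (by positivity),
    show 1 / a - 1 = 1 + (1 / a - 2) by ring, Real.rpow_add hp', Real.rpow_one, mul_assoc]

theorem mul_dualFn {a b : ℝ} (h : (Fin (m + 2) → ℝ) × (Fin (m + 2) → ℝ) → ℂ)
    (p : (Fin (m + 2) → ℝ) × (Fin (m + 2) → ℝ)) :
    h p * dualFn a b h p =
      ((‖h p‖ ^ 2 * (‖h p‖ ^ (1 / a - 2) * (pn a h p.1).toReal ^ (1 / b - 1 / a)) : ℝ) : ℂ) := by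
  unfold dualFn
  rw [← mul_assoc, Complex.mul_conj, Complex.normSq_eq_norm_sq]
  push_cast
  ring

theorem measurable_dualFn {a b : ℝ} {h : (Fin (m + 2) → ℝ) × (Fin (m + 2) → ℝ) → ℂ}
    (hh : Measurable h) : Measurable (dualFn a b h) := by
  have h1 : Measurable fun p : (Fin (m + 2) → ℝ) × (Fin (m + 2) → ℝ) => (pn a h p.1).toReal :=
    ((measurable_pn hh).comp measurable_fst).ennreal_toReal
  exact (Complex.continuous_conj.measurable.comp hh).mul
    (Complex.measurable_ofReal.comp ((hh.norm.pow_const _).mul (h1.pow_const _)))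

theorem norm_dualFn_eq {a b : ℝ} (ha : 0 < a) (hb : 0 < b)
    {h : (Fin (m + 2) → ℝ) × (Fin (m + 2) → ℝ) → ℂ}
    {p : (Fin (m + 2) → ℝ) × (Fin (m + 2) → ℝ)} (hp : h p ≠ 0) :
    ‖dualFn a b h p‖ = ‖h p‖ ^ ((1 - a) / a) *
      (pn a h p.1).toReal ^ ((1 - b) / b - (1 - a) / a) := by
  rw [norm_dualFn hp, show (1 - a) / a = 1 / a - 1 by field_simp,
    show (1 - b) / b - (1 / a - 1) = 1 / b - 1 / a by field_simp; ring]

theorem nice_dualFn {a b : ℝ} (ha : 0 < a) (ha1 : a < 1) (hb : 0 < b) (hb1 : b < 1)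
    {h : (Fin (m + 2) → ℝ) × (Fin (m + 2) → ℝ) → ℂ} (hh : Nice a h) :
    Nice (1 - a) (dualFn a b h) := by
  obtain ⟨k₁, hk₁, H₁⟩ := hh.exists_bound
  obtain ⟨k₂, hk₂, H₂⟩ := hh.exists_pn_bound ha
  set s := (1 - a) / a
  set t := (1 - b) / b - (1 - a) / a
  set u := (1 - b) / b with hu
  have hu0 : 0 ≤ u := div_nonneg (by linarith) hb.le
  set K := k₁ + k₂ ^ |s| * k₂ ^ |t| + k₂ ^ |u| with hK
  have e0 : ∀ r : ℝ, 1 ≤ k₂ ^ |r| := fun r => Real.one_le_rpow hk₂ (abs_nonneg _)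
  have e1 : 1 ≤ k₂ ^ |s| * k₂ ^ |t| := one_le_mul_of_one_le_of_one_le (e0 s) (e0 t)
  have e2 := e0 u
  refine ⟨measurable_dualFn hh.measurable, K, by linarith, fun p hp => ?_⟩
  have hp' : h p ≠ 0 := fun h0 => hp (dualFn_eq_zero h0)
  obtain ⟨⟨⟨c1, c2, c3⟩, c4⟩, -⟩ := H₁ p hp'
  obtain ⟨d1, d2, d3, d4, d5⟩ := H₂ p hp'
  have hkK : k₁ ≤ K := by linarith
  have hkK' : 1 / K ≤ 1 / k₁ := one_div_le_one_div_of_le (by linarith) hkK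
  have b1 := rpow_bounds hk₂ d1 d2 s
  have b2 := rpow_bounds hk₂ d4 d5 t
  have b3 := rpow_bounds hk₂ d4 d5 u
  refine ⟨⟨⟨c1, c2.trans hkK, hkK'.trans c3⟩, Metric.closedBall_subset_closedBall hkK c4⟩, ?_, ?_, ?_⟩
  · rw [norm_dualFn_eq ha hb hp']
    calc 1 / K ≤ 1 / (k₂ ^ |s| * k₂ ^ |t|) := one_div_le_one_div_of_le (by linarith) (by linarith)
      _ = 1 / k₂ ^ |s| * (1 / k₂ ^ |t|) := by rw [one_div_mul_one_div]
      _ ≤ _ := mul_le_mul b1.1 b2.1 (one_div_nonneg.2 (by linarith [e0 t])) (by positivity)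
  · rw [norm_dualFn_eq ha hb hp']
    calc _ ≤ k₂ ^ |s| * k₂ ^ |t| := mul_le_mul b1.2 b2.2 (by positivity) (by linarith [e0 s])
      _ ≤ K := by linarith
  · rw [pn_twist (β := 1 - b) ha hb (by linarith) (by linarith) hh (fun p hp => dualFn_eq_zero hp)
      (fun p hp => norm_dualFn_eq ha hb hp), ← ENNReal.ofReal_toReal d3, ENNReal.ofReal_rpow_of_nonneg
      ENNReal.toReal_nonneg hu0]
    refine ENNReal.ofReal_le_ofReal (le_trans ?_ b3.1)
    exact one_div_le_one_div_of_le (by linarith) (by linarith)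

theorem mn_dualFn {ν a b : ℝ} (ha : 0 < a) (ha1 : a < 1) (hb : 0 < b) (hb1 : b < 1)
    {h : (Fin (m + 2) → ℝ) × (Fin (m + 2) → ℝ) → ℂ} (hh : Nice a h) :
    mn ν (1 - a) (1 - b) (dualFn a b h) = mn ν a b h ^ ((1 - b) / b) :=
  mn_twist ha hb (by linarith) (by linarith) hh (fun _ hp => dualFn_eq_zero hp)
    (fun _ hp => norm_dualFn_eq ha hb hp)

theorem mn_one_one {ν : ℝ} {f : (Fin (m + 2) → ℝ) × (Fin (m + 2) → ℝ) → ℂ} (hf : Measurable f) :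
    mn ν 1 1 f = ∫⁻ p, ‖f p‖ₑ ∂(tubeMeasure m ν) := by
  rw [lintegral_tubeMeasure hf.enorm]
  simp [mn, pn]

theorem enorm_integral_mul_dualFn {ν a b : ℝ} (ha : 0 < a) (ha1 : a < 1) (hb : 0 < b) (hb1 : b < 1)
    {h : (Fin (m + 2) → ℝ) × (Fin (m + 2) → ℝ) → ℂ} (hh : Nice a h) :
    ‖∫ p, h p * dualFn a b h p ∂(tubeMeasure m ν)‖ₑ = mn ν a b h ^ (1 / b) := by
  have hm := hh.measurable
  have hd := nice_dualFn ha ha1 hb hb1 hh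
  have hdm := hd.measurable
  obtain ⟨k, hk, H⟩ := hd.exists_bound
  have hint : Integrable (fun p => h p * dualFn a b h p) (tubeMeasure m ν) := by
    refine ((hh.adm ν).mul_bdd hdm (R := k) fun p => ?_).integrable
    by_cases hp : dualFn a b h p = 0
    · rw [hp, norm_zero]
      linarith
    · exact (H p hp).2.2.1
  have e : ∫ p, h p * dualFn a b h p ∂(tubeMeasure m ν) =
      ((∫ p, ‖h p * dualFn a b h p‖ ∂(tubeMeasure m ν) : ℝ) : ℂ) := by
    rw [← integral_complex_ofReal]
    congr 1
    ext p
    rw [mul_dualFn, Complex.norm_real, Real.norm_of_nonneg (by positivity)]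
  rw [e, ← ofReal_norm, Complex.norm_real, Real.norm_of_nonneg (by positivity),
    ofReal_integral_norm_eq_lintegral_enorm hint, ← mn_one_one (by fun_prop)]
  refine mn_twist ha hb one_pos one_pos hh (fun p hp => by simp [hp]) fun p hp => ?_
  have hp' := norm_pos_iff.2 hp
  rw [norm_mul, norm_dualFn hp, ← mul_assoc, show 1 / a = 1 + (1 / a - 1) by ring,
    Real.rpow_add hp', Real.rpow_one]
  ring_nf

theorem mn_le_of_dual {ν a b : ℝ} (ha : 0 < a) (ha1 : a < 1) (hb : 0 < b) (hb1 : b < 1)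
    {H : (Fin (m + 2) → ℝ) × (Fin (m + 2) → ℝ) → ℂ} (hH : Measurable H) {D : ℝ≥0∞}
    (hD : ∀ g, Nice (1 - a) g → ‖∫ p, H p * g p ∂(tubeMeasure m ν)‖ₑ ≤ D * mn ν (1 - a) (1 - b) g) :
    mn ν a b H ≤ D := by
  refine mn_le_of_tendsto ha hb (fun j => measurable_trunc hH j) (ae_eventually_trunc_eq ν ha hH)
    fun j => ?_
  have hn : Nice a (trunc a j H) := nice_trunc hH j
  have h1 := hD _ (nice_dualFn ha ha1 hb hb1 hn)
  have e : ∀ p, H p * dualFn a b (trunc a j H) p = trunc a j H p * dualFn a b (trunc a j H) p := by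
    intro p
    rcases trunc_eq_or a j H p with h | h
    · rw [h]
    · rw [dualFn_eq_zero h, mul_zero, mul_zero]
  simp only [e] at h1
  rw [enorm_integral_mul_dualFn ha ha1 hb hb1 hn, mn_dualFn ha ha1 hb hb1 hn] at h1
  have ht := (hn.mn_lt_top ν ha hb).ne
  rcases eq_or_ne (mn ν a b (trunc a j H)) 0 with h0 | h0
  · rw [h0]
    exact zero_le
  · have h2 : mn ν a b (trunc a j H) ^ (1 / b) =
        mn ν a b (trunc a j H) * mn ν a b (trunc a j H) ^ ((1 - b) / b) := by
      conv_rhs => rw [← ENNReal.rpow_one (mn ν a b (trunc a j H)), ← ENNReal.rpow_mul, one_mul]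
      rw [← ENNReal.rpow_add _ _ h0 ht]
      congr 1
      field_simp
      ring
    rw [h2] at h1
    have h3 : mn ν a b (trunc a j H) ^ ((1 - b) / b) ≠ 0 := by
      simp [ENNReal.rpow_eq_zero_iff, h0, ht]
    exact (ENNReal.mul_le_mul_iff_left h3
      (ENNReal.rpow_ne_top_of_nonneg (div_nonneg (by linarith) hb.le) ht)).1 h1

end dual

section extension

variable {m : ℕ}

theorem exists_lintegral_kern_mul_fibre_le {ν a : ℝ} (hν : (m : ℝ) / 2 < ν) (ha : 0 < a)
    (ha1 : a ≤ 1) : ∃ K : ℝ, 0 < K ∧ ∀ w ∈ lightCone (m + 2), ∀ x : Fin (m + 2) → ℝ,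
      ∀ φ : (Fin (m + 2) → ℝ) → ℂ, Measurable φ →
      ∫⁻ u, ‖kern ν (x - u) w‖ₑ * ‖φ u‖ₑ ≤
        ENNReal.ofReal (K * lorentzQ (m + 2) w ^ (-(ν + (m / 2 + 1) * a))) *
          (∫⁻ u, ‖φ u‖ₑ ^ (1 / a)) ^ a := by
  have hsup : ∀ w ∈ lightCone (m + 2), ∀ x : Fin (m + 2) → ℝ, ‖kern ν x w‖ₑ ≤
      ENNReal.ofReal (lorentzQ (m + 2) w ^ (-(ν + m / 2 + 1))) := fun w hw x => by
    rw [← ofReal_norm]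
    exact ENNReal.ofReal_le_ofReal (norm_kern_le hν x hw)
  rcases eq_or_lt_of_le ha1 with rfl | ha1
  · refine ⟨1, one_pos, fun w hw x φ hφ => ?_⟩
    rw [one_mul, mul_one, ← add_assoc]
    simp only [div_one, ENNReal.rpow_one]
    rw [← lintegral_const_mul _ (by fun_prop)]
    exact lintegral_mono fun u => mul_le_mul' (hsup w hw _) le_rfl
  · obtain ⟨K, hK, HK⟩ := exists_lintegral_kern_le hν
    have hc : (0 : ℝ) < 1 - a := by linarith
    have hconj : (1 / (1 - a)).HolderConjugate (1 / a) := by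
      rw [Real.holderConjugate_iff]
      refine ⟨by rw [lt_div_iff₀ hc]; linarith, ?_⟩
      simp
    refine ⟨K ^ (1 - a), by positivity, fun w hw x φ hφ => ?_⟩
    have hQ := Q_pos hw
    have h := ENNReal.lintegral_mul_le_Lp_mul_Lq volume hconj (f := fun u => ‖kern ν (x - u) w‖ₑ)
      (g := fun u => ‖φ u‖ₑ) (Measurable.aemeasurable (by fun_prop)) (by fun_prop)
    rw [one_div_one_div, one_div_one_div] at h
    refine h.trans ?_
    gcongr
    have e : 1 / (1 - a) = a / (1 - a) + 1 := by field_simp; ring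
    have hpos : 0 ≤ a / (1 - a) := by positivity
    calc (∫⁻ u, ‖kern ν (x - u) w‖ₑ ^ (1 / (1 - a))) ^ (1 - a)
        = (∫⁻ u, ‖kern ν u w‖ₑ ^ (1 / (1 - a))) ^ (1 - a) := by
          rw [lintegral_sub_left_eq_self (fun u => ‖kern ν u w‖ₑ ^ (1 / (1 - a)))]
      _ ≤ (∫⁻ u, ENNReal.ofReal (lorentzQ (m + 2) w ^ (-(ν + m / 2 + 1))) ^ (a / (1 - a)) *
            ‖kern ν u w‖ₑ) ^ (1 - a) := by
          gcongr with u
          rw [e, ENNReal.rpow_add_of_nonneg _ _ hpos one_pos.le, ENNReal.rpow_one]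
          gcongr
          exact hsup w hw u
      _ ≤ (ENNReal.ofReal (lorentzQ (m + 2) w ^ (-(ν + m / 2 + 1))) ^ (a / (1 - a)) *
            ENNReal.ofReal (K * lorentzQ (m + 2) w ^ (-ν))) ^ (1 - a) := by
          rw [lintegral_const_mul _ (by fun_prop)]
          gcongr
          exact HK w hw
      _ = _ := by
          rw [ENNReal.ofReal_rpow_of_nonneg (by positivity) hpos, ← ENNReal.ofReal_mul
            (by positivity), ENNReal.ofReal_rpow_of_nonneg (by positivity) hc.le,
            ← Real.rpow_mul hQ.le, mul_left_comm, ← Real.rpow_add hQ,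
            Real.mul_rpow hK.le (by positivity), ← Real.rpow_mul hQ.le]
          congr 3
          field_simp
          ring

/-- The integral defining the Bergman operator, dominated in absolute value. -/
theorem exists_lintegral_kern_mul_le {ν a b : ℝ} (hν : (m : ℝ) / 2 < ν) (ha : 0 < a)
    (ha1 : a ≤ 1) (hb : 0 < b) (hb1 : b < 1) (hab : m / 2 - (m / 2 + 1) * a < b * (ν + m / 2)) :
    ∃ K : ℝ≥0∞, K ≠ ∞ ∧ ∃ s : ℝ, 0 ≤ s ∧
      ∀ f : (Fin (m + 2) → ℝ) × (Fin (m + 2) → ℝ) → ℂ, Measurable f →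
      ∀ y ∈ lightCone (m + 2), ∀ x : Fin (m + 2) → ℝ,
      ∫⁻ p, ‖kern ν (x - p.2) (y + p.1)‖ₑ * ‖f p‖ₑ ∂(tubeMeasure m ν) ≤
        K * ENNReal.ofReal (lorentzQ (m + 2) y ^ (-s)) * mn ν a b f := by
  have hm : (0 : ℝ) ≤ m / 2 := by positivity
  set α := ν + (m / 2 + 1) * a with hα
  have hc : (0 : ℝ) < 1 - b := by linarith
  obtain ⟨K, hK, HK⟩ := exists_lintegral_kern_mul_fibre_le hν ha ha1
  obtain ⟨C, hC, HC⟩ := exists_lintegral_coneMeasure_Q_add_rpow_le (m := m) (a := α / (1 - b)) hν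
    (by rw [lt_div_iff₀ hc]; linarith)
  have hconj : (1 / (1 - b)).HolderConjugate (1 / b) := by
    rw [Real.holderConjugate_iff]
    refine ⟨by rw [lt_div_iff₀ hc]; linarith, ?_⟩
    simp
  refine ⟨ENNReal.ofReal (K * C ^ (1 - b)), ENNReal.ofReal_ne_top, α - ν * (1 - b), ?_,
    fun f hf y hy x => ?_⟩
  · have h0 : 0 ≤ ν * b := mul_nonneg (by linarith) hb.le
    have h1 : 0 ≤ (m / 2 + 1) * a := by positivity
    linarith
  have hQ := Q_pos hy
  have hmQ : Measurable fun v => ENNReal.ofReal (lorentzQ (m + 2) (y + v) ^ (-α)) := by fun_prop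
  calc ∫⁻ p, ‖kern ν (x - p.2) (y + p.1)‖ₑ * ‖f p‖ₑ ∂(tubeMeasure m ν)
      = ∫⁻ v, (∫⁻ u, ‖kern ν (x - u) (y + v)‖ₑ * ‖f (v, u)‖ₑ) ∂(coneMeasure m ν) :=
        lintegral_tubeMeasure (by fun_prop)
    _ ≤ ∫⁻ v, ENNReal.ofReal K * (ENNReal.ofReal (lorentzQ (m + 2) (y + v) ^ (-α)) * pn a f v)
          ∂(coneMeasure m ν) := by
        refine lintegral_coneMeasure_mono fun v hv => ?_
        rw [← mul_assoc, ← ENNReal.ofReal_mul hK.le]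
        exact HK _ (add_mem_lightCone hy hv) x (fun u => f (v, u)) (by fun_prop)
    _ ≤ ENNReal.ofReal K * ((∫⁻ v, ENNReal.ofReal (lorentzQ (m + 2) (y + v) ^ (-α)) ^ (1 / (1 - b))
          ∂(coneMeasure m ν)) ^ (1 - b) * mn ν a b f) := by
        rw [lintegral_const_mul _ (by fun_prop)]
        gcongr
        have h := ENNReal.lintegral_mul_le_Lp_mul_Lq (coneMeasure m ν) hconj
          hmQ.aemeasurable (measurable_pn (a := a) hf).aemeasurable
        rw [one_div_one_div, one_div_one_div] at h
        exact h
    _ = ENNReal.ofReal K * ((∫⁻ v, ENNReal.ofReal (lorentzQ (m + 2) (y + v) ^ (-(α / (1 - b))))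
          ∂(coneMeasure m ν)) ^ (1 - b) * mn ν a b f) := by
        congr 3
        refine lintegral_coneMeasure_congr fun v hv => ?_
        have hQ' := Q_pos (add_mem_lightCone hy hv)
        rw [ENNReal.ofReal_rpow_of_nonneg (by positivity) (by positivity), ← Real.rpow_mul hQ'.le]
        congr 2
        field_simp
    _ ≤ ENNReal.ofReal K * (ENNReal.ofReal (C * lorentzQ (m + 2) y ^ (ν - α / (1 - b))) ^ (1 - b) *
          mn ν a b f) := by
        gcongr
        exact HC y hy
    _ = _ := by
        rw [ENNReal.ofReal_rpow_of_nonneg (by positivity) hc.le, ← mul_assoc,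
          ← ENNReal.ofReal_mul hK.le, ← ENNReal.ofReal_mul (by positivity),
          Real.mul_rpow hC.le (by positivity), ← Real.rpow_mul hQ.le]
        congr 2
        rw [← mul_assoc]
        congr 2
        field_simp
        ring

/-- The Bergman operator in the coordinates `(y, x)`. -/
def berg (ν : ℝ) (f : (Fin (m + 2) → ℝ) × (Fin (m + 2) → ℝ) → ℂ)
    (p : (Fin (m + 2) → ℝ) × (Fin (m + 2) → ℝ)) : ℂ :=
  ∫ q, kern ν (p.2 - q.2) (p.1 + q.1) * f q ∂(tubeMeasure m ν)

theorem measurable_berg {ν : ℝ} {f : (Fin (m + 2) → ℝ) × (Fin (m + 2) → ℝ) → ℂ}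
    (hf : Measurable f) : Measurable (berg ν f) := by
  unfold berg
  have h : Measurable fun P : ((Fin (m + 2) → ℝ) × (Fin (m + 2) → ℝ)) ×
      ((Fin (m + 2) → ℝ) × (Fin (m + 2) → ℝ)) => kern ν (P.1.2 - P.2.2) (P.1.1 + P.2.1) * f P.2 := by
    fun_prop
  exact (h.stronglyMeasurable.integral_prod_right' (ν := tubeMeasure m ν)).measurable

theorem integrable_bil_of_mn {ν a b : ℝ} (hν : (m : ℝ) / 2 < ν) (ha : 0 < a)
    (ha1 : a ≤ 1) (hb : 0 < b) (hb1 : b < 1) (hab : m / 2 - (m / 2 + 1) * a < b * (ν + m / 2))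
    {f g : (Fin (m + 2) → ℝ) × (Fin (m + 2) → ℝ) → ℂ} (hf : Measurable f)
    (hf' : mn ν a b f ≠ ∞) (hg : Adm ν g) :
    Integrable (fun P => bilKernel ν P * (f P.2 * g P.1))
      ((tubeMeasure m ν).prod (tubeMeasure m ν)) := by
  obtain ⟨K, hK, s, hs, H⟩ := exists_lintegral_kern_mul_le hν ha ha1 hb hb1 hab
  have hmg := hg.measurable
  obtain ⟨k, hk, Hk⟩ := hg.exists_le
  have hmem : ∀ᵐ p ∂(tubeMeasure m ν), p.1 ∈ lightCone (m + 2) :=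
    Measure.quasiMeasurePreserving_fst.ae (ae_mem_lightCone ν)
  have hm1 : Measurable fun P : ((Fin (m + 2) → ℝ) × (Fin (m + 2) → ℝ)) ×
      ((Fin (m + 2) → ℝ) × (Fin (m + 2) → ℝ)) => bilKernel ν P * (f P.2 * g P.1) := by fun_prop
  refine ⟨hm1.aestronglyMeasurable, ?_⟩
  rw [hasFiniteIntegral_iff_enorm, lintegral_prod _ hm1.enorm.aemeasurable]
  calc ∫⁻ p, ∫⁻ q, ‖bilKernel ν (p, q) * (f q * g p)‖ₑ ∂(tubeMeasure m ν) ∂(tubeMeasure m ν)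
      ≤ ∫⁻ p, K * ENNReal.ofReal (k ^ (-s)) * mn ν a b f * ‖g p‖ₑ ∂(tubeMeasure m ν) := by
        refine lintegral_mono_ae (hmem.mono fun p hp => ?_)
        simp only [enorm_mul, ← mul_assoc]
        rw [lintegral_mul_const _ (by fun_prop)]
        by_cases h0 : g p = 0
        · simp [h0]
        · refine mul_le_mul' ((H f hf p.1 hp p.2).trans ?_) le_rfl
          gcongr K * ENNReal.ofReal ?_ * _
          exact Real.rpow_le_rpow_of_nonpos hk (Hk p h0) (by linarith)
    _ < ∞ := by
        rw [lintegral_const_mul _ (by fun_prop)]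
        exact ENNReal.mul_lt_top (ENNReal.mul_lt_top (ENNReal.mul_lt_top hK.lt_top
          ENNReal.ofReal_lt_top) hf'.lt_top) hg.integrable.2

theorem enorm_bil_le_of_boundNice {ν a b : ℝ} (hν : (m : ℝ) / 2 < ν) (ha : 0 < a)
    (ha1 : a < 1) (hb : 0 < b) (hb1 : b < 1) (hab : m / 2 - (m / 2 + 1) * a < b * (ν + m / 2))
    {C : ℝ≥0∞} (hC : ∀ f g : (Fin (m + 2) → ℝ) × (Fin (m + 2) → ℝ) → ℂ,
      Nice a f → Nice (1 - a) g → ‖bil ν f g‖ₑ ≤ C * mn ν a b f * mn ν (1 - a) (1 - b) g)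
    {f g : (Fin (m + 2) → ℝ) × (Fin (m + 2) → ℝ) → ℂ} (hf : Measurable f)
    (hf' : mn ν a b f ≠ ∞) (hg : Nice (1 - a) g) :
    ‖bil ν f g‖ₑ ≤ C * mn ν a b f * mn ν (1 - a) (1 - b) g := by
  have hint := integrable_bil_of_mn hν ha ha1.le hb hb1 hab hf hf' (hg.adm ν)
  have hmg := hg.measurable
  have hlim : Filter.Tendsto (fun j => bil ν (trunc a j f) g) Filter.atTop (nhds (bil ν f g)) := by
    unfold bil
    refine tendsto_integral_of_dominated_convergence _ (fun j => ?_) hint.norm (fun j => ?_) ?_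
    · have := measurable_trunc (a := a) hf j
      exact Measurable.aestronglyMeasurable (by fun_prop)
    · refine Filter.Eventually.of_forall fun P => ?_
      rw [norm_mul, norm_mul, norm_mul, norm_mul]
      gcongr
      rcases trunc_eq_or a j f P.2 with h | h <;> simp [h]
    · have h : ∀ᵐ P ∂((tubeMeasure m ν).prod (tubeMeasure m ν)),
          ∀ᶠ j in Filter.atTop, trunc a j f P.2 = f P.2 :=
        Measure.quasiMeasurePreserving_snd.ae (ae_eventually_trunc_eq ν ha hf)
      exact h.mono fun P hP => tendsto_const_nhds.congr' (hP.mono fun j hj => by simp only [hj])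
  refine le_of_tendsto ((continuous_enorm.tendsto _).comp hlim) (Filter.Eventually.of_forall
    fun j => ?_)
  refine (hC _ _ (nice_trunc hf j) hg).trans ?_
  gcongr
  exact mn_mono ha hb (enorm_trunc_le a j f)

theorem integral_berg_mul {ν : ℝ} {f g : (Fin (m + 2) → ℝ) × (Fin (m + 2) → ℝ) → ℂ}
    (h : Integrable (fun P => bilKernel ν P * (f P.2 * g P.1))
      ((tubeMeasure m ν).prod (tubeMeasure m ν))) :
    ∫ p, berg ν f p * g p ∂(tubeMeasure m ν) = bil ν f g := by
  unfold bil
  rw [integral_prod _ h]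
  refine integral_congr_ae (Filter.Eventually.of_forall fun p => ?_)
  simp only [berg]
  rw [← integral_mul_const]
  simp only [bilKernel, mul_assoc]

theorem exists_mn_berg_le {ν a b κ : ℝ} (hm : 0 < m) (hν : (m : ℝ) / 2 < ν)
    (hκ : κ = 1 / (1 + ν / (m / 2))) (ha0 : 0 < a) (ha1 : a < 1) (hb0 : 0 < b) (hb1 : b < 1)
    (hab : m / 2 - (m / 2 + 1) * a < b * (ν + m / 2))
    (h1 : a * κ < b) (h2 : (1 - a) * κ < b) (h3 : a * κ < 1 - b) (h4 : (1 - a) * κ < 1 - b) :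
    ∃ C : ℝ≥0∞, C ≠ ∞ ∧ ∀ f : (Fin (m + 2) → ℝ) × (Fin (m + 2) → ℝ) → ℂ, Measurable f →
      mn ν a b f ≠ ∞ → mn ν a b (berg ν f) ≤ C * mn ν a b f := by
  obtain ⟨C, hC, H⟩ := boundNice hm hν hκ ha0 ha1 h1 h2 h3 h4
  refine ⟨C, hC, fun f hf hf' => mn_le_of_dual ha0 ha1 hb0 hb1 (measurable_berg hf) fun g hg => ?_⟩
  rw [integral_berg_mul (integrable_bil_of_mn hν ha0 ha1.le hb0 hb1 hab hf hf' (hg.adm ν))]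
  exact enorm_bil_le_of_boundNice hν ha0 ha1 hb0 hb1 hab H hf hf' hg

theorem exists_mn_one_berg_le {ν b : ℝ} (hm : 0 < m) (hν : (m : ℝ) / 2 < ν) (hb0 : 0 < b)
    (hb1 : b < 1) (h1 : 1 / b < 1 + ν / (m / 2)) (h2 : 1 / (1 - b) < 1 + ν / (m / 2)) :
    ∃ C : ℝ≥0∞, C ≠ ∞ ∧ ∀ f : (Fin (m + 2) → ℝ) × (Fin (m + 2) → ℝ) → ℂ, Measurable f →
      mn ν 1 b (berg ν f) ≤ C * mn ν 1 b f := by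
  obtain ⟨K, hK, HK⟩ := exists_lintegral_kern_le hν
  have hconj : (1 / b).HolderConjugate (1 / (1 - b)) := by
    rw [Real.holderConjugate_iff]
    refine ⟨by rw [lt_div_iff₀ hb0]; linarith, ?_⟩
    simp
  obtain ⟨S, hS, HS⟩ := exists_lintegral_coneMeasure_schur hm hν hconj h1 h2
  refine ⟨ENNReal.ofReal K * S ^ b, ENNReal.mul_ne_top ENNReal.ofReal_ne_top
    (ENNReal.rpow_ne_top_of_nonneg hb0.le hS), fun f hf => ?_⟩
  have hb' : 0 ≤ 1 / b := by positivity
  have hpn : ∀ y ∈ lightCone (m + 2), pn 1 (berg ν f) y ≤ ENNReal.ofReal K *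
      ∫⁻ v, ENNReal.ofReal (lorentzQ (m + 2) (y + v) ^ (-ν)) * pn 1 f v ∂(coneMeasure m ν) := by
    intro y hy
    have hpn1 : ∀ (g : (Fin (m + 2) → ℝ) × (Fin (m + 2) → ℝ) → ℂ) y, pn 1 g y = ∫⁻ x, ‖g (y, x)‖ₑ :=
      fun g y => by simp [pn]
    simp only [hpn1]
    have hmk : ∀ v, Measurable fun p : (Fin (m + 2) → ℝ) × (Fin (m + 2) → ℝ) =>
        ‖kern ν (p.1 - p.2) (y + v)‖ₑ * ‖f (v, p.2)‖ₑ := fun v => by fun_prop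
    calc ∫⁻ x, ‖berg ν f (y, x)‖ₑ
        ≤ ∫⁻ x, ∫⁻ v, (∫⁻ u, ‖kern ν (x - u) (y + v)‖ₑ * ‖f (v, u)‖ₑ) ∂(coneMeasure m ν) := by
          refine lintegral_mono fun x => (enorm_integral_le_lintegral_enorm _).trans (le_of_eq ?_)
          simp only [enorm_mul]
          exact lintegral_tubeMeasure (by fun_prop)
      _ = ∫⁻ v, (∫⁻ x, ∫⁻ u, ‖kern ν (x - u) (y + v)‖ₑ * ‖f (v, u)‖ₑ) ∂(coneMeasure m ν) := by
          refine lintegral_lintegral_swap (Measurable.aemeasurable ?_)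
          exact Measurable.lintegral_prod_right' (f := fun q : ((Fin (m + 2) → ℝ) ×
            (Fin (m + 2) → ℝ)) × (Fin (m + 2) → ℝ) =>
            ‖kern ν (q.1.1 - q.2) (y + q.1.2)‖ₑ * ‖f (q.1.2, q.2)‖ₑ) (by fun_prop)
      _ ≤ ∫⁻ v, ENNReal.ofReal K * (ENNReal.ofReal (lorentzQ (m + 2) (y + v) ^ (-ν)) *
            ∫⁻ u, ‖f (v, u)‖ₑ) ∂(coneMeasure m ν) := by
          refine lintegral_coneMeasure_mono fun v hv => ?_
          rw [lintegral_lintegral_swap (hmk v).aemeasurable, ← mul_assoc,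
            ← ENNReal.ofReal_mul hK.le, ← lintegral_const_mul _ (by fun_prop)]
          refine lintegral_mono fun u => ?_
          rw [lintegral_mul_const _ (by fun_prop),
            lintegral_sub_right_eq_self (fun x => ‖kern ν x (y + v)‖ₑ)]
          gcongr
          exact HK _ (add_mem_lightCone hy hv)
      _ = _ := by
          have hml : Measurable fun v => ∫⁻ u, ‖f (v, u)‖ₑ :=
            Measurable.lintegral_prod_right' (f := fun q => ‖f q‖ₑ) (by fun_prop)
          rw [lintegral_const_mul _ (by fun_prop)]
  have hm2 : Measurable fun p : (Fin (m + 2) → ℝ) × (Fin (m + 2) → ℝ) =>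
      ENNReal.ofReal (lorentzQ (m + 2) (p.1 + p.2) ^ (-ν)) * pn 1 f p.2 := by fun_prop
  have hm3 : Measurable fun y => ∫⁻ v, ENNReal.ofReal (lorentzQ (m + 2) (y + v) ^ (-ν)) *
    pn 1 f v ∂(coneMeasure m ν) := hm2.lintegral_prod_right'
  calc mn ν 1 b (berg ν f)
      ≤ (∫⁻ y, (ENNReal.ofReal K * ∫⁻ v, ENNReal.ofReal (lorentzQ (m + 2) (y + v) ^ (-ν)) *
          pn 1 f v ∂(coneMeasure m ν)) ^ (1 / b) ∂(coneMeasure m ν)) ^ b := by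
        unfold mn
        exact ENNReal.rpow_le_rpow (lintegral_coneMeasure_mono fun y hy =>
          ENNReal.rpow_le_rpow (hpn y hy) hb') hb0.le
    _ ≤ (ENNReal.ofReal K ^ (1 / b) * (S * ∫⁻ v, pn 1 f v ^ (1 / b) ∂(coneMeasure m ν))) ^ b := by
        simp only [ENNReal.mul_rpow_of_nonneg _ _ hb']
        rw [lintegral_const_mul _ (by fun_prop)]
        gcongr
        exact HS _ (measurable_pn hf)
    _ = _ := by
        rw [ENNReal.mul_rpow_of_nonneg _ _ hb0.le, ENNReal.mul_rpow_of_nonneg _ _ hb0.le,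
          ← ENNReal.rpow_mul, one_div_mul_cancel hb0.ne', ENNReal.rpow_one, mul_assoc]
        rfl

end extension

section bridge

variable {m : ℕ}

/-- A function on the tube domain, read in the coordinates `(y, x)`. -/
def coord (F : (Fin (m + 2) → ℂ) → ℂ) (p : (Fin (m + 2) → ℝ) × (Fin (m + 2) → ℝ)) : ℂ :=
  F (tubePt (m + 2) p.2 p.1)

theorem measurable_coord {F : (Fin (m + 2) → ℂ) → ℂ} (hF : Measurable F) :
    Measurable (coord F) := by
  refine hF.comp (measurable_pi_lambda _ fun k => ?_)
  unfold tubePt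
  fun_prop

theorem mixedNorm_eq_mn {p q ν : ℝ} (F : (Fin (m + 2) → ℂ) → ℂ)
    (hF : Measurable (coord F)) :
    mixedNorm (m + 2) p q ν F = mn ν (1 / p) (1 / q) (coord F) := by
  unfold mixedNorm mn
  rw [lintegral_coneMeasure (by fun_prop)]
  congr 1
  refine lintegral_congr fun y => ?_
  rw [mul_comm, pn, ← ENNReal.rpow_mul, one_div_one_div, one_div_one_div, one_div_mul_eq_div, wgt]
  push_cast
  rw [add_div, div_self (two_ne_zero' ℝ), ← sub_sub]
  rfl

theorem bergmanIntegrand_tubePt (ν : ℝ) (F : (Fin (m + 2) → ℂ) → ℂ) (x y u v : Fin (m + 2) → ℝ) :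
    bergmanIntegrand (m + 2) ν F (tubePt (m + 2) x y) (u, v) =
      (wgt m ν v) • (kern ν (x - u) (y + v) * coord F (v, u)) := by
  have h1 : (fun k => (tubePt (m + 2) x y k - ((u k : ℂ) - (v k : ℂ) * I)) / I) =
      zpt (x - u) (y + v) := by
    ext k
    rw [div_eq_iff I_ne_zero]
    simp only [tubePt, zpt, Pi.sub_apply, Pi.add_apply, Complex.ofReal_sub, Complex.ofReal_add]
    linear_combination ((x k : ℂ) - u k) * I_mul_I
  have h2 : ν + ((m + 2 : ℕ) : ℝ) / 2 = ν + m / 2 + 1 := by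
    push_cast
    ring
  have h3 : ν - ((m + 2 : ℕ) : ℝ) / 2 = ν - m / 2 - 1 := by
    push_cast
    ring
  unfold bergmanIntegrand
  simp only
  rw [h1, h2, h3, Complex.real_smul, mul_comm, Complex.ofReal_neg]
  rfl

theorem tubeMeasure_eq (ν : ℝ) : tubeMeasure m ν =
    (((volume.restrict (lightCone (m + 2))).prod volume).withDensity
      fun p => ENNReal.ofReal (wgt m ν p.1)) := by
  have : Measurable fun y : Fin (m + 2) → ℝ => ENNReal.ofReal (wgt m ν y) := by fun_prop
  unfold tubeMeasure coneMeasure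
  rw [prod_withDensity_left this]

theorem restrict_univ_prod :
    (volume : Measure ((Fin (m + 2) → ℝ) × (Fin (m + 2) → ℝ))).restrict (univ ×ˢ lightCone (m + 2)) =
      volume.prod (volume.restrict (lightCone (m + 2))) := by
  rw [Measure.volume_eq_prod, ← Measure.prod_restrict, Measure.restrict_univ]

theorem ae_wgt (ν : ℝ) : ∀ᵐ p ∂((volume.restrict (lightCone (m + 2))).prod
    (volume : Measure (Fin (m + 2) → ℝ))), (ENNReal.ofReal (wgt m ν p.1)).toReal = wgt m ν p.1 := by
  have h : ∀ᵐ y ∂((volume : Measure (Fin (m + 2) → ℝ)).restrict (lightCone (m + 2))),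
      (ENNReal.ofReal (wgt m ν y)).toReal = wgt m ν y := by
    refine (ae_restrict_mem measurableSet_lightCone).mono fun y hy => ?_
    have := Q_pos hy
    refine ENNReal.toReal_ofReal ?_
    unfold wgt
    positivity
  exact Measure.quasiMeasurePreserving_fst.ae h

theorem integrableOn_smul_iff {ν : ℝ} {G : (Fin (m + 2) → ℝ) × (Fin (m + 2) → ℝ) → ℂ} :
    IntegrableOn (fun uv => wgt m ν uv.2 • G uv.swap) (univ ×ˢ lightCone (m + 2)) ↔
      Integrable G (tubeMeasure m ν) := by
  have : Measurable fun p : (Fin (m + 2) → ℝ) × (Fin (m + 2) → ℝ) =>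
    ENNReal.ofReal (wgt m ν p.1) := by fun_prop
  rw [tubeMeasure_eq, integrable_withDensity_iff_integrable_smul' this
    (Filter.Eventually.of_forall fun _ => ENNReal.ofReal_lt_top), IntegrableOn, restrict_univ_prod,
    integrable_congr ((ae_wgt ν).mono fun p hp => by rw [hp] :
      _ =ᵐ[_] fun p => wgt m ν p.1 • G p), ← integrable_swap_iff]
  rfl

theorem setIntegral_smul_eq {ν : ℝ} (G : (Fin (m + 2) → ℝ) × (Fin (m + 2) → ℝ) → ℂ) :
    ∫ uv in univ ×ˢ lightCone (m + 2), wgt m ν uv.2 • G uv.swap = ∫ p, G p ∂(tubeMeasure m ν) := by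
  have : Measurable fun p : (Fin (m + 2) → ℝ) × (Fin (m + 2) → ℝ) =>
    ENNReal.ofReal (wgt m ν p.1) := by fun_prop
  rw [tubeMeasure_eq, integral_withDensity_eq_integral_toReal_smul this
    (Filter.Eventually.of_forall fun _ => ENNReal.ofReal_lt_top), restrict_univ_prod,
    integral_congr_ae ((ae_wgt ν).mono fun p hp => by rw [hp] :
      _ =ᵐ[_] fun p => wgt m ν p.1 • G p), ← integral_prod_swap]
  rfl

theorem bergmanOp_tubePt (ν : ℝ) (F : (Fin (m + 2) → ℂ) → ℂ) (x y : Fin (m + 2) → ℝ) :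
    bergmanOp (m + 2) ν F (tubePt (m + 2) x y) = berg ν (coord F) (y, x) := by
  unfold bergmanOp berg
  rw [← setIntegral_smul_eq]
  congr 1
  ext uv
  exact bergmanIntegrand_tubePt ν F x y uv.1 uv.2

theorem tubePt_re_im (z : Fin (m + 2) → ℂ) :
    tubePt (m + 2) (fun k => (z k).re) (fun k => (z k).im) = z := by
  ext k
  exact Complex.re_add_im _

theorem bergman_bounded {ν p q : ℝ} (hm : 0 < m) (hν : (m : ℝ) / 2 < ν) (hp : 1 ≤ p) {c : ℝ}
    (hc0 : 0 < c) (hc1 : c ≤ 1) (hca : 1 / p ≤ c) (hca' : 1 - 1 / p ≤ c)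
    (h1 : c * (1 / (1 + ν / (m / 2))) < 1 / q) (h2 : c * (1 / (1 + ν / (m / 2))) < 1 - 1 / q) :
    ∃ C : ℝ, 0 < C ∧
      ∀ F : (Fin (m + 2) → ℂ) → ℂ, Measurable F → mixedNorm (m + 2) p q ν F < ∞ →
        (∀ z : Fin (m + 2) → ℂ, inTube (m + 2) z →
            IntegrableOn (bergmanIntegrand (m + 2) ν F z) (univ ×ˢ lightCone (m + 2))) ∧
        mixedNorm (m + 2) p q ν (bergmanOp (m + 2) ν F) ≤
          ENNReal.ofReal C * mixedNorm (m + 2) p q ν F := by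
  have hm' : (0 : ℝ) < m / 2 := by positivity
  have hν0 : 0 < ν := hm'.trans hν
  set a := 1 / p with ha
  set b := 1 / q with hb
  set κ := 1 / (1 + ν / (m / 2)) with hκ
  have ha0 : 0 < a := by positivity
  have ha1 : a ≤ 1 := (div_le_one (by linarith)).2 hp
  have hκ0 : 0 < κ := by positivity
  have hcκ : 0 < c * κ := by positivity
  have hκN : κ * (ν + m / 2) = m / 2 := by
    rw [hκ]
    field_simp
    ring
  have hab : m / 2 - (m / 2 + 1) * a < b * (ν + m / 2) := by
    have e1 : c * κ * (ν + m / 2) < b * (ν + m / 2) := mul_lt_mul_of_pos_right h1 (by linarith)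
    rw [mul_assoc, hκN] at e1
    have e2 : (1 - a) * (m / 2) ≤ c * (m / 2) := mul_le_mul_of_nonneg_right hca' hm'.le
    linarith
  have hb0 : 0 < b := by linarith
  have hb1 : b < 1 := by linarith
  have ea : a * κ ≤ c * κ := mul_le_mul_of_nonneg_right hca hκ0.le
  have ea' : (1 - a) * κ ≤ c * κ := mul_le_mul_of_nonneg_right hca' hκ0.le
  obtain ⟨C, hC, H⟩ : ∃ C : ℝ≥0∞, C ≠ ∞ ∧ ∀ f : (Fin (m + 2) → ℝ) × (Fin (m + 2) → ℝ) → ℂ,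
      Measurable f → mn ν a b f ≠ ∞ → mn ν a b (berg ν f) ≤ C * mn ν a b f := by
    rcases eq_or_lt_of_le ha1 with h | h
    · have lt_of : ∀ t, κ < t → 1 / t < 1 + ν / (m / 2) := fun t ht => by
        have := one_div_lt_one_div_of_lt hκ0 ht
        rwa [hκ, one_div_one_div] at this
      rw [h, one_mul] at ea
      obtain ⟨C, hC, H⟩ := exists_mn_one_berg_le hm hν hb0 hb1 (lt_of _ (by linarith))
        (lt_of _ (by linarith))
      rw [h]
      exact ⟨C, hC, fun f hf _ => H f hf⟩
    · exact exists_mn_berg_le hm hν hκ ha0 h hb0 hb1 hab (by linarith) (by linarith) (by linarith)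
        (by linarith)
  refine ⟨C.toReal + 1, by positivity, fun F hF hFn => ?_⟩
  have hf := measurable_coord hF
  rw [mixedNorm_eq_mn F hf] at hFn ⊢
  constructor
  · intro z hz
    obtain ⟨K, hK, s, -, HK⟩ := exists_lintegral_kern_mul_le hν ha0 ha1 hb0 hb1 hab
    have hi : Integrable (fun p => kern ν ((fun k => (z k).re) - p.2) ((fun k => (z k).im) + p.1) *
        coord F p) (tubeMeasure m ν) := by
      refine ⟨Measurable.aestronglyMeasurable (by fun_prop), ?_⟩
      rw [hasFiniteIntegral_iff_enorm]
      simp only [enorm_mul]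
      exact (HK _ hf _ hz _).trans_lt
        (ENNReal.mul_lt_top (ENNReal.mul_lt_top hK.lt_top ENNReal.ofReal_lt_top) hFn)
    refine (integrableOn_smul_iff.2 hi).congr_fun_ae (Filter.Eventually.of_forall fun uv => ?_)
    have h := bergmanIntegrand_tubePt ν F (fun k => (z k).re) (fun k => (z k).im) uv.1 uv.2
    rw [tubePt_re_im] at h
    exact h.symm
  · have e : coord (bergmanOp (m + 2) ν F) = berg ν (coord F) := by
      ext p
      exact bergmanOp_tubePt ν F p.2 p.1
    rw [mixedNorm_eq_mn _ (by rw [e]; exact measurable_berg hf), e]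
    refine (H _ hf hFn.ne).trans ?_
    gcongr
    rw [← ENNReal.ofReal_toReal hC]
    exact ENNReal.ofReal_le_ofReal (by rw [ENNReal.toReal_ofReal]; all_goals simp)

end bridge
end LightCone

/-- For `n ≥ 3`, `ν > n/2 − 1`, `1 ≤ p < ∞` and
`(q_{ν,p})' < q < q_{ν,p}`, the Bergman-type operator `T_ν` is bounded on `L^{p,q}_ν`,
and its defining integral converges absolutely at every point of the tube. -/
theorem statement0 (n : ℕ) [NeZero n] (hn : 3 ≤ n) (ν p q : ℝ)
    (hν : (n : ℝ) / 2 - 1 < ν) (hp : 1 ≤ p)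
    (hq1 : pSharp p * qnu n ν / (pSharp p * qnu n ν - 1) < q)
    (hq2 : q < pSharp p * qnu n ν) :
    ∃ C : ℝ, 0 < C ∧
      ∀ F : (Fin n → ℂ) → ℂ, Measurable F → mixedNorm n p q ν F < ∞ →
        (∀ z : Fin n → ℂ, inTube n z →
            IntegrableOn (bergmanIntegrand n ν F z) (univ ×ˢ lightCone n)) ∧
        mixedNorm n p q ν (bergmanOp n ν F) ≤ ENNReal.ofReal C * mixedNorm n p q ν F := by
  obtain ⟨m, rfl⟩ : ∃ m, n = m + 2 := ⟨n - 2, by omega⟩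
  have hm : 0 < m := by omega
  have hm' : (0 : ℝ) < m / 2 := by positivity
  have hN : ((m + 2 : ℕ) : ℝ) / 2 - 1 = m / 2 := by
    push_cast
    ring
  rw [hN] at hν
  have hq : qnu (m + 2) ν = 1 + ν / (m / 2) := by
    unfold qnu
    rw [add_sub_assoc, hN]
    field_simp
    ring
  have hκ : 2 < 1 + ν / (m / 2) := by
    have : 1 < ν / (m / 2) := (one_lt_div hm').2 hν
    linarith
  rw [hq] at hq1 hq2
  set r := 1 + ν / (m / 2) with hr
  have hr0 : 0 < r := by linarith
  have key : ∀ S : ℝ, 1 ≤ S → S * r / (S * r - 1) < q → q < S * r →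
      1 / S * (1 / r) < 1 / q ∧ 1 / S * (1 / r) < 1 - 1 / q := by
    intro S hS h1 h2
    have hSr : 2 < S * r := by nlinarith
    have hq1 : 1 < q := lt_of_lt_of_le ((one_lt_div (by linarith)).2 (by linarith)) h1.le
    rw [one_div_mul_one_div]
    refine ⟨one_div_lt_one_div_of_lt (by linarith) h2, ?_⟩
    rw [div_lt_iff₀ (by linarith)] at h1
    rw [lt_sub_iff_add_lt, div_add_div _ _ (by linarith) (by linarith),
      div_lt_one (mul_pos (by linarith) (by linarith))]
    nlinarith
  have hp0 : 0 < p := by linarith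
  have hS : 1 ≤ pSharp p ∧ 1 / p ≤ 1 / pSharp p ∧ 1 - 1 / p ≤ 1 / pSharp p := by
    unfold pSharp
    split_ifs with h
    · refine ⟨hp, le_rfl, ?_⟩
      rw [sub_le_iff_le_add, ← add_div, le_div_iff₀ hp0]
      linarith
    · push Not at h
      have h1 : 1 - 1 / p = (p - 1) / p := by field_simp
      rw [one_div_div, h1]
      refine ⟨(one_le_div (by linarith)).2 (by linarith), ?_, le_rfl⟩
      gcongr
      linarith
  obtain ⟨h1, h2⟩ := key _ hS.1 hq1 hq2
  exact LightCone.bergman_bounded hm hν hp (one_div_pos.2 (by linarith [hS.1]))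
    ((div_le_one (by linarith [hS.1])).2 hS.1) hS.2.1 hS.2.2 h1 h2
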